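/- arXiv:2407.18577 — 2 statements merged into one kernel-verified Lean document; each statement's English description precedes it below -/
import Mathlib

section
/- Let p, q ≥ 1 and let Ω be a proper quasi-homogeneous domain of Ein^{p,q}. Then Ω is a diamond: there exists a linear automorphism g of ℝⁿ with Q(g v) = Q(v) for all v whose induced projective transformation maps the model diamond 𝔻 onto Ω. -/
noncomputable section

open scoped LinearAlgebra.Projectivization ENNReal
open Projectivization Filter Topology Set

variable {W : Type} [AddCommGroup W] [Module ℝ W] [TopologicalSpace W]

instance projTopology : TopologicalSpace (ℙ ℝ W) :=
  inferInstanceAs (TopologicalSpace (Quotient (projectivizationSetoid ℝ W)))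

/-- The null cone in projective space determined by a quadratic form `v ↦ Bf v v`. -/
def einSet (Bf : W → W → ℝ) : Set (ℙ ℝ W) := {x | Bf x.rep x.rep = 0}

/-- The lightcone of a point of the Einstein universe. -/
def lightcone (Bf : W → W → ℝ) (x : ℙ ℝ W) : Set (ℙ ℝ W) :=
  {y | y ∈ einSet Bf ∧ Bf x.rep y.rep = 0}

/-- A domain: nonempty connected open subset of the Einstein universe
(open and connected in the subspace topology of `einSet Bf`). -/
def IsEinDomain (Bf : W → W → ℝ) (Ω : Set (ℙ ℝ W)) : Prop :=
  Ω ⊆ einSet Bf ∧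
  IsOpen (Subtype.val ⁻¹' Ω : Set (einSet Bf)) ∧
  IsConnected (Subtype.val ⁻¹' Ω : Set (einSet Bf))

/-- A proper domain: some lightcone misses the closure. -/
def IsProperDomain (Bf : W → W → ℝ) (Ω : Set (ℙ ℝ W)) : Prop :=
  IsEinDomain Bf Ω ∧ ∃ x ∈ einSet Bf, closure Ω ∩ lightcone Bf x = ∅

/-- The projective transformation induced by a linear automorphism. -/
def projMap (g : W ≃ₗ[ℝ] W) : ℙ ℝ W → ℙ ℝ W :=
  Projectivization.map (g : W →ₗ[ℝ] W) g.injective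

/-- The conformal group of a domain. -/
def Conf (Bf : W → W → ℝ) (Ω : Set (ℙ ℝ W)) : Set (W ≃ₗ[ℝ] W) :=
  {g | (∀ v, Bf (g v) (g v) = Bf v v) ∧ projMap g '' Ω = Ω}

/-- Quasi-homogeneity of a domain. -/
def IsQuasiHomogeneous (Bf : W → W → ℝ) (Ω : Set (ℙ ℝ W)) : Prop :=
  ∃ K : Set (ℙ ℝ W), K ⊆ Ω ∧ IsCompact K ∧
    Ω = ⋃ g ∈ Conf Bf Ω, projMap g '' K

/-- Dual convexity: every frontier point admits a supporting lightcone. -/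
def IsDuallyConvex (Bf : W → W → ℝ) (Ω : Set (ℙ ℝ W)) : Prop :=
  ∀ a ∈ closure Ω \ Ω, ∃ b ∈ einSet Bf, a ∈ lightcone Bf b ∧ lightcone Bf b ∩ Ω = ∅

/-- The hyperbolic distance on the interval `(-1,1)`. -/
def dHyp (s t : ℝ) : ℝ := |Real.log (((1 + t) * (1 - s)) / ((1 - t) * (1 + s)))|

/-- The interval of parameters. -/
def II : Set ℝ := Set.Ioo (-1 : ℝ) 1

/-- A projectively parametrized lightlike geodesic with values in `Ω`. -/
def IsLightGeodesic (Bf : W → W → ℝ) (Ω : Set (ℙ ℝ W)) (α : ℝ → ℙ ℝ W) : Prop :=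
  ∃ (u w : W) (a b c d : ℝ),
    LinearIndependent ℝ ![u, w] ∧
    Bf u u = 0 ∧ Bf u w = 0 ∧ Bf w w = 0 ∧
    a * d - b * c ≠ 0 ∧
    ∀ t ∈ II, ∃ h : (a * t + b) • u + (c * t + d) • w ≠ 0,
      α t = Projectivization.mk ℝ ((a * t + b) • u + (c * t + d) • w) h ∧ α t ∈ Ω

/-- `IsChainCost Bf Ω x y N c` : there is a chain of index `N` from `x` to `y` in `Ω`
whose cost is `c`. -/
def IsChainCost (Bf : W → W → ℝ) (Ω : Set (ℙ ℝ W)) (x y : ℙ ℝ W) (N : ℕ) (c : ℝ) : Prop :=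
  ∃ (xs : Fin (N + 1) → ℙ ℝ W) (αs : Fin N → ℝ → ℙ ℝ W) (ss ts : Fin N → ℝ),
    xs 0 = x ∧ xs (Fin.last N) = y ∧
    (∀ i : Fin N, IsLightGeodesic Bf Ω (αs i) ∧ ss i ∈ II ∧ ts i ∈ II ∧
      αs i (ss i) = xs i.castSucc ∧ αs i (ts i) = xs i.succ) ∧
    c = ∑ i : Fin N, dHyp (ss i) (ts i)

/-- The Markowitz pseudodistance of `Ω`, with values in `[0,∞]`. -/
def markowitz (Bf : W → W → ℝ) (Ω : Set (ℙ ℝ W)) (x y : ℙ ℝ W) : ℝ≥0∞ :=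
  sInf {e | ∃ (N : ℕ) (c : ℝ), 1 ≤ N ∧ IsChainCost Bf Ω x y N c ∧ e = ENNReal.ofReal c}

/-- The Markowitz pseudodistance restricted to chains of index at most `Nmax`. -/
def markowitzN (Bf : W → W → ℝ) (Ω : Set (ℙ ℝ W)) (Nmax : ℕ) (x y : ℙ ℝ W) : ℝ≥0∞ :=
  sInf {e | ∃ (N : ℕ) (c : ℝ), 1 ≤ N ∧ N ≤ Nmax ∧ IsChainCost Bf Ω x y N c ∧
    e = ENNReal.ofReal c}

/-- The projectivization of a linear subspace. -/
def projSet (Pl : Submodule ℝ W) : Set (ℙ ℝ W) := {y | y.rep ∈ Pl}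

/-- A photon subspace: a totally isotropic plane. -/
def IsPhotonSub (Bf : W → W → ℝ) (Pl : Submodule ℝ W) : Prop :=
  Module.finrank ℝ Pl = 2 ∧ ∀ u ∈ Pl, ∀ w ∈ Pl, Bf u w = 0

/-- Photon-extremal points of the frontier of `Ω`. -/
def IsPhotonExtremal (Bf : W → W → ℝ) (Ω : Set (ℙ ℝ W)) (a : ℙ ℝ W) : Prop :=
  a ∈ closure Ω \ Ω ∧
  ∀ Pl : Submodule ℝ W, IsPhotonSub Bf Pl → a.rep ∈ Pl →
    ¬ ∃ U : Set (ℙ ℝ W), IsOpen U ∧ a ∈ U ∧ U ∩ projSet Pl ⊆ closure Ω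

/-- A maximal projectively parametrized lightlike geodesic in `Ω`: its image is
a connected component of `ℙ(Pl) ∩ Ω`. -/
def IsMaxLightGeodesic (Bf : W → W → ℝ) (Ω : Set (ℙ ℝ W)) (α : ℝ → ℙ ℝ W) : Prop :=
  ∃ (u w : W) (a b c d : ℝ),
    LinearIndependent ℝ ![u, w] ∧
    Bf u u = 0 ∧ Bf u w = 0 ∧ Bf w w = 0 ∧
    a * d - b * c ≠ 0 ∧
    (∀ t ∈ II, ∃ h : (a * t + b) • u + (c * t + d) • w ≠ 0,
      α t = Projectivization.mk ℝ ((a * t + b) • u + (c * t + d) • w) h ∧ α t ∈ Ω) ∧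
    α '' II = connectedComponentIn (projSet (Submodule.span ℝ {u, w}) ∩ Ω) (α 0)

/-- The coordinate bilinear form of signature `(p+1, q+1)` on `ℝⁿ`, `n = p+q+2`. -/
def bForm (p q : ℕ) (v w : Fin (p + q + 2) → ℝ) : ℝ :=
  ∑ i : Fin (p + q + 2), (if (i : ℕ) ≤ p then (-1 : ℝ) else 1) * v i * w i

/-! ### The product model of `ℝⁿ`, `n = p+q+2`, with `B = B₀ ⊕ B₁`. -/

/-- The bilinear form `B₀` of signature `(p,1)` on `ℝ^{p+1}`. -/
def b0 (p : ℕ) (v v' : Fin (p + 1) → ℝ) : ℝ :=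
  ∑ i : Fin (p + 1), (if (i : ℕ) < p then (-1 : ℝ) else 1) * v i * v' i

/-- The bilinear form `B₁` of signature `(1,q)` on `ℝ^{q+1}`. -/
def b1 (q : ℕ) (w w' : Fin (q + 1) → ℝ) : ℝ :=
  ∑ i : Fin (q + 1), (if (i : ℕ) < q then (1 : ℝ) else -1) * w i * w' i

/-- `ℝⁿ` written as pairs `(v, w)` with `v ∈ ℝ^{p+1}`, `w ∈ ℝ^{q+1}`. -/
abbrev PairV (p q : ℕ) := (Fin (p + 1) → ℝ) × (Fin (q + 1) → ℝ)

/-- The bilinear form `B = B₀ ⊕ B₁` of signature `(p+1, q+1)`. -/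
def bPair (p q : ℕ) (x y : PairV p q) : ℝ := b0 p x.1 y.1 + b1 q x.2 y.2

/-- The model diamond `𝔻 ⊆ Ein^{p,q}`. -/
def diamond (p q : ℕ) : Set (ℙ ℝ (PairV p q)) :=
  {x | ∃ (vw : PairV p q) (h : vw ≠ 0), x = Projectivization.mk ℝ vw h ∧
    b0 p vw.1 vw.1 = 1 ∧ 0 < vw.1 (Fin.last p) ∧
    b1 q vw.2 vw.2 = -1 ∧ 0 < vw.2 (Fin.last q)}

/-- The dual model diamond `𝔻' ⊆ Ein^{p,q}`. -/
def diamondDual (p q : ℕ) : Set (ℙ ℝ (PairV p q)) :=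
  {x | ∃ (vw : PairV p q) (h : vw ≠ 0), x = Projectivization.mk ℝ vw h ∧
    b0 p vw.1 vw.1 = 1 ∧ 0 < vw.1 (Fin.last p) ∧
    b1 q vw.2 vw.2 = -1 ∧ vw.2 (Fin.last q) < 0}

set_option linter.unusedSectionVars false

/-! ### Abstract part -/

theorem isCompact_convexHull_fd {X : Type*} [NormedAddCommGroup X] [NormedSpace ℝ X]
    [FiniteDimensional ℝ X] {A : Set X} (hA : IsCompact A) : IsCompact (convexHull ℝ A) := by
  classical
  rcases A.eq_empty_or_nonempty with rfl | ⟨a0, ha0⟩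
  · simp
  let n := Module.finrank ℝ X
  have h1 : IsCompact ((stdSimplex ℝ (Fin (n + 1))) ×ˢ (Set.univ.pi fun _ : Fin (n + 1) => A)) :=
    (isCompact_stdSimplex ℝ _).prod (isCompact_univ_pi fun _ => hA)
  have h2 : Continuous fun z : (Fin (n + 1) → ℝ) × (Fin (n + 1) → X) => ∑ i, z.1 i • z.2 i := by
    fun_prop
  convert h1.image h2 using 1
  ext x
  constructor
  · intro hx
    obtain ⟨ι, _, z, w, hz, hind, hw, hw1, hx⟩ := eq_pos_convex_span_of_mem_convexHull hx
    have hcard : Fintype.card ι ≤ Fintype.card (Fin (n + 1)) := by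
      have := hind.card_le_finrank_succ
      have h3 := Submodule.finrank_le (vectorSpan ℝ (Set.range z))
      simp only [Fintype.card_fin]
      omega
    obtain ⟨f⟩ := Function.Embedding.nonempty_of_card_le hcard
    refine ⟨(Function.extend f w 0, Function.extend f z fun _ => a0), ⟨⟨?_, ?_⟩, ?_⟩, ?_⟩
    · intro j
      by_cases hj : ∃ i, f i = j
      · obtain ⟨i, rfl⟩ := hj
        simpa [f.injective.extend_apply] using (hw i).le
      · simp [Function.extend_apply' _ _ _ hj]
    · rw [← hw1]
      symm
      apply Fintype.sum_of_injective f f.injective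
      · intro j hj
        exact Function.extend_apply' _ _ _ (by simpa using hj)
      · intro i
        simp [f.injective.extend_apply]
    · intro j _
      by_cases hj : ∃ i, f i = j
      · obtain ⟨i, rfl⟩ := hj
        simpa [f.injective.extend_apply] using hz ⟨i, rfl⟩
      · simpa [Function.extend_apply' _ _ _ hj] using ha0
    · rw [← hx]
      symm
      apply Fintype.sum_of_injective f f.injective
      · intro j hj
        simp only
        rw [Function.extend_apply' w _ _ (by simpa using hj)]
        simp
      · intro i
        simp [f.injective.extend_apply]
  · rintro ⟨⟨w, z⟩, ⟨⟨hw, hw1⟩, hz⟩, rfl⟩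
    exact (convex_convexHull ℝ A).sum_mem (fun i _ => hw i) hw1
      (fun i _ => subset_convexHull ℝ A (hz i (Set.mem_univ i)))

/-- Data extracted from a proper quasi-homogeneous domain. -/
structure EDat (X : Type*) [NormedAddCommGroup X] [NormedSpace ℝ X] where
  B : X →ₗ[ℝ] X →ₗ[ℝ] ℝ
  symm : ∀ x y, B x y = B y x
  nondeg : ∀ x, (∀ y, B x y = 0) → x = 0
  posd : ∀ y, ∃ x, B x y = 0 ∧ 0 < B x x
  negd : ∀ y, ∃ x, B x y = 0 ∧ B x x < 0
  C : Set X
  U : Set X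
  K : Set X
  G : Set (X ≃ₗ[ℝ] X)
  e : X
  δ : ℝ
  hδ : 0 < δ
  Uopen : IsOpen U
  memC : ∀ x, x ∈ C ↔ x ∈ U ∧ B x x = 0
  cone : ∀ x ∈ C, ∀ t : ℝ, 0 < t → t • x ∈ C
  ne : C.Nonempty
  ne0 : ∀ x ∈ C, x ≠ 0
  bd : ∀ x ∈ C, δ * ‖x‖ ≤ B e x
  Giso : ∀ g ∈ G, ∀ x y, B (g x) (g y) = B x y
  GC : ∀ g ∈ G, ∀ x, g x ∈ C ↔ x ∈ C
  Kc : IsCompact K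
  KC : K ⊆ C
  qh : ∀ x ∈ C, ∃ g ∈ G, ∃ k ∈ K, ∃ r : ℝ, 0 < r ∧ x = r • g k

namespace EDat

variable {X : Type*} [NormedAddCommGroup X] [NormedSpace ℝ X] [FiniteDimensional ℝ X] (d : EDat X)

theorem cont2 : Continuous fun z : X × X => d.B z.1 z.2 := by
  have := (LinearMap.toContinuousBilinearMap d.B).continuous₂
  exact this

theorem contl (x : X) : Continuous fun y => d.B x y :=
  d.cont2.comp (by fun_prop : Continuous fun y => (x, y))

theorem contr (y : X) : Continuous fun x => d.B x y :=
  d.cont2.comp (by fun_prop : Continuous fun x => (x, y))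

theorem contQ : Continuous fun x => d.B x x :=
  d.cont2.comp (by fun_prop : Continuous fun x => (x, x))

/-- The dual cone. -/
def Ds : Set X := {y | ∀ c ∈ d.C, 0 ≤ d.B y c}
/-- The bidual cone. -/
def D : Set X := {x | ∀ y ∈ d.Ds, 0 ≤ d.B y x}

theorem C_sub_D : d.C ⊆ d.D := fun _ hx _ hy => hy _ hx

theorem isClosed_Ds : IsClosed d.Ds := by
  have : d.Ds = ⋂ c ∈ d.C, {y | 0 ≤ d.B y c} := by ext; simp [Ds]
  rw [this]
  exact isClosed_biInter fun c _ => isClosed_le continuous_const (d.contr c)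

theorem isClosed_D : IsClosed d.D := by
  have : d.D = ⋂ c ∈ d.Ds, {y | 0 ≤ d.B c y} := by ext; simp [D]
  rw [this]
  exact isClosed_biInter fun c _ => isClosed_le continuous_const (d.contl c)

theorem Ds_add {x y : X} (hx : x ∈ d.Ds) (hy : y ∈ d.Ds) : x + y ∈ d.Ds := fun c hc => by
  have := hx c hc; have := hy c hc
  simp only [map_add, LinearMap.add_apply]; positivity

theorem Ds_smul {x : X} (hx : x ∈ d.Ds) {t : ℝ} (ht : 0 ≤ t) : t • x ∈ d.Ds := fun c hc => by
  have := hx c hc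
  simp only [map_smul, LinearMap.smul_apply, smul_eq_mul]; positivity

theorem D_add {x y : X} (hx : x ∈ d.D) (hy : y ∈ d.D) : x + y ∈ d.D := fun c hc => by
  have := hx c hc; have := hy c hc
  simp only [map_add]; positivity

theorem D_smul {x : X} (hx : x ∈ d.D) {t : ℝ} (ht : 0 ≤ t) : t • x ∈ d.D := fun c hc => by
  have := hx c hc
  simp only [map_smul, smul_eq_mul]; positivity

theorem convex_D : Convex ℝ d.D := fun _ hx _ hy _ _ ha hb _ =>
  d.D_add (d.D_smul hx ha) (d.D_smul hy hb)

theorem convex_Ds : Convex ℝ d.Ds := fun _ hx _ hy _ _ ha hb _ =>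
  d.Ds_add (d.Ds_smul hx ha) (d.Ds_smul hy hb)

theorem exists_rep (f : X →ₗ[ℝ] ℝ) : ∃ y, ∀ x, d.B y x = f x := by
  have hinj : Function.Injective d.B := by
    rw [injective_iff_map_eq_zero]
    intro x hx
    exact d.nondeg x fun y => by rw [hx]; rfl
  have hs : Function.Surjective d.B :=
    (LinearMap.injective_iff_surjective_of_finrank_eq_finrank
      (Subspace.dual_finrank_eq (K := ℝ) (V := X)).symm).1 hinj
  obtain ⟨y, hy⟩ := hs f
  exact ⟨y, fun x => by rw [hy]⟩

/-- `e` is interior to the dual cone. -/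
theorem e_int (u : X) : ∃ ε > 0, ∀ t : ℝ, |t| ≤ ε → d.e + t • u ∈ d.Ds := by
  let f : X →L[ℝ] ℝ := LinearMap.toContinuousLinearMap (d.B u)
  refine ⟨d.δ / (‖f‖ + 1), div_pos d.hδ (by positivity), fun t ht c hc => ?_⟩
  have h1 := d.bd c hc
  have h2 : |d.B u c| ≤ ‖f‖ * ‖c‖ := f.le_opNorm c
  have h3 : |t * d.B u c| ≤ d.δ * ‖c‖ := by
    rw [abs_mul]
    calc |t| * |d.B u c| ≤ (d.δ / (‖f‖ + 1)) * ((‖f‖ + 1) * ‖c‖) := by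
          apply mul_le_mul ht _ (abs_nonneg _) (div_pos d.hδ (by positivity)).le
          nlinarith [norm_nonneg c]
      _ = d.δ * ‖c‖ := by
          have : ‖f‖ + 1 ≠ 0 := by positivity
          field_simp
  simp only [map_add, map_smul, LinearMap.add_apply, LinearMap.smul_apply, smul_eq_mul]
  have := neg_abs_le (t * d.B u c)
  linarith

theorem e_mem : d.e ∈ d.Ds := by
  obtain ⟨ε, hε, h⟩ := d.e_int 0
  simpa using h 0 (by simpa using hε.le)

/-- the bidual cone satisfies the norm bound -/
theorem D_bd {x : X} (hx : x ∈ d.D) : d.δ * ‖x‖ ≤ d.B d.e x := by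
  obtain ⟨f, hf, hfx⟩ := exists_dual_vector'' ℝ x
  obtain ⟨y, hy⟩ := d.exists_rep f.toLinearMap
  have hm : d.e - d.δ • y ∈ d.Ds := by
    intro c hc
    have h1 := d.bd c hc
    have h2 : f c ≤ ‖c‖ := by
      have := f.le_opNorm c
      have h3 := le_abs_self (f c)
      simp only [Real.norm_eq_abs] at this
      nlinarith [norm_nonneg c]
    simp only [map_sub, map_smul, LinearMap.sub_apply, LinearMap.smul_apply, smul_eq_mul, hy,
      ContinuousLinearMap.coe_coe]
    nlinarith [d.hδ]
  have := hx _ hm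
  simp only [map_sub, map_smul, LinearMap.sub_apply, LinearMap.smul_apply, smul_eq_mul, hy,
      ContinuousLinearMap.coe_coe, hfx] at this
  simp at this
  linarith

theorem D_pointed {x : X} (hx : x ∈ d.D) (hx' : -x ∈ d.D) : x = 0 := by
  have h1 := d.D_bd hx
  have h2 := d.D_bd hx'
  simp only [norm_neg, map_neg] at h2
  have : ‖x‖ ≤ 0 := by nlinarith [d.hδ, norm_nonneg x]
  simpa using this

theorem D_pos {x : X} (hx : x ∈ d.D) (h0 : x ≠ 0) : 0 < d.B d.e x := by
  have h1 := d.D_bd hx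
  have := mul_pos d.hδ (norm_pos_iff.2 h0)
  linarith

theorem C_null {c : X} (hc : c ∈ d.C) : d.B c c = 0 := ((d.memC c).1 hc).2

/-- small null perturbations stay in the cone -/
theorem C_curve {c : X} (hc : c ∈ d.C) (γ : ℝ → X) (hγ : Continuous γ) (h0 : γ 0 = c)
    (hn : ∀ t, d.B (γ t) (γ t) = 0) : ∃ ε > 0, ∀ t : ℝ, |t| < ε → γ t ∈ d.C := by
  have h1 : IsOpen (γ ⁻¹' d.U) := d.Uopen.preimage hγ
  have h2 : (0 : ℝ) ∈ γ ⁻¹' d.U := by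
    simp only [Set.mem_preimage, h0]; exact ((d.memC c).1 hc).1
  obtain ⟨ε, hε, h⟩ := Metric.isOpen_iff.1 h1 0 h2
  refine ⟨ε, hε, fun t ht => (d.memC _).2 ⟨h (by simpa using ht), hn t⟩⟩

/-- The saddle argument: a functional nonnegative on the cone is positive on it or zero. -/
theorem saddle {c y : X} (hc : c ∈ d.C) (hy : y ∈ d.Ds) (h : d.B y c = 0) : y = 0 := by
  have hcc := d.C_null hc
  -- a null vector transverse to c
  obtain ⟨z0, hz0⟩ : ∃ z, d.B c z ≠ 0 := by
    by_contra! hh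
    exact d.ne0 c hc (d.nondeg c hh)
  obtain ⟨z, hcz, hzz⟩ : ∃ z, d.B c z = 1 ∧ d.B z z = 0 := by
    let z1 := (d.B c z0)⁻¹ • z0
    have h1 : d.B c z1 = 1 := by simp [z1, hz0]
    refine ⟨z1 - (d.B z1 z1 / 2) • c, ?_, ?_⟩
    · simp [h1, hcc]
    · simp only [map_sub, map_smul, LinearMap.sub_apply, LinearMap.smul_apply, smul_eq_mul, hcc,
        d.symm z1 c, h1]
      ring
  have key : ∀ u, d.B c u = 0 → d.B z u = 0 → d.B y u = 0 ∧ 0 ≤ - d.B u u * d.B y z := by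
    intro u hcu hzu
    obtain ⟨ε, hε, hcur⟩ := d.C_curve hc (fun t => c + t • u - (t ^ 2 * d.B u u / 2) • z)
      (by fun_prop) (by simp) (by
        intro t
        simp only [map_sub, map_add, map_smul, LinearMap.sub_apply, LinearMap.add_apply,
          LinearMap.smul_apply, smul_eq_mul, hcc, hcz, hzz, hcu, hzu, d.symm u c, d.symm z c,
          d.symm u z]
        ring)
    have hin : ∀ t, |t| < ε → 0 ≤ t * d.B y u - t ^ 2 * d.B u u / 2 * d.B y z := by
      intro t ht
      have := hy _ (hcur t ht)
      simpa only [map_sub, map_add, map_smul, smul_eq_mul, h, zero_add] using this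
    have hyu : d.B y u = 0 := by
      by_contra hne
      set a := d.B y u
      set b := d.B u u / 2 * d.B y z with hb
      have hin' : ∀ t, |t| < ε → 0 ≤ t * a - t ^ 2 * b := by
        intro t ht; have := hin t ht; rw [hb]; nlinarith
      obtain ⟨s, hs, hs1, hs2⟩ : ∃ s > 0, s * |a| < ε ∧ s * |b| < 1 := by
        refine ⟨min (ε / (2 * (|a| + 1))) (1 / (2 * (|b| + 1))), by positivity, ?_, ?_⟩
        · calc _ ≤ (ε / (2 * (|a| + 1))) * |a| := by gcongr; exact min_le_left _ _
            _ < ε := by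
              rw [div_mul_eq_mul_div, div_lt_iff₀ (by positivity)]
              nlinarith [abs_nonneg a]
        · calc _ ≤ (1 / (2 * (|b| + 1))) * |b| := by gcongr; exact min_le_right _ _
            _ < 1 := by
              rw [div_mul_eq_mul_div, div_lt_iff₀ (by positivity)]
              nlinarith [abs_nonneg b]
      have h4 := hin' (-(s * a)) (by rw [abs_neg, abs_mul, abs_of_pos hs]; exact hs1)
      have h5 : 0 < s * a ^ 2 := by positivity
      have h6 : -(s * b) < 1 := by
        have : -(s * b) ≤ s * |b| := by nlinarith [neg_abs_le b]
        linarith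
      nlinarith
    refine ⟨hyu, ?_⟩
    have h4 := hin (ε / 2) (by rw [abs_of_pos (by positivity)]; linarith)
    rw [hyu] at h4
    have : 0 ≤ (ε / 2) ^ 2 / 2 * (- d.B u u * d.B y z) := by nlinarith
    exact nonneg_of_mul_nonneg_right this (by positivity)
  have proj : ∀ x, d.B x c = 0 → d.B c (x - d.B x z • c) = 0 ∧ d.B z (x - d.B x z • c) = 0 ∧
      d.B (x - d.B x z • c) (x - d.B x z • c) = d.B x x := by
    intro x hx
    refine ⟨?_, ?_, ?_⟩
    · simp [d.symm c x, hx, hcc]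
    · simp [d.symm z x, d.symm z c, hcz]
    · simp [d.symm c x, hx, hcc]
  have hyz : d.B y z = 0 := by
    obtain ⟨x1, hx1, hp1⟩ := d.posd c
    obtain ⟨x2, hx2, hp2⟩ := d.negd c
    obtain ⟨a1, a2, a3⟩ := proj x1 hx1
    obtain ⟨b1, b2, b3⟩ := proj x2 hx2
    have h1 := (key _ a1 a2).2
    have h2 := (key _ b1 b2).2
    rw [a3] at h1
    rw [b3] at h2
    nlinarith
  apply d.nondeg
  intro x
  have h1 : d.B c (x - d.B x z • c - d.B x c • z) = 0 := by
    simp [d.symm c x, hcc, hcz]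
  have h2 : d.B z (x - d.B x z • c - d.B x c • z) = 0 := by
    simp [d.symm z x, d.symm z c, hzz, hcz]
  have h3 := (key _ h1 h2).1
  simpa [h, hyz] using h3

theorem C_int {c : X} (hc : c ∈ d.C) (u : X) :
    ∃ ε > 0, ∀ t : ℝ, |t| ≤ ε → c + t • u ∈ d.D := by
  have hcomp : IsCompact (d.Ds ∩ Metric.sphere 0 1) :=
    (isCompact_sphere (0 : X) 1).inter_left d.isClosed_Ds
  have henz : d.e ≠ 0 := by
    intro h
    have := d.bd c hc
    rw [h] at this
    have h2 := mul_pos d.hδ (norm_pos_iff.2 (d.ne0 c hc))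
    simp at this
    linarith
  have hne : (d.Ds ∩ Metric.sphere 0 1).Nonempty := by
    refine ⟨‖d.e‖⁻¹ • d.e, d.Ds_smul d.e_mem (by positivity), ?_⟩
    simp [norm_smul, henz]
  obtain ⟨y0, hy0, hmin⟩ := hcomp.exists_isMinOn hne (d.contr c).continuousOn
  have hη : 0 < d.B y0 c := by
    refine lt_of_le_of_ne (hy0.1 c hc) fun h => ?_
    have := d.saddle hc hy0.1 h.symm
    have h1 := hy0.2
    rw [this] at h1
    simp at h1
  have hb : ∀ y ∈ d.Ds, d.B y0 c * ‖y‖ ≤ d.B y c := by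
    intro y hy
    by_cases h0 : y = 0
    · simp [h0]
    have h1 := hmin (show ‖y‖⁻¹ • y ∈ d.Ds ∩ Metric.sphere 0 1 from
      ⟨d.Ds_smul hy (by positivity), by simp [norm_smul, h0]⟩)
    simp only [Set.mem_ofPred_eq, map_smul, LinearMap.smul_apply, smul_eq_mul] at h1
    have hn : 0 < ‖y‖ := norm_pos_iff.2 h0
    calc d.B y0 c * ‖y‖ ≤ (‖y‖⁻¹ * d.B y c) * ‖y‖ := by gcongr
      _ = d.B y c := by field_simp
  let f : X →L[ℝ] ℝ := LinearMap.toContinuousLinearMap (d.B u)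
  refine ⟨d.B y0 c / (‖f‖ + 1), by positivity, fun t ht y hy => ?_⟩
  have h1 := hb y hy
  have h2 : |d.B u y| ≤ ‖f‖ * ‖y‖ := f.le_opNorm y
  have h3 : |t * d.B u y| ≤ d.B y0 c * ‖y‖ := by
    rw [abs_mul]
    calc |t| * |d.B u y| ≤ (d.B y0 c / (‖f‖ + 1)) * ((‖f‖ + 1) * ‖y‖) := by
          apply mul_le_mul ht _ (abs_nonneg _) (by positivity)
          nlinarith [norm_nonneg y]
      _ = d.B y0 c * ‖y‖ := by
          have : ‖f‖ + 1 ≠ 0 := by positivity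
          field_simp
  simp only [map_add, map_smul, smul_eq_mul, d.symm y u]
  have := neg_abs_le (t * d.B u y)
  linarith

theorem G_Ds {g : X ≃ₗ[ℝ] X} (hg : g ∈ d.G) {y : X} (hy : y ∈ d.Ds) : g y ∈ d.Ds := by
  intro c hc
  have h1 : g.symm c ∈ d.C := by rw [← d.GC g hg]; simpa using hc
  have h2 := hy _ h1
  rw [← d.Giso g hg] at h2
  simpa using h2

theorem G_Ds' {g : X ≃ₗ[ℝ] X} (hg : g ∈ d.G) {y : X} (hy : y ∈ d.Ds) : g.symm y ∈ d.Ds := by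
  intro c hc
  have h2 := hy _ ((d.GC g hg c).2 hc)
  rw [← d.Giso g hg]
  simpa using h2

theorem G_D {g : X ≃ₗ[ℝ] X} (hg : g ∈ d.G) {x : X} (hx : x ∈ d.D) : g x ∈ d.D := by
  intro y hy
  have h2 := hx _ (d.G_Ds' hg hy)
  rw [← d.Giso g hg] at h2
  simpa using h2

/-- A linear map which is a limit of rescaled group elements. -/
structure Lim (T : X →ₗ[ℝ] X) (s : ℝ) (g : ℕ → X ≃ₗ[ℝ] X) (σ : ℕ → ℝ) : Prop where
  mem : ∀ k, g k ∈ d.G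
  pos : ∀ k, 0 < σ k
  lims : Tendsto σ atTop (𝓝 s)
  lim : ∀ x, Tendsto (fun k => σ k • g k x) atTop (𝓝 (T x))
  nz : ∃ u, T u ≠ 0

variable {d} in
theorem Lim.D {T s g σ} (h : d.Lim T s g σ) {x : X} (hx : x ∈ d.D) : T x ∈ d.D :=
  d.isClosed_D.mem_of_tendsto (h.lim x) (Filter.Eventually.of_forall fun k =>
    d.D_smul (d.G_D (h.mem k) hx) (h.pos k).le)

variable {d} in
theorem Lim.Ds {T s g σ} (h : d.Lim T s g σ) {x : X} (hx : x ∈ d.Ds) : T x ∈ d.Ds :=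
  d.isClosed_Ds.mem_of_tendsto (h.lim x) (Filter.Eventually.of_forall fun k =>
    d.Ds_smul (d.G_Ds (h.mem k) hx) (h.pos k).le)

variable {d} in
theorem Lim.ne {T s g σ} (h : d.Lim T s g σ) {c : X} (hc : c ∈ d.C) : T c ≠ 0 := by
  intro h0
  obtain ⟨u, hu⟩ := h.nz
  obtain ⟨ε, hε, hh⟩ := d.C_int hc u
  have h1 := h.D (hh ε (by rw [abs_of_pos hε]))
  have h2 := h.D (hh (-ε) (by rw [abs_neg, abs_of_pos hε]))
  simp only [map_add, map_smul, h0, zero_add, neg_smul, map_neg] at h1 h2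
  have h3 := d.D_pointed h1 h2
  rcases smul_eq_zero.1 h3 with h3 | h3
  · exact hε.ne' h3
  · exact hu h3

variable {d} in
theorem Lim.iso {T s g σ} (h : d.Lim T s g σ) (x y : X) :
    d.B (T x) (T y) = s ^ 2 * d.B x y := by
  have h1 : Tendsto (fun k => d.B (σ k • g k x) (σ k • g k y)) atTop (𝓝 (d.B (T x) (T y))) :=
    (d.cont2.tendsto (T x, T y)).comp ((h.lim x).prodMk_nhds (h.lim y))
  have h2 : Tendsto (fun k => σ k ^ 2 * d.B x y) atTop (𝓝 (s ^ 2 * d.B x y)) :=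
    (h.lims.pow 2).mul_const _
  refine tendsto_nhds_unique h1 (h2.congr fun k => ?_)
  simp only [map_smul, LinearMap.smul_apply, smul_eq_mul, d.Giso _ (h.mem k)]
  ring

theorem clC_D {a : X} (ha : a ∈ closure d.C) : a ∈ d.D :=
  closure_minimal d.C_sub_D d.isClosed_D ha

theorem clC_null {a : X} (ha : a ∈ closure d.C) : d.B a a = 0 := by
  have : closure d.C ⊆ {x | d.B x x = 0} :=
    closure_minimal (fun x hx => d.C_null hx) (isClosed_eq d.contQ continuous_const)
  exact this ha

theorem limit {a : X} (ha : a ∈ closure d.C) (h0 : a ≠ 0) :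
    ∃ T s g σ, d.Lim T s g σ ∧ ∃ c ∈ d.C, ∃ r : ℝ, 0 < r ∧ T c = r • a := by
  obtain ⟨x, hx, hxa⟩ := mem_closure_iff_seq_limit.1 ha
  choose g hg c hc r hr hxe using fun k => d.qh (x k) (hx k)
  let γ : ℕ → (X →L[ℝ] X) := fun k => LinearMap.toContinuousLinearMap (g k).toLinearMap
  let σ : ℕ → ℝ := fun k => (1 + ‖γ k‖)⁻¹
  have hσ : ∀ k, 0 < σ k := fun k => by positivity
  have hσ1 : ∀ k, σ k ≤ 1 := fun k => inv_le_one_of_one_le₀ (by linarith [norm_nonneg (γ k)])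
  have hsum : ∀ k, ‖σ k • γ k‖ + σ k = 1 := by
    intro k
    rw [norm_smul, Real.norm_eq_abs, abs_of_pos (hσ k)]
    have : 1 + ‖γ k‖ ≠ 0 := by positivity
    simp only [σ]
    field_simp
    ring
  have : ProperSpace (X →L[ℝ] X) := FiniteDimensional.proper ℝ _
  have hcomp : IsCompact (Metric.closedBall (0 : X →L[ℝ] X) 1 ×ˢ (Set.Icc (0 : ℝ) 1 ×ˢ d.K)) :=
    (isCompact_closedBall _ _).prod (isCompact_Icc.prod d.Kc)
  obtain ⟨⟨T, s, c0⟩, hmem, φ, hφ, hlim⟩ := hcomp.tendsto_subseq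
    (x := fun k => (σ k • γ k, σ k, c k)) (fun k => by
      refine ⟨?_, ⟨(hσ k).le, hσ1 k⟩, hc k⟩
      have := hsum k
      have := hσ k
      simp only [mem_closedBall_zero_iff]
      linarith)
  have hT : Tendsto (fun k => σ (φ k) • γ (φ k)) atTop (𝓝 T) :=
    (continuous_fst.tendsto _).comp hlim
  have hs : Tendsto (fun k => σ (φ k)) atTop (𝓝 s) :=
    ((continuous_fst.comp continuous_snd).tendsto _).comp hlim
  have hc0 : Tendsto (fun k => c (φ k)) atTop (𝓝 c0) :=
    ((continuous_snd.comp continuous_snd).tendsto _).comp hlim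
  have hc0K : c0 ∈ d.C := d.KC hmem.2.2
  have hsum' : ‖T‖ + s = 1 :=
    tendsto_nhds_unique (hT.norm.add hs) (by simp only [hsum]; exact tendsto_const_nhds)
  have hpt : ∀ u, Tendsto (fun k => σ (φ k) • g (φ k) u) atTop (𝓝 (T u)) := by
    intro u
    exact ((ContinuousLinearMap.apply ℝ X u).continuous.tendsto T).comp hT
  have hiso : ∀ u v, d.B (T u) (T v) = s ^ 2 * d.B u v := by
    intro u v
    have h1 : Tendsto (fun k => d.B (σ (φ k) • g (φ k) u) (σ (φ k) • g (φ k) v)) atTop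
        (𝓝 (d.B (T u) (T v))) :=
      (d.cont2.tendsto (T u, T v)).comp ((hpt u).prodMk_nhds (hpt v))
    have h2 : Tendsto (fun k => σ (φ k) ^ 2 * d.B u v) atTop (𝓝 (s ^ 2 * d.B u v)) :=
      (hs.pow 2).mul_const _
    refine tendsto_nhds_unique h1 (h2.congr fun k => ?_)
    simp only [map_smul, LinearMap.smul_apply, smul_eq_mul, d.Giso _ (hg _)]
    ring
  have hL : d.Lim T.toLinearMap s (fun k => g (φ k)) (fun k => σ (φ k)) := by
    refine ⟨fun k => hg _, fun k => hσ _, hs, hpt, ?_⟩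
    by_contra! hh
    have hT0 : T = 0 := by ext u; simpa using hh u
    rw [hT0] at hsum'
    have hs1 : s = 1 := by simpa using hsum'
    obtain ⟨u, -, hu⟩ := d.posd 0
    have := hiso u u
    rw [hT0, hs1] at this
    simp at this
    linarith
  refine ⟨_, _, _, _, hL, c0, hc0K, ?_⟩
  have h1 : Tendsto (fun k => (σ (φ k) • γ (φ k)) (c (φ k))) atTop (𝓝 (T c0)) := by
    have hcc : Continuous fun z : (X →L[ℝ] X) × X => z.1 z.2 := by fun_prop
    exact (hcc.tendsto (T, c0)).comp (hT.prodMk_nhds hc0)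
  have hea : 0 < d.B d.e a := d.D_pos (d.clC_D ha) h0
  have heT : 0 < d.B d.e (T c0) := d.D_pos (hL.D (d.C_sub_D hc0K)) (hL.ne hc0K)
  let μ : ℕ → ℝ := fun k => σ k * (r k)⁻¹
  have hμ : ∀ k, (σ k • γ k) (c k) = μ k • x k := by
    intro k
    rw [hxe k, smul_smul]
    have : r k ≠ 0 := (hr k).ne'
    simp [μ, γ, this]
  have hxa' : Tendsto (fun k => x (φ k)) atTop (𝓝 a) := hxa.comp hφ.tendsto_atTop
  have hμlim : Tendsto (fun k => μ (φ k)) atTop (𝓝 (d.B d.e (T c0) / d.B d.e a)) := by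
    have h2 : Tendsto (fun k => d.B d.e ((σ (φ k) • γ (φ k)) (c (φ k))) / d.B d.e (x (φ k))) atTop
        (𝓝 (d.B d.e (T c0) / d.B d.e a)) :=
      (((d.contl d.e).tendsto _).comp h1).div (((d.contl d.e).tendsto _).comp hxa') hea.ne'
    refine h2.congr fun k => ?_
    rw [hμ]
    have : d.B d.e (x (φ k)) ≠ 0 := (d.D_pos (d.C_sub_D (hx _)) (d.ne0 _ (hx _))).ne'
    simp [this]
  refine ⟨d.B d.e (T c0) / d.B d.e a, by positivity, ?_⟩
  refine tendsto_nhds_unique h1 ((hμlim.smul hxa').congr fun k => ?_)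
  rw [hμ]

/-- If the limit is nondegenerate, the limit point stays in the cone. -/
theorem limit_inv {a : X} (ha : a ∈ closure d.C) {T s g σ} (h : d.Lim T s g σ) {c : X}
    (hc : c ∈ d.C) {r : ℝ} (hr : 0 < r) (hT : T c = r • a) (hs : s ≠ 0) : a ∈ d.C := by
  have hs0 : 0 < s := lt_of_le_of_ne (ge_of_tendsto' h.lims fun k => (h.pos k).le) hs.symm
  let b := Module.finBasis ℝ X
  let F : X →ₗ[ℝ] (Fin (Module.finrank ℝ X) → ℝ) :=
    LinearMap.pi fun i => d.B.flip (b i)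
  have hF : LinearMap.ker F = ⊥ := by
    rw [LinearMap.ker_eq_bot']
    intro m hm
    apply d.nondeg
    intro y
    have h1 : d.B m = 0 := b.ext fun i => by
      have := congrFun hm i
      simpa [F] using this
    rw [h1]; rfl
  have hemb := LinearMap.isClosedEmbedding_of_injective hF
  have hlim : Tendsto (fun k => (g k).symm a) atTop (𝓝 ((s / r) • c)) := by
    rw [hemb.isInducing.tendsto_nhds_iff, tendsto_pi_nhds]
    intro i
    have h1 : Tendsto (fun k => (σ k)⁻¹ * d.B a (σ k • g k (b i))) atTop
        (𝓝 (s⁻¹ * d.B a (T (b i)))) :=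
      (h.lims.inv₀ hs).mul (((d.contl a).tendsto _).comp (h.lim (b i)))
    have h2 : s⁻¹ * d.B a (T (b i)) = F ((s / r) • c) i := by
      have h3 : r * d.B a (T (b i)) = s ^ 2 * d.B c (b i) := by
        rw [← h.iso, hT]; simp
      simp only [F, LinearMap.pi_apply, LinearMap.flip_apply, map_smul, LinearMap.smul_apply,
        smul_eq_mul]
      have hr' := hr.ne'
      field_simp
      linarith
    rw [← h2]
    refine h1.congr fun k => ?_
    have h3 := (h.pos k).ne'
    simp only [Function.comp, F, LinearMap.pi_apply, LinearMap.flip_apply, map_smul, smul_eq_mul]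
    have h5 := d.Giso _ (h.mem k) ((g k).symm a) (b i)
    rw [LinearEquiv.apply_symm_apply] at h5
    rw [← h5, inv_mul_cancel_left₀ h3]
  have hcU : (s / r) • c ∈ d.U := ((d.memC _).1 (d.cone c hc _ (by positivity))).1
  obtain ⟨k, hk⟩ := (hlim.eventually (d.Uopen.mem_nhds hcU)).exists
  have h4 : (g k).symm a ∈ d.C := by
    refine (d.memC _).2 ⟨hk, ?_⟩
    rw [← d.Giso _ (h.mem k)]
    simpa using d.clC_null ha
  have := (d.GC _ (h.mem k) _).2 h4
  simpa using this

/-- compact base of the cone over the closure -/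
def A : Set X := {x | x ∈ closure d.C ∧ d.B d.e x = 1}

theorem isCompact_A : IsCompact d.A := by
  apply Metric.isCompact_of_isClosed_isBounded
  · exact isClosed_closure.inter (isClosed_eq (d.contl d.e) continuous_const)
  · rw [isBounded_iff_forall_norm_le]
    refine ⟨1 / d.δ, fun x hx => ?_⟩
    have := d.D_bd (d.clC_D hx.1)
    rw [hx.2] at this
    rw [le_div_iff₀ d.hδ]
    linarith

def H : Set X := convexHull ℝ d.A

theorem H_eq : d.H = {x | x ∈ d.D ∧ d.B d.e x = 1} := by
  apply Set.Subset.antisymm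
  · apply convexHull_min
    · exact fun x hx => ⟨d.clC_D hx.1, hx.2⟩
    · exact d.convex_D.inter (convex_hyperplane (d.B d.e).isLinear 1)
  · rintro x ⟨hx, hx1⟩
    by_contra hn
    obtain ⟨f, u, hu, hf⟩ := geometric_hahn_banach_point_closed (convex_convexHull ℝ d.A)
      (isCompact_convexHull_fd d.isCompact_A).isClosed hn
    obtain ⟨y, hy⟩ := d.exists_rep f.toLinearMap
    have hm : y - u • d.e ∈ d.Ds := by
      intro c hc
      have hp := d.D_pos (d.C_sub_D hc) (d.ne0 c hc)
      have hcA : (d.B d.e c)⁻¹ • c ∈ d.A :=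
        ⟨subset_closure (d.cone c hc _ (by positivity)), by simp [hp.ne']⟩
      have h1 := hf _ (subset_convexHull ℝ _ hcA)
      simp only [map_smul, smul_eq_mul] at h1
      simp only [map_sub, map_smul, LinearMap.sub_apply, LinearMap.smul_apply, smul_eq_mul, hy,
        ContinuousLinearMap.coe_coe]
      rw [inv_mul_eq_div, lt_div_iff₀ hp] at h1
      linarith
    have := hx _ hm
    simp only [map_sub, map_smul, LinearMap.sub_apply, LinearMap.smul_apply, smul_eq_mul, hy,
        ContinuousLinearMap.coe_coe, hx1] at this
    linarith

theorem ext_cone {a x y : X} {r : ℝ} (hr : 0 < r) (ha : a ∈ d.H.extremePoints ℝ) (hx : x ∈ d.D)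
    (hy : y ∈ d.D) (h : x + y = r • a) : ∃ t : ℝ, x = t • a := by
  by_cases hx0 : x = 0
  · exact ⟨0, by simp [hx0]⟩
  by_cases hy0 : y = 0
  · exact ⟨r, by rw [← h, hy0, add_zero]⟩
  have hxp := d.D_pos hx hx0
  have hyp := d.D_pos hy hy0
  have hx' : (d.B d.e x)⁻¹ • x ∈ d.H := by
    rw [H_eq]; exact ⟨d.D_smul hx (by positivity), by simp [hxp.ne']⟩
  have hy' : (d.B d.e y)⁻¹ • y ∈ d.H := by
    rw [H_eq]; exact ⟨d.D_smul hy (by positivity), by simp [hyp.ne']⟩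
  have ha1 : d.B d.e a = 1 := by
    have := ha.1; rw [H_eq] at this; exact this.2
  have hsum : d.B d.e x + d.B d.e y = r := by
    rw [← map_add, h]; simp [ha1]
  have := ha.2 hx' hy' ⟨d.B d.e x / r, d.B d.e y / r, by positivity, by positivity, by
    rw [← add_div, hsum, div_self hr.ne'], by
    rw [smul_smul, smul_smul]
    have e1 : d.B d.e x / r * (d.B d.e x)⁻¹ = r⁻¹ := by field_simp
    have e2 : d.B d.e y / r * (d.B d.e y)⁻¹ = r⁻¹ := by field_simp
    rw [e1, e2, ← smul_add, h, smul_smul, inv_mul_cancel₀ hr.ne', one_smul]⟩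
  exact ⟨d.B d.e x, by rw [← this, smul_smul, mul_inv_cancel₀ hxp.ne', one_smul]⟩

/-- extreme points lie in the dual cone up to sign -/
theorem ext_dual {a : X} (ha : a ∈ d.H.extremePoints ℝ) : a ∈ d.Ds ∨ -a ∈ d.Ds := by
  have haA : a ∈ d.A := extremePoints_convexHull_subset ha
  have ha0 : a ≠ 0 := by
    rintro rfl
    have := haA.2
    simp at this
  obtain ⟨T, s, g, σ, hL, c, hc, r, hr, hTc⟩ := d.limit haA.1 ha0
  have rank1 : ∀ u, ∃ t : ℝ, T u = t • a := by
    intro u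
    obtain ⟨ε, hε, hh⟩ := d.C_int hc u
    have h1 := hL.D (hh ε (by rw [abs_of_pos hε]))
    have h2 := hL.D (hh (-ε) (by rw [abs_neg, abs_of_pos hε]))
    obtain ⟨t, ht⟩ := d.ext_cone (r := 2 * r) (by positivity) ha h1 h2 (by
      simp only [map_add, map_smul, hTc, mul_smul, two_smul, neg_smul, map_neg]
      abel)
    refine ⟨ε⁻¹ * (t - r), ?_⟩
    rw [map_add, map_smul, hTc] at ht
    rw [mul_smul, sub_smul, ← ht, add_sub_cancel_left, smul_smul, inv_mul_cancel₀ hε.ne', one_smul]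
  obtain ⟨f, hf, hTf⟩ : ∃ f ∈ d.Ds, T f ≠ 0 := by
    by_contra! hh
    obtain ⟨u, hu⟩ := hL.nz
    obtain ⟨ε, hε, h1⟩ := d.e_int u
    have h2 := hh _ (h1 ε (by rw [abs_of_pos hε]))
    have h3 := hh _ d.e_mem
    rw [map_add, h3, zero_add, map_smul] at h2
    rcases smul_eq_zero.1 h2 with h2 | h2
    · exact hε.ne' h2
    · exact hu h2
  obtain ⟨t, ht⟩ := rank1 f
  have hm := hL.Ds hf
  rw [ht] at hm hTf
  have ht0 : t ≠ 0 := by rintro rfl; simp at hTf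
  rcases lt_or_gt_of_ne ht0 with h | h
  · right
    have := d.Ds_smul hm (t := -t⁻¹) (by have := inv_lt_zero.2 h; linarith)
    rw [smul_smul] at this
    simpa [ht0] using this
  · left
    have := d.Ds_smul hm (t := t⁻¹) (by positivity)
    rw [smul_smul] at this
    simpa [ht0] using this

theorem D_span (V : Submodule ℝ X) (h : d.H.extremePoints ℝ ⊆ V) : V = ⊤ := by
  have hcl : IsClosed (V : Set X) := V.closed_of_finiteDimensional
  have hH : d.H ⊆ V := by
    have := closure_convexHull_extremePoints (isCompact_convexHull_fd d.isCompact_A)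
      (convex_convexHull ℝ d.A)
    rw [H, ← this]
    exact closure_minimal (convexHull_min h V.convex) hcl
  have hD : d.D ⊆ V := by
    intro x hx
    by_cases h0 : x = 0
    · rw [h0]; exact V.zero_mem
    have hp := d.D_pos hx h0
    have : (d.B d.e x)⁻¹ • x ∈ d.H := by
      rw [H_eq]; exact ⟨d.D_smul hx (by positivity), by simp [hp.ne']⟩
    exact (V.smul_mem_iff (by positivity)).1 (hH this)
  rw [eq_top_iff]
  intro u _
  obtain ⟨c, hc⟩ := d.ne
  obtain ⟨ε, hε, hh⟩ := d.C_int hc u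
  have h1 := hD (hh ε (by rw [abs_of_pos hε]))
  have h2 := (V.add_mem_iff_right (hD (d.C_sub_D hc))).1 h1
  exact (V.smul_mem_iff hε.ne').1 h2

/-- The main structural statement. -/
theorem main : ∃ P : X →ₗ[ℝ] X, (∀ x, P (P x) = P x) ∧ (∀ x y, d.B (P x) y = d.B x (P y)) ∧
    (∀ x ∈ d.C, 0 < d.B (P x) (P x)) ∧
    (∀ x ∈ d.C, ∀ y ∈ d.C, 0 ≤ d.B (P x) (P y)) ∧
    (∀ x ∈ d.C, ∀ y ∈ d.C, d.B (x - P x) (y - P y) ≤ 0) ∧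
    (∀ a ∈ closure d.C, d.B (P a) (P a) ≠ 0 → a ∈ d.C) := by
  let Vp : Submodule ℝ X := Submodule.span ℝ (d.D ∩ d.Ds)
  let Vm : Submodule ℝ X := Submodule.span ℝ (d.D ∩ {x | -x ∈ d.Ds})
  have horth : ∀ x ∈ Vp, ∀ y ∈ Vm, d.B x y = 0 := by
    intro x hx y hy
    induction hx using Submodule.span_induction with
    | mem x hx =>
      induction hy using Submodule.span_induction with
      | mem y hy =>
        have h1 := hy.1 x hx.2
        have h2 := hx.1 _ hy.2
        simp only [map_neg, LinearMap.neg_apply, d.symm y x] at h2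
        linarith
      | zero => simp
      | add y z _ _ h1 h2 => simp [h1, h2]
      | smul a y _ h1 => simp [h1]
    | zero => simp
    | add y z _ _ h1 h2 => simp [h1, h2]
    | smul a y _ h1 => simp [h1]
  have hE : d.H.extremePoints ℝ ⊆ (d.D ∩ d.Ds) ∪ (d.D ∩ {x | -x ∈ d.Ds}) := by
    intro a ha
    have haD : a ∈ d.D := d.clC_D (extremePoints_convexHull_subset ha : a ∈ d.A).1
    rcases d.ext_dual ha with h | h
    · exact Or.inl ⟨haD, h⟩
    · exact Or.inr ⟨haD, h⟩
  have htop : Vp ⊔ Vm = ⊤ := by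
    apply d.D_span
    intro a ha
    rcases hE ha with h | h
    · exact Submodule.mem_sup_left (Submodule.subset_span h)
    · exact Submodule.mem_sup_right (Submodule.subset_span h)
  have hcompl : IsCompl Vp Vm := by
    refine ⟨?_, codisjoint_iff.2 htop⟩
    rw [Submodule.disjoint_def]
    intro x hx hx'
    apply d.nondeg
    intro y
    obtain ⟨v, hv, w, hw, rfl⟩ := Submodule.mem_sup.1 (htop ▸ Submodule.mem_top : y ∈ Vp ⊔ Vm)
    rw [map_add, horth x hx w hw, d.symm x v, horth v hv x hx', add_zero]
  let P : X →ₗ[ℝ] X := Vp.projection Vm hcompl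
  have hPm : ∀ x, P x ∈ Vp := fun x => Submodule.projection_apply_mem hcompl x
  have hPv : ∀ x ∈ Vp, P x = x := fun x hx => Submodule.projection_apply_of_mem_left hcompl hx
  have hPw : ∀ x ∈ Vm, P x = 0 := fun x hx =>
    (Submodule.projection_apply_eq_zero_iff hcompl).2 hx
  have hPs : ∀ x, x - P x ∈ Vm := by
    intro x
    rw [← Submodule.projection_apply_eq_zero_iff hcompl]
    change P (x - P x) = 0
    rw [map_sub, hPv _ (hPm x), sub_self]
  have hPP : ∀ x, P (P x) = P x := fun x => hPv _ (hPm x)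
  have hPB : ∀ x y, d.B (P x) y = d.B (P x) (P y) := by
    intro x y
    have := horth _ (hPm x) _ (hPs y)
    rw [map_sub] at this
    linarith
  have hadj : ∀ x y, d.B (P x) y = d.B x (P y) := by
    intro x y
    rw [hPB, d.symm x, hPB y x, d.symm]
  have hPcont : Continuous P := P.continuous_of_finiteDimensional
  -- the projections preserve the cone
  have hext : ∀ S : Set X, IsClosed S → Convex ℝ S → (∀ a ∈ d.H.extremePoints ℝ, a ∈ S) →
      ∀ a ∈ d.H, a ∈ S := by
    intro S h1 h2 h3 a ha
    have := closure_convexHull_extremePoints (isCompact_convexHull_fd d.isCompact_A)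
      (convex_convexHull ℝ d.A)
    rw [H, ← this] at ha
    exact closure_minimal (convexHull_min h3 h2) h1 ha
  have h0D : (0 : X) ∈ d.D := fun y _ => by simp
  have h0Ds : (0 : X) ∈ d.Ds := fun y _ => by simp
  have hPD : ∀ x ∈ d.D, P x ∈ d.D ∩ d.Ds := by
    have hH : ∀ a ∈ d.H, a ∈ P ⁻¹' (d.D ∩ d.Ds) := by
      apply hext
      · exact (d.isClosed_D.inter d.isClosed_Ds).preimage hPcont
      · exact (d.convex_D.inter d.convex_Ds).linear_preimage P
      · intro a ha
        rcases hE ha with h | h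
        · rw [Set.mem_preimage, hPv _ (Submodule.subset_span h)]; exact h
        · rw [Set.mem_preimage, hPw _ (Submodule.subset_span h)]; exact ⟨h0D, h0Ds⟩
    intro x hx
    by_cases h0 : x = 0
    · rw [h0, map_zero]; exact ⟨h0D, h0Ds⟩
    have hp := d.D_pos hx h0
    have hm : (d.B d.e x)⁻¹ • x ∈ d.H := by
      rw [H_eq]; exact ⟨d.D_smul hx (by positivity), by simp [hp.ne']⟩
    have h1 := hH _ hm
    have h2 : P x = d.B d.e x • P ((d.B d.e x)⁻¹ • x) := by
      rw [map_smul, smul_smul, mul_inv_cancel₀ hp.ne', one_smul]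
    rw [h2]
    exact ⟨d.D_smul h1.1 hp.le, d.Ds_smul h1.2 hp.le⟩
  have hPD' : ∀ x ∈ d.D, x - P x ∈ d.D ∧ -(x - P x) ∈ d.Ds := by
    let R : X →ₗ[ℝ] X := LinearMap.id - P
    have hR : ∀ x, R x = x - P x := fun x => rfl
    have hH : ∀ a ∈ d.H, a ∈ R ⁻¹' d.D ∩ (-R) ⁻¹' d.Ds := by
      apply hext
      · exact (d.isClosed_D.preimage R.continuous_of_finiteDimensional).inter
          (d.isClosed_Ds.preimage (-R).continuous_of_finiteDimensional)
      · exact (d.convex_D.linear_preimage R).inter (d.convex_Ds.linear_preimage (-R))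
      · intro a ha
        rcases hE ha with h | h
        · simp only [Set.mem_inter_iff, Set.mem_preimage, LinearMap.neg_apply, hR,
            hPv _ (Submodule.subset_span h), sub_self, neg_zero]
          exact ⟨h0D, h0Ds⟩
        · simp only [Set.mem_inter_iff, Set.mem_preimage, LinearMap.neg_apply, hR,
            hPw _ (Submodule.subset_span h), sub_zero]
          exact h
    intro x hx
    by_cases h0 : x = 0
    · rw [h0, map_zero, sub_zero, neg_zero]; exact ⟨h0D, h0Ds⟩
    have hp := d.D_pos hx h0
    have hm : (d.B d.e x)⁻¹ • x ∈ d.H := by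
      rw [H_eq]; exact ⟨d.D_smul hx (by positivity), by simp [hp.ne']⟩
    have h1 := hH _ hm
    have h2 : R x = d.B d.e x • R ((d.B d.e x)⁻¹ • x) := by
      rw [map_smul, smul_smul, mul_inv_cancel₀ hp.ne', one_smul]
    rw [← hR, h2]
    refine ⟨d.D_smul h1.1 hp.le, ?_⟩
    rw [← smul_neg]
    exact d.Ds_smul h1.2 hp.le
  have hpos : ∀ x ∈ d.D, ∀ y ∈ d.D, 0 ≤ d.B (P x) (P y) := fun x hx y hy =>
    (hPD y hy).1 _ (hPD x hx).2
  have hneg : ∀ x ∈ d.D, ∀ y ∈ d.D, d.B (x - P x) (y - P y) ≤ 0 := fun x hx y hy => by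
    have := (hPD' y hy).1 _ (hPD' x hx).2
    rw [map_neg, LinearMap.neg_apply] at this
    linarith
  -- critical point argument
  have hcrit : ∀ c ∈ d.C, ∀ F : X →ₗ[ℝ] X, (∀ x y, d.B (F x) y = d.B x (F y)) →
      (∀ x ∈ d.D, 0 ≤ d.B (F x) x) → d.B (F c) c = 0 → F c = 0 := by
    intro c hc F hF hFp h0
    apply d.nondeg
    intro u
    obtain ⟨ε, hε, hh⟩ := d.C_int hc u
    by_contra hne
    set α := d.B (F c) u with hα
    set β := d.B (F u) u with hβ
    have hin : ∀ t, |t| ≤ ε → 0 ≤ 2 * t * α + t ^ 2 * β := by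
      intro t ht
      have := hFp _ (hh t ht)
      simp only [map_add, map_smul, LinearMap.add_apply, LinearMap.smul_apply, smul_eq_mul,
        h0] at this
      have h3 : d.B (F u) c = α := by rw [hF, d.symm]
      rw [h3, ← hα, ← hβ] at this
      linarith
    obtain ⟨s, hs, hs1, hs2⟩ : ∃ s > 0, s * |α| ≤ ε ∧ s * |β| < 1 := by
      refine ⟨min (ε / (2 * (|α| + 1))) (1 / (2 * (|β| + 1))), by positivity, ?_, ?_⟩
      · calc _ ≤ (ε / (2 * (|α| + 1))) * |α| := by gcongr; exact min_le_left _ _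
          _ ≤ ε := by
            rw [div_mul_eq_mul_div, div_le_iff₀ (by positivity)]
            nlinarith [abs_nonneg α]
      · calc _ ≤ (1 / (2 * (|β| + 1))) * |β| := by gcongr; exact min_le_right _ _
          _ < 1 := by
            rw [div_mul_eq_mul_div, div_lt_iff₀ (by positivity)]
            nlinarith [abs_nonneg β]
    have h4 := hin (-(s * α)) (by rw [abs_neg, abs_mul, abs_of_pos hs]; exact hs1)
    have h5 : 0 < s * α ^ 2 := by positivity
    have h6 : s * β < 1 := by
      have : s * β ≤ s * |β| := by nlinarith [le_abs_self β]
      linarith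
    nlinarith
  have hsplit : ∀ x, d.B x x = d.B (P x) (P x) + d.B (x - P x) (x - P x) := by
    intro x
    have h1 := horth _ (hPm x) _ (hPs x)
    have h3 := d.symm x (P x)
    simp only [map_sub, LinearMap.sub_apply] at h1 ⊢
    linarith
  have hi : ∀ x ∈ d.C, 0 < d.B (P x) (P x) := by
    intro c hc
    refine lt_of_le_of_ne (hpos c (d.C_sub_D hc) c (d.C_sub_D hc)) fun h => ?_
    have h1 : P c = 0 := by
      refine hcrit c hc P hadj (fun x hx => ?_) ?_
      · rw [hPB]; exact hpos x hx x hx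
      · rw [hPB]; exact h.symm
    have h2 : (P - LinearMap.id : X →ₗ[ℝ] X) c = 0 := by
      refine hcrit c hc (P - LinearMap.id) (fun x y => ?_) (fun x hx => ?_) ?_
      · simp [hadj]
      · have h3 := hsplit x
        have h4 := hneg x hx x hx
        simp only [LinearMap.sub_apply, LinearMap.id_apply, map_sub]
        rw [hPB]
        linarith
      · simp [h1, d.C_null hc]
    have h3 : c = 0 := by
      have : P c - c = 0 := h2
      rw [h1] at this
      simpa using this
    exact d.ne0 c hc h3
  refine ⟨P, hPP, hadj, hi, fun x hx y hy => hpos x (d.C_sub_D hx) y (d.C_sub_D hy),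
    fun x hx y hy => hneg x (d.C_sub_D hx) y (d.C_sub_D hy), ?_⟩
  intro a ha hne
  have ha0 : a ≠ 0 := by rintro rfl; simp at hne
  obtain ⟨T, s, g, σ, hL, c, hc, r, hr, hTc⟩ := d.limit ha ha0
  have hgV : ∀ g ∈ d.G, ∀ x ∈ Vp, g x ∈ Vp := by
    intro g hg x hx
    induction hx using Submodule.span_induction with
    | mem x hx => exact Submodule.subset_span ⟨d.G_D hg hx.1, d.G_Ds hg hx.2⟩
    | zero => simp
    | add y z _ _ h1 h2 => rw [map_add]; exact Vp.add_mem h1 h2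
    | smul a y _ h1 => rw [map_smul]; exact Vp.smul_mem _ h1
  have hgV' : ∀ g ∈ d.G, ∀ x ∈ Vm, g x ∈ Vm := by
    intro g hg x hx
    induction hx using Submodule.span_induction with
    | mem x hx => exact Submodule.subset_span ⟨d.G_D hg hx.1, by
        have := d.G_Ds hg hx.2
        rw [map_neg] at this
        exact this⟩
    | zero => simp
    | add y z _ _ h1 h2 => rw [map_add]; exact Vm.add_mem h1 h2
    | smul a y _ h1 => rw [map_smul]; exact Vm.smul_mem _ h1
  have hgP : ∀ g ∈ d.G, ∀ x, P (g x) = g (P x) := by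
    intro g hg x
    have h2 : x = P x + (x - P x) := by abel
    conv_lhs => rw [h2]
    rw [map_add, map_add, hPv _ (hgV g hg _ (hPm x)), hPw _ (hgV' g hg _ (hPs x)), add_zero]
  have hTP : ∀ x, P (T x) = T (P x) := by
    intro x
    refine tendsto_nhds_unique ((hPcont.tendsto _).comp (hL.lim x)) ((hL.lim (P x)).congr ?_)
    intro k
    simp [hgP _ (hL.mem k)]
  refine d.limit_inv ha hL hc hr hTc ?_
  rintro rfl
  have h1 := hL.iso (P c) (P c)
  rw [← hTP, hTc] at h1
  simp at h1
  rcases h1 with h1 | h1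
  · exact hr.ne' h1
  · exact hne h1

end EDat

/-! ### Reconstruction of the diamond from the projection -/

/-- The cone together with the orthogonal projection. -/
structure PDat (X : Type*) [NormedAddCommGroup X] [NormedSpace ℝ X] where
  B : X →ₗ[ℝ] X →ₗ[ℝ] ℝ
  symm : ∀ x y, B x y = B y x
  nondeg : ∀ x, (∀ y, B x y = 0) → x = 0
  C : Set X
  U : Set X
  P : X →ₗ[ℝ] X
  Uopen : IsOpen U
  memC : ∀ x, x ∈ C ↔ x ∈ U ∧ B x x = 0
  cone : ∀ x ∈ C, ∀ t : ℝ, 0 < t → t • x ∈ C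
  ne : C.Nonempty
  PP : ∀ x, P (P x) = P x
  adj : ∀ x y, B (P x) y = B x (P y)
  pos : ∀ x ∈ C, 0 < B (P x) (P x)
  hp : ∀ x ∈ C, ∀ y ∈ C, 0 ≤ B (P x) (P y)
  hm : ∀ x ∈ C, ∀ y ∈ C, B (x - P x) (y - P y) ≤ 0
  cl : ∀ a ∈ closure C, B (P a) (P a) ≠ 0 → a ∈ C

namespace PDat

variable {X : Type*} [NormedAddCommGroup X] [NormedSpace ℝ X] [FiniteDimensional ℝ X]
variable (d : PDat X)

theorem split (x : X) : d.B x x = d.B (d.P x) (d.P x) + d.B (x - d.P x) (x - d.P x) := by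
  have h1 := d.adj x (d.P x)
  have h2 := d.adj x x
  rw [d.PP] at h1
  simp only [map_sub, LinearMap.sub_apply]
  linarith

theorem contQ : Continuous fun x => d.B x x := by
  have h : ∀ x, d.B x x = (LinearMap.toContinuousLinearMap
      ((LinearMap.toContinuousLinearMap (𝕜 := ℝ) (E := X) (F' := ℝ)).toLinearMap ∘ₗ d.B)) x x := by
    intro x; rfl
  simp_rw [h]
  fun_prop

theorem null_closure {a : X} (ha : a ∈ closure d.C) : d.B a a = 0 := by
  have h : closure d.C ⊆ {x | d.B x x = 0} :=
    closure_minimal (fun x hx => ((d.memC x).1 hx).2) (isClosed_eq d.contQ continuous_const)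
  exact h ha

/-- Exchange of the two factors. -/
def flip : PDat X where
  B := -d.B
  symm x y := by simp [d.symm x y]
  nondeg x h := d.nondeg x fun y => by simpa using h y
  C := d.C
  U := d.U
  P := LinearMap.id - d.P
  Uopen := d.Uopen
  memC x := by simp [d.memC]
  cone := d.cone
  ne := d.ne
  PP x := by simp [d.PP]
  adj x y := by simp [d.adj]
  pos x hx := by
    have h1 := d.split x
    have h2 := d.pos x hx
    rw [((d.memC x).1 hx).2] at h1
    simp only [LinearMap.neg_apply, LinearMap.sub_apply, LinearMap.id_apply]
    linarith
  hp x hx y hy := by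
    have := d.hm x hx y hy
    simp only [LinearMap.neg_apply, LinearMap.sub_apply, LinearMap.id_apply]
    linarith
  hm x hx y hy := by
    have := d.hp x hx y hy
    simp only [LinearMap.neg_apply, LinearMap.sub_apply, LinearMap.id_apply, sub_sub_cancel]
    linarith
  cl a ha h := by
    refine d.cl a ha fun h0 => h ?_
    have h1 := d.split a
    rw [d.null_closure ha] at h1
    simp only [LinearMap.neg_apply, LinearMap.sub_apply, LinearMap.id_apply]
    linarith

theorem conn {S : Set X} (hS : IsPreconnected S) (h0 : ∀ x ∈ S, d.B x x = 0)
    (h1 : ∀ x ∈ S, d.B (d.P x) (d.P x) ≠ 0) {c : X} (hcS : c ∈ S) (hc : c ∈ d.C) : S ⊆ d.C := by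
  intro y hy
  by_contra hyC
  have hycl : y ∉ closure d.C := fun h => hyC (d.cl y h (h1 y hy))
  obtain ⟨z, hzS, hzU, hzc⟩ := hS d.U (closure d.C)ᶜ d.Uopen isClosed_closure.isOpen_compl
    (fun x hx => by
      by_cases h : x ∈ closure d.C
      · exact Or.inl ((d.memC x).1 (d.cl x h (h1 x hx))).1
      · exact Or.inr h)
    ⟨c, hcS, ((d.memC c).1 hc).1⟩ ⟨y, hy, hycl⟩
  exact hzc (subset_closure ((d.memC z).2 ⟨hzU, h0 z hzS⟩))

/-- A normalised base point. -/
structure Base (v w : X) : Prop where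
  Pv : d.P v = v
  Pw : d.P w = 0
  vv : d.B v v = 1
  ww : d.B w w = -1
  mem : v + w ∈ d.C

theorem exists_base : ∃ v w, d.Base v w := by
  obtain ⟨c, hc⟩ := d.ne
  have h1 := d.pos c hc
  set r := d.B (d.P c) (d.P c) with hr
  have h2 := d.split c
  rw [((d.memC c).1 hc).2] at h2
  have hs : 0 < Real.sqrt r := Real.sqrt_pos.2 h1
  have hss : Real.sqrt r * Real.sqrt r = r := Real.mul_self_sqrt h1.le
  refine ⟨(Real.sqrt r)⁻¹ • d.P c, (Real.sqrt r)⁻¹ • (c - d.P c), ?_, ?_, ?_, ?_, ?_⟩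
  · rw [map_smul, d.PP]
  · rw [map_smul, map_sub, d.PP, sub_self, smul_zero]
  · simp only [map_smul, LinearMap.smul_apply, smul_eq_mul, ← hr]
    rw [← mul_assoc, ← mul_inv, hss, inv_mul_cancel₀ h1.ne']
  · have h3 : d.B (c - d.P c) (c - d.P c) = -r := by linarith
    rw [map_smul, map_smul, LinearMap.smul_apply, h3, smul_eq_mul, smul_eq_mul,
      ← mul_assoc, ← mul_inv, hss, mul_neg, inv_mul_cancel₀ h1.ne']
  · rw [← smul_add, add_sub_cancel]
    exact d.cone c hc _ (by positivity)

variable {d}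

theorem Base.vw {v w : X} (b : d.Base v w) {u z : X} (hu : d.P u = u) (hz : d.P z = 0) :
    d.B u z = 0 := by
  rw [← hu, d.adj, hz, map_zero]

theorem Base.flip {v w : X} (b : d.Base v w) : d.flip.Base w v where
  Pv := by simp [PDat.flip, b.Pw]
  Pw := by simp [PDat.flip, b.Pv]
  vv := by simp [PDat.flip, b.ww]
  ww := by simp [PDat.flip, b.vv]
  mem := by rw [add_comm]; exact b.mem

theorem Base.nonpos {v w : X} (b : d.Base v w) {u : X} (hu : d.P u = u) (huv : d.B u v = 0) :
    d.B u u ≤ 0 := by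
  by_contra! h
  set r := Real.sqrt (d.B u u) with hr
  have hr0 : 0 < r := Real.sqrt_pos.2 h
  have hrr : r * r = d.B u u := Real.mul_self_sqrt h.le
  set u' := r⁻¹ • u with hu'
  have h1 : d.B u' u' = 1 := by
    rw [hu', map_smul, map_smul, LinearMap.smul_apply, ← hrr, smul_eq_mul, smul_eq_mul]
    field_simp
  have h2 : d.P u' = u' := by rw [hu', map_smul, hu]
  have h3 : d.B u' v = 0 := by rw [hu', map_smul, LinearMap.smul_apply, huv, smul_zero]
  have h3' : d.B v u' = 0 := by rw [d.symm, h3]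
  let γ : ℝ → X := fun θ => Real.cos θ • v + Real.sin θ • u' + w
  have hγP : ∀ θ, d.P (γ θ) = Real.cos θ • v + Real.sin θ • u' := by
    intro θ
    simp only [γ, map_add, map_smul, b.Pv, b.Pw, h2, add_zero]
  have hγ1 : ∀ θ, d.B (d.P (γ θ)) (d.P (γ θ)) = 1 := by
    intro θ
    rw [hγP]
    simp only [map_add, map_smul, LinearMap.add_apply, LinearMap.smul_apply, b.vv, h1, h3, h3',
      smul_eq_mul]
    nlinarith [Real.sin_sq_add_cos_sq θ]
  have hγ0 : ∀ θ, d.B (γ θ) (γ θ) = 0 := by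
    intro θ
    rw [d.split, hγ1, hγP]
    simp only [γ, add_sub_cancel_left, b.ww]
    norm_num
  have hsub : range γ ⊆ d.C := by
    refine d.conn (c := v + w) (isPreconnected_range (by fun_prop)) ?_ ?_ ⟨0, by simp [γ]⟩ b.mem
    · rintro _ ⟨θ, rfl⟩; exact hγ0 θ
    · rintro _ ⟨θ, rfl⟩; rw [hγ1]; norm_num
  have h4 := d.hp _ b.mem _ (hsub ⟨Real.pi, rfl⟩)
  rw [hγP] at h4
  simp [b.Pv, b.Pw, b.vv] at h4
  linarith

theorem Base.neg {v w : X} (b : d.Base v w) {u : X} (hu : d.P u = u) (huv : d.B u v = 0)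
    (hu0 : u ≠ 0) : d.B u u < 0 := by
  refine lt_of_le_of_ne (b.nonpos hu huv) fun h => hu0 (d.nondeg u fun y => ?_)
  set z := d.P y - d.B (d.P y) v • v with hz
  have hzP : d.P z = z := by rw [hz, map_sub, map_smul, d.PP, b.Pv]
  have hzv : d.B z v = 0 := by
    rw [hz, map_sub, LinearMap.sub_apply, map_smul, LinearMap.smul_apply, b.vv]; simp
  have h1 : d.B u y = d.B u z := by
    rw [hz, map_sub, map_smul, huv, smul_zero, sub_zero, ← d.adj, hu]
  rw [h1]
  have h2 : ∀ t : ℝ, d.B z z + 2 * t * d.B u z ≤ 0 := by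
    intro t
    have := b.nonpos (u := z + t • u) (by rw [map_add, map_smul, hzP, hu])
      (by rw [map_add, map_smul, LinearMap.add_apply, LinearMap.smul_apply, hzv, huv]; simp)
    simp only [map_add, map_smul, LinearMap.add_apply, LinearMap.smul_apply, smul_eq_mul, h,
      d.symm z u] at this
    linarith
  by_contra h3
  have h4 := h2 ((1 - d.B z z) / (2 * d.B u z))
  have h5 : 2 * ((1 - d.B z z) / (2 * d.B u z)) * d.B u z = 1 - d.B z z := by
    field_simp
  linarith

theorem Base.posd {v w : X} (b : d.Base v w) {u : X} (hu : d.P u = 0) (huw : d.B u w = 0)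
    (hu0 : u ≠ 0) : 0 < d.B u u := by
  have := b.flip.neg (u := u) (by simp [PDat.flip, hu]) (by simp [PDat.flip, huw]) hu0
  simp only [PDat.flip, LinearMap.neg_apply] at this
  linarith

end PDat

theorem exists_onb {Y : Type*} [AddCommGroup Y] [Module ℝ Y] [FiniteDimensional ℝ Y]
    (B : Y →ₗ[ℝ] Y →ₗ[ℝ] ℝ) (hs : ∀ x y, B x y = B y x) (hpos : ∀ x, x ≠ 0 → 0 < B x x)
    {n : ℕ} (hn : Module.finrank ℝ Y = n) :
    ∃ b : Fin n → Y, (∀ i j, B (b i) (b j) = if i = j then 1 else 0) ∧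
      ⊤ ≤ Submodule.span ℝ (range b) := by
  let c : InnerProductSpace.Core ℝ Y :=
    { inner := fun x y => B x y
      conj_inner_symm := fun x y => by simp [hs x y]
      re_inner_nonneg := fun x => by
        by_cases h : x = 0
        · simp [h]
        · simpa using (hpos x h).le
      add_left := fun x y z => by simp
      smul_left := fun x y r => by simp
      definite := fun x h => by
        by_contra h0
        exact (hpos x h0).ne' h }
  letI : NormedAddCommGroup Y := c.toNormedAddCommGroup
  letI : InnerProductSpace ℝ Y := InnerProductSpace.ofCore c.toCore
  let b := (stdOrthonormalBasis ℝ Y).reindex (finCongr hn)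
  refine ⟨b, fun i j => ?_, ?_⟩
  · exact orthonormal_iff_ite.1 b.orthonormal i j
  · have := b.toBasis.span_eq
    rw [OrthonormalBasis.coe_toBasis] at this
    exact this.ge

theorem finrank_add_le_of_definite {X Y Z : Type*} [AddCommGroup X] [Module ℝ X]
    [FiniteDimensional ℝ X] [AddCommGroup Y] [Module ℝ Y] [FiniteDimensional ℝ Y]
    [AddCommGroup Z] [Module ℝ Z] [FiniteDimensional ℝ Z] (Q : X → ℝ)
    (hQ0 : Q 0 = 0) (hQ : ∀ x, Q (-x) = Q x) (L : Y →ₗ[ℝ] X) (M : Z →ₗ[ℝ] X) (hL : ∀ y, y ≠ 0 → Q (L y) < 0)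
    (hM : ∀ z, z ≠ 0 → 0 < Q (M z)) :
    Module.finrank ℝ Y + Module.finrank ℝ Z ≤ Module.finrank ℝ X := by
  rw [← Module.finrank_prod]
  refine LinearMap.finrank_le_finrank_of_injective (f := L.coprod M) ?_
  rw [injective_iff_map_eq_zero]
  rintro ⟨y, z⟩ h
  rw [LinearMap.coprod_apply] at h
  have h1 : L y = -(M z) := eq_neg_of_add_eq_zero_left h
  have h2 : Q (L y) = Q (M z) := by rw [h1, hQ]
  by_cases hy : y = 0
  · by_cases hz : z = 0
    · simp [hy, hz]
    · have h3 := hM z hz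
      rw [← h2, hy, map_zero, hQ0] at h3
      exact absurd h3 (lt_irrefl _)
  · by_cases hz : z = 0
    · have h3 := hL y hy
      rw [h2, hz, map_zero, hQ0] at h3
      exact absurd h3 (lt_irrefl _)
    · have := hL y hy
      have := hM z hz
      linarith

/-! ### The concrete model -/

theorem b0_eq (p : ℕ) (v v' : Fin (p + 1) → ℝ) :
    b0 p v v' = -(∑ i : Fin p, v i.castSucc * v' i.castSucc) +
      v (Fin.last p) * v' (Fin.last p) := by
  simp [b0, Fin.sum_univ_castSucc]

theorem b1_eq (q : ℕ) (v v' : Fin (q + 1) → ℝ) :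
    b1 q v v' = (∑ i : Fin q, v i.castSucc * v' i.castSucc) -
      v (Fin.last q) * v' (Fin.last q) := by
  simp [b1, Fin.sum_univ_castSucc, sub_eq_add_neg]

/-- The form `bPair` as a bilinear map. -/
def Bl (p q : ℕ) : PairV p q →ₗ[ℝ] PairV p q →ₗ[ℝ] ℝ :=
  LinearMap.mk₂ ℝ (bPair p q)
    (fun x y z => by
      simp only [bPair, b0, b1, Prod.fst_add, Prod.snd_add, Pi.add_apply, mul_add, add_mul,
        Finset.sum_add_distrib]; ring)
    (fun c x y => by
      simp only [bPair, b0, b1, Prod.smul_fst, Prod.smul_snd, Pi.smul_apply, smul_eq_mul,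
        mul_add, Finset.mul_sum]
      congr 1 <;> exact Finset.sum_congr rfl fun i _ => by ring)
    (fun x y z => by
      simp only [bPair, b0, b1, Prod.fst_add, Prod.snd_add, Pi.add_apply, mul_add,
        Finset.sum_add_distrib]; ring)
    (fun c x y => by
      simp only [bPair, b0, b1, Prod.smul_fst, Prod.smul_snd, Pi.smul_apply, smul_eq_mul,
        mul_add, Finset.mul_sum]
      congr 1 <;> exact Finset.sum_congr rfl fun i _ => by ring)

theorem Bl_apply (p q : ℕ) (x y : PairV p q) : Bl p q x y = bPair p q x y := rfl

theorem Bl_symm (p q : ℕ) (x y : PairV p q) : Bl p q x y = Bl p q y x := by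
  simp only [Bl_apply, bPair, b0, b1]
  congr 1 <;> exact Finset.sum_congr rfl fun i _ => by ring

/-- The form evaluated in coordinates. -/
theorem Bl_eq (p q : ℕ) (x y : PairV p q) : Bl p q x y =
    -(∑ i : Fin p, x.1 i.castSucc * y.1 i.castSucc) + x.1 (Fin.last p) * y.1 (Fin.last p) +
      ((∑ i : Fin q, x.2 i.castSucc * y.2 i.castSucc) -
        x.2 (Fin.last q) * y.2 (Fin.last q)) := by
  rw [Bl_apply, bPair, b0_eq, b1_eq]

theorem Bl_nondeg (p q : ℕ) (x : PairV p q) (h : ∀ y, Bl p q x y = 0) : x = 0 := by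
  have h1 := h (fun i => (if (i : ℕ) < p then (-1 : ℝ) else 1) * x.1 i,
    fun i => (if (i : ℕ) < q then (1 : ℝ) else -1) * x.2 i)
  have h2 : (∑ i, x.1 i * x.1 i) + ∑ i, x.2 i * x.2 i = 0 := by
    rw [← h1, Bl_apply, bPair, b0, b1]
    congr 1 <;> refine Finset.sum_congr rfl fun i _ => ?_ <;> dsimp only <;> split_ifs <;> ring
  have h3 : 0 ≤ ∑ i, x.1 i * x.1 i := Finset.sum_nonneg fun i _ => mul_self_nonneg _
  have h4 : 0 ≤ ∑ i, x.2 i * x.2 i := Finset.sum_nonneg fun i _ => mul_self_nonneg _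
  have h5 : ∑ i, x.1 i * x.1 i = 0 := by linarith
  have h6 : ∑ i, x.2 i * x.2 i = 0 := by linarith
  rw [Finset.sum_eq_zero_iff_of_nonneg fun i _ => mul_self_nonneg _] at h5 h6
  ext i
  · exact mul_self_eq_zero.1 (h5 i (Finset.mem_univ i))
  · exact mul_self_eq_zero.1 (h6 i (Finset.mem_univ i))

theorem sum_sq_pos {n : ℕ} {a : Fin n → ℝ} {t : ℝ} (h : ¬ (a = 0 ∧ t = 0)) :
    0 < (∑ i, a i * a i) + t * t := by
  have h3 : 0 ≤ ∑ i, a i * a i := Finset.sum_nonneg fun i _ => mul_self_nonneg _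
  have h4 := mul_self_nonneg t
  refine lt_of_le_of_ne (by positivity) fun h0 => h ⟨?_, ?_⟩
  · have h5 : ∑ i, a i * a i = 0 := by linarith
    rw [Finset.sum_eq_zero_iff_of_nonneg fun i _ => mul_self_nonneg _] at h5
    ext i
    exact mul_self_eq_zero.1 (h5 i (Finset.mem_univ i))
  · have h5 : t * t = 0 := by linarith
    exact mul_self_eq_zero.1 h5

/-- Extension of a vector by a last coordinate, as a linear map. -/
def snocL (n : ℕ) : ((Fin n → ℝ) × ℝ) →ₗ[ℝ] (Fin (n + 1) → ℝ) where
  toFun x := Fin.snoc (α := fun _ => ℝ) x.1 x.2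
  map_add' x y := by
    ext i
    refine Fin.lastCases ?_ (fun i => ?_) i <;> simp
  map_smul' c x := by
    ext i
    refine Fin.lastCases ?_ (fun i => ?_) i <;> simp

@[simp] theorem snocL_last (n : ℕ) (x : (Fin n → ℝ) × ℝ) : snocL n x (Fin.last n) = x.2 := by
  simp [snocL]

@[simp] theorem snocL_castSucc (n : ℕ) (x : (Fin n → ℝ) × ℝ) (i : Fin n) :
    snocL n x i.castSucc = x.1 i := by
  simp [snocL]

/-- standard positive definite subspace -/
def stdPos (p q : ℕ) : ((Fin q → ℝ) × ℝ) →ₗ[ℝ] PairV p q :=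
  LinearMap.prod (snocL p ∘ₗ LinearMap.prod 0 (LinearMap.snd ℝ _ _))
    (snocL q ∘ₗ LinearMap.prod (LinearMap.fst ℝ _ _) 0)

/-- standard negative definite subspace -/
def stdNeg (p q : ℕ) : ((Fin p → ℝ) × ℝ) →ₗ[ℝ] PairV p q :=
  LinearMap.prod (snocL p ∘ₗ LinearMap.prod (LinearMap.fst ℝ _ _) 0)
    (snocL q ∘ₗ LinearMap.prod 0 (LinearMap.snd ℝ _ _))

theorem stdPos_pos (p q : ℕ) (y : (Fin q → ℝ) × ℝ) (hy : y ≠ 0) :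
    0 < Bl p q (stdPos p q y) (stdPos p q y) := by
  have h : Bl p q (stdPos p q y) (stdPos p q y) = (∑ i, y.1 i * y.1 i) + y.2 * y.2 := by
    rw [Bl_eq]; simp [stdPos]; ring
  rw [h]
  refine sum_sq_pos fun h => hy (Prod.ext h.1 h.2)

theorem stdNeg_neg (p q : ℕ) (y : (Fin p → ℝ) × ℝ) (hy : y ≠ 0) :
    Bl p q (stdNeg p q y) (stdNeg p q y) < 0 := by
  have h : Bl p q (stdNeg p q y) (stdNeg p q y) = -((∑ i, y.1 i * y.1 i) + y.2 * y.2) := by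
    rw [Bl_eq]; simp [stdNeg]; ring
  rw [h, neg_lt_zero]
  refine sum_sq_pos fun h => hy (Prod.ext h.1 h.2)

theorem finrank_pair (p q : ℕ) : Module.finrank ℝ (PairV p q) = p + 1 + (q + 1) := by
  simp

namespace PDat

variable {p q : ℕ}

/-- The final description of the cone. -/
theorem exists_model (d : PDat (PairV p q)) (hB : d.B = Bl p q) :
    ∃ g : PairV p q ≃ₗ[ℝ] PairV p q, (∀ x y, Bl p q (g x) (g y) = Bl p q x y) ∧
      ∀ x, x ∈ d.C ↔ ∃ t : ℝ, 0 < t ∧ ∃ y : PairV p q, x = t • g y ∧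
        b0 p y.1 y.1 = 1 ∧ 0 < y.1 (Fin.last p) ∧ b1 q y.2 y.2 = -1 ∧ 0 < y.2 (Fin.last q) := by
  obtain ⟨v, w, b⟩ := d.exists_base
  let Np : Submodule ℝ (PairV p q) :=
    LinearMap.ker (d.P - LinearMap.id) ⊓ LinearMap.ker (d.B.flip v)
  let Nm : Submodule ℝ (PairV p q) := LinearMap.ker d.P ⊓ LinearMap.ker (d.B.flip w)
  have hNp : ∀ u, u ∈ Np ↔ d.P u = u ∧ d.B u v = 0 := fun u => by
    simp [Np, sub_eq_zero]
  have hNm : ∀ u, u ∈ Nm ↔ d.P u = 0 ∧ d.B u w = 0 := fun u => by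
    simp [Nm]
  have hd0 : d.B 0 0 = 0 := by simp
  have hdn : ∀ x, d.B (-x) (-x) = d.B x x := by simp
  have hvw := b.vw b.Pv b.Pw
  have hwv : d.B w v = 0 := by rw [d.symm, hvw]
  have d1 : Module.finrank ℝ Np + 1 + (q + 1) ≤ p + 1 + (q + 1) := by
    have := finrank_add_le_of_definite (fun x => d.B x x) hd0 hdn
      (Np.subtype.coprod (LinearMap.toSpanSingleton ℝ (PairV p q) w)) (stdPos p q) ?_ ?_
    · simpa using this
    · rintro ⟨⟨u, hu⟩, t⟩ hne
      obtain ⟨h1, h2⟩ := (hNp u).1 hu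
      have h3 := b.vw h1 b.Pw
      have h4 : d.B w u = 0 := by rw [d.symm, h3]
      simp only [LinearMap.coprod_apply, Submodule.subtype_apply,
        LinearMap.toSpanSingleton_apply, map_add, map_smul, LinearMap.add_apply,
        LinearMap.smul_apply, h3, h4, b.ww, smul_eq_mul]
      by_cases hu0 : u = 0
      · have ht : t ≠ 0 := by
          rintro rfl; subst hu0; exact hne rfl
        have := mul_self_pos.2 ht
        rw [hu0]; simp; exact ht
      · have := b.neg h1 h2 hu0
        nlinarith [mul_self_nonneg t]
    · intro z hz
      simp only [hB]
      exact stdPos_pos p q z hz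
  have d2 : p + 1 + (Module.finrank ℝ Nm + 1) ≤ p + 1 + (q + 1) := by
    have := finrank_add_le_of_definite (fun x => d.B x x) hd0 hdn (stdNeg p q)
      (Nm.subtype.coprod (LinearMap.toSpanSingleton ℝ (PairV p q) v)) ?_ ?_
    · simpa using this
    · intro z hz
      simp only [hB]
      exact stdNeg_neg p q z hz
    · rintro ⟨⟨u, hu⟩, t⟩ hne
      obtain ⟨h1, h2⟩ := (hNm u).1 hu
      have h3 := b.vw b.Pv h1
      have h4 : d.B u v = 0 := by rw [d.symm, h3]
      simp only [LinearMap.coprod_apply, Submodule.subtype_apply,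
        LinearMap.toSpanSingleton_apply, map_add, map_smul, LinearMap.add_apply,
        LinearMap.smul_apply, h3, h4, b.vv, smul_eq_mul]
      by_cases hu0 : u = 0
      · have ht : t ≠ 0 := by
          rintro rfl; subst hu0; exact hne rfl
        have := mul_self_pos.2 ht
        rw [hu0]; simp; exact ht
      · have := b.posd h1 h2 hu0
        nlinarith [mul_self_nonneg t]
  have d3 : p + 1 + (q + 1) ≤ Module.finrank ℝ Np + 1 + (Module.finrank ℝ Nm + 1) := by
    have h : Function.Surjective
        ((Np.subtype.coprod (LinearMap.toSpanSingleton ℝ (PairV p q) v)).coprod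
          (Nm.subtype.coprod (LinearMap.toSpanSingleton ℝ (PairV p q) w))) := by
      intro x
      refine ⟨((⟨d.P x - d.B x v • v, ?_⟩, d.B x v),
        (⟨x - d.P x + d.B x w • w, ?_⟩, -d.B x w)), ?_⟩
      · rw [hNp]
        constructor
        · rw [map_sub, map_smul, d.PP, b.Pv]
        · rw [map_sub, map_smul, LinearMap.sub_apply, LinearMap.smul_apply, d.adj, b.Pv, b.vv]
          simp
      · rw [hNm]
        constructor
        · simp [d.PP, b.Pw]
        · rw [map_add, map_sub, map_smul, LinearMap.add_apply, LinearMap.sub_apply,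
            LinearMap.smul_apply, d.adj, b.Pw, b.ww]
          simp
      · simp only [LinearMap.coprod_apply, Submodule.subtype_apply,
          LinearMap.toSpanSingleton_apply, neg_smul]
        abel
    have := LinearMap.finrank_le_finrank_of_surjective h
    simpa using this
  obtain ⟨n, hn, -⟩ := exists_onb (Y := Np) (n := p)
    (-(d.B.compl₁₂ Np.subtype Np.subtype)) (fun x y => by simp [d.symm (x : PairV p q)])
    (fun x hx => by
      have := b.neg ((hNp x).1 x.2).1 ((hNp x).1 x.2).2 (fun h => hx (Subtype.ext h))
      simpa using this) (by omega)
  obtain ⟨m, hm, -⟩ := exists_onb (Y := Nm) (n := q)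
    (d.B.compl₁₂ Nm.subtype Nm.subtype) (fun x y => by simp [d.symm (x : PairV p q)])
    (fun x hx => by
      have := b.posd ((hNm x).1 x.2).1 ((hNm x).1 x.2).2 (fun h => hx (Subtype.ext h))
      simpa using this) (by omega)
  have hn1 : ∀ i j, d.B (n i : PairV p q) (n j) = -(if i = j then 1 else 0) := fun i j => by
    rw [← hn i j]; simp
  have hm1 : ∀ i j, d.B (m i : PairV p q) (m j) = (if i = j then 1 else 0) := fun i j => by
    rw [← hm i j]; simp
  have hnP : ∀ i, d.P (n i) = n i := fun i => ((hNp _).1 (n i).2).1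
  have hnv : ∀ i, d.B (n i) v = 0 := fun i => ((hNp _).1 (n i).2).2
  have hvn : ∀ i, d.B v (n i) = 0 := fun i => by rw [d.symm, hnv]
  have hmP : ∀ i, d.P (m i) = 0 := fun i => ((hNm _).1 (m i).2).1
  have hmw : ∀ i, d.B (m i) w = 0 := fun i => ((hNm _).1 (m i).2).2
  have hwm : ∀ i, d.B w (m i) = 0 := fun i => by rw [d.symm, hmw]
  let F : (Fin (p + 1) → ℝ) →ₗ[ℝ] PairV p q :=
    (∑ i : Fin p, (LinearMap.proj i.castSucc).smulRight (n i : PairV p q)) +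
      (LinearMap.proj (Fin.last p)).smulRight v
  let H : (Fin (q + 1) → ℝ) →ₗ[ℝ] PairV p q :=
    (∑ i : Fin q, (LinearMap.proj i.castSucc).smulRight (m i : PairV p q)) +
      (LinearMap.proj (Fin.last q)).smulRight w
  have hF : ∀ a, F a = (∑ i : Fin p, a i.castSucc • (n i : PairV p q)) + a (Fin.last p) • v :=
    fun a => by simp [F]
  have hH : ∀ a, H a = (∑ i : Fin q, a i.castSucc • (m i : PairV p q)) + a (Fin.last q) • w :=
    fun a => by simp [H]
  have hFP : ∀ a, d.P (F a) = F a := fun a => by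
    rw [hF]; simp [hnP, b.Pv]
  have hHP : ∀ a, d.P (H a) = 0 := fun a => by
    rw [hH]; simp [hmP, b.Pw]
  have hFB : ∀ a a', d.B (F a) (F a') = b0 p a a' := fun a a' => by
    rw [hF, hF, b0_eq]
    simp only [map_add, map_sum, map_smul, LinearMap.add_apply, LinearMap.sum_apply,
      LinearMap.smul_apply, hn1, hnv, hvn, b.vv, smul_eq_mul]
    simp [mul_comm]
  have hHB : ∀ a a', d.B (H a) (H a') = b1 q a a' := fun a a' => by
    rw [hH, hH, b1_eq]
    simp only [map_add, map_sum, map_smul, LinearMap.add_apply, LinearMap.sum_apply,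
      LinearMap.smul_apply, hm1, hmw, hwm, b.ww, smul_eq_mul]
    simp [mul_comm, sub_eq_add_neg]
  let g0 : PairV p q →ₗ[ℝ] PairV p q := F.coprod H
  have hg0 : ∀ x y, d.B (g0 x) (g0 y) = Bl p q x y := fun x y => by
    have h1 := b.vw (hFP x.1) (hHP y.2)
    have h2 : d.B (H x.2) (F y.1) = 0 := by rw [d.symm, b.vw (hFP y.1) (hHP x.2)]
    simp only [g0, LinearMap.coprod_apply, map_add, LinearMap.add_apply, h1, h2, hFB, hHB]
    rw [Bl_apply, bPair]; ring
  have hinj : Function.Injective g0 := by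
    rw [injective_iff_map_eq_zero]
    intro x hx
    refine Bl_nondeg p q x fun y => ?_
    rw [← hg0, hx]; simp
  let g : PairV p q ≃ₗ[ℝ] PairV p q := LinearEquiv.ofInjectiveEndo g0 hinj
  have hg : ∀ x, g x = F x.1 + H x.2 := fun x => by
    simp [g, g0]
  have hgP : ∀ x, d.P (g x) = F x.1 := fun x => by
    rw [hg, map_add, hFP, hHP, add_zero]
  have hgB : ∀ x y, d.B (g x) (g y) = Bl p q x y := hg0
  have hv0 : F (snocL p (0, 1)) = v := by rw [hF]; simp
  have hw0 : H (snocL q (0, 1)) = w := by rw [hH]; simp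
  refine ⟨g, fun x y => by have h := hgB x y; rw [hB] at h; exact h, fun x => ⟨fun hx => ?_, ?_⟩⟩
  · obtain ⟨y, rfl⟩ := g.surjective x
    have h1 := d.pos _ hx
    rw [hgP, hFB] at h1
    have h2 := ((d.memC _).1 hx).2
    rw [hgB, Bl_apply, bPair] at h2
    have h3 := d.hp _ hx _ b.mem
    rw [hgP, map_add, b.Pv, b.Pw, add_zero, ← hv0, hFB, b0_eq] at h3
    have h4 := d.hm _ hx _ b.mem
    rw [hgP, hg, map_add, b.Pv, b.Pw, add_zero, add_sub_cancel_left, add_sub_cancel_left,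
      ← hw0, hHB, b1_eq] at h4
    simp at h3 h4
    set r := b0 p y.1 y.1 with hr
    have hs : 0 < Real.sqrt r := Real.sqrt_pos.2 h1
    have hss : Real.sqrt r * Real.sqrt r = r := Real.mul_self_sqrt h1.le
    set s := Real.sqrt r
    have e1 : b0 p (s⁻¹ • y.1) (s⁻¹ • y.1) = 1 := by
      rw [← hFB, map_smul, map_smul, map_smul, LinearMap.smul_apply, hFB, ← hr, ← hss,
        smul_eq_mul, smul_eq_mul]
      field_simp
    have e2 : b1 q (s⁻¹ • y.2) (s⁻¹ • y.2) = -1 := by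
      have : b1 q y.2 y.2 = -(s * s) := by linarith
      rw [← hHB, map_smul, map_smul, map_smul, LinearMap.smul_apply, hHB, this,
        smul_eq_mul, smul_eq_mul]
      field_simp
    refine ⟨s, hs, s⁻¹ • y, ?_, e1, ?_, e2, ?_⟩
    · rw [map_smul, smul_smul, mul_inv_cancel₀ hs.ne', one_smul]
    · refine lt_of_le_of_ne (mul_nonneg (by positivity) h3) fun h => ?_
      rw [b0_eq] at e1
      have h7 : 0 ≤ ∑ i : Fin p, (s⁻¹ • y.1) i.castSucc * (s⁻¹ • y.1) i.castSucc :=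
        Finset.sum_nonneg fun i _ => mul_self_nonneg _
      have h8 : (s⁻¹ • y.1) (Fin.last p) = 0 := h.symm
      rw [h8] at e1
      linarith
    · refine lt_of_le_of_ne (mul_nonneg (by positivity) h4) fun h => ?_
      rw [b1_eq] at e2
      have h7 : 0 ≤ ∑ i : Fin q, (s⁻¹ • y.2) i.castSucc * (s⁻¹ • y.2) i.castSucc :=
        Finset.sum_nonneg fun i _ => mul_self_nonneg _
      have h8 : (s⁻¹ • y.2) (Fin.last q) = 0 := h.symm
      rw [h8] at e2
      linarith
  · rintro ⟨t, ht, y, rfl, y1, y2, y3, y4⟩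
    refine d.cone _ ?_ t ht
    let γ : (Fin p → ℝ) × (Fin q → ℝ) → PairV p q := fun a =>
      g (snocL p (a.1, Real.sqrt (1 + ∑ i, a.1 i * a.1 i)),
        snocL q (a.2, Real.sqrt (1 + ∑ i, a.2 i * a.2 i)))
    have hb0 : ∀ a : Fin p → ℝ, b0 p (snocL p (a, Real.sqrt (1 + ∑ i, a i * a i)))
        (snocL p (a, Real.sqrt (1 + ∑ i, a i * a i))) = 1 := by
      intro a
      have h7 : 0 ≤ ∑ i : Fin p, a i * a i := Finset.sum_nonneg fun i _ => mul_self_nonneg _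
      rw [b0_eq]
      simp only [snocL_last, snocL_castSucc]
      rw [Real.mul_self_sqrt (by positivity)]
      ring
    have hb1 : ∀ a : Fin q → ℝ, b1 q (snocL q (a, Real.sqrt (1 + ∑ i, a i * a i)))
        (snocL q (a, Real.sqrt (1 + ∑ i, a i * a i))) = -1 := by
      intro a
      have h7 : 0 ≤ ∑ i : Fin q, a i * a i := Finset.sum_nonneg fun i _ => mul_self_nonneg _
      rw [b1_eq]
      simp only [snocL_last, snocL_castSucc]
      rw [Real.mul_self_sqrt (by positivity)]
      ring
    have hcont : Continuous γ := by
      have hg1 : Continuous g := LinearMap.continuous_of_finiteDimensional g.toLinearMap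
      have hs1 : Continuous (snocL p) := LinearMap.continuous_of_finiteDimensional _
      have hs2 : Continuous (snocL q) := LinearMap.continuous_of_finiteDimensional _
      fun_prop
    have hsub : range γ ⊆ d.C := by
      refine d.conn (c := v + w) (isPreconnected_range hcont) ?_ ?_ ⟨(0, 0), ?_⟩ b.mem
      · rintro _ ⟨a, rfl⟩
        simp only [γ]
        rw [hgB, Bl_apply, bPair, hb0, hb1]; norm_num
      · rintro _ ⟨a, rfl⟩
        simp only [γ]
        rw [hgP, hFB, hb0]; norm_num
      · simp only [γ]
        rw [hg]
        simp [hv0, hw0]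
    refine hsub ⟨(fun i => y.1 i.castSucc, fun i => y.2 i.castSucc), ?_⟩
    simp only [γ]
    congr 1
    rw [b0_eq] at y1
    rw [b1_eq] at y3
    ext i
    · refine Fin.lastCases ?_ (fun i => ?_) i
      · simp only [snocL_last]
        rw [Real.sqrt_eq_iff_mul_self_eq_of_pos y2]; linarith
      · simp
    · refine Fin.lastCases ?_ (fun i => ?_) i
      · simp only [snocL_last]
        rw [Real.sqrt_eq_iff_mul_self_eq_of_pos y4]; linarith
      · simp

end PDat

/-! ### Topology of the projective space -/

section ProjTop

variable {X : Type} [NormedAddCommGroup X] [NormedSpace ℝ X]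

/-- the quotient map -/
def pm (x : {x : X // x ≠ 0}) : ℙ ℝ X := Projectivization.mk ℝ x.1 x.2

theorem pm_quot : IsQuotientMap (pm (X := X)) :=
  isQuotientMap_quotient_mk' (s := projectivizationSetoid ℝ X)

theorem isOpen_cone {O : Set (ℙ ℝ X)} (hO : IsOpen O) :
    IsOpen {x : X | ∃ h, Projectivization.mk ℝ x h ∈ O} := by
  have h1 : IsOpen (pm ⁻¹' O) := hO.preimage pm_quot.continuous
  have h2 : IsOpen {x : X | x ≠ 0} := isOpen_ne
  have h3 := h2.isOpenMap_subtype_val _ h1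
  convert h3 using 1
  ext x
  constructor
  · rintro ⟨h, hx⟩
    exact ⟨⟨x, h⟩, hx, rfl⟩
  · rintro ⟨⟨y, h⟩, hy, rfl⟩
    exact ⟨h, hy⟩

theorem mk_smul {x : X} (h : x ≠ 0) {t : ℝ} (ht : t ≠ 0) (h' : t • x ≠ 0) :
    Projectivization.mk ℝ (t • x) h' = Projectivization.mk ℝ x h := by
  rw [Projectivization.mk_eq_mk_iff']
  exact ⟨t, rfl⟩

theorem rep_pos {f : X → ℝ} (hom : ∀ (a : ℝ) x, f (a • x) = a ^ 2 * f x) {x : X} (h : x ≠ 0) :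
    0 < f (Projectivization.mk ℝ x h).rep ↔ 0 < f x := by
  obtain ⟨a, ha⟩ := Projectivization.exists_smul_eq_mk_rep ℝ x h
  have ha0 : (a : ℝ) ≠ 0 := a.ne_zero
  rw [← ha, Units.smul_def, hom]
  exact mul_pos_iff_of_pos_left (by positivity)

theorem isOpen_rep {f : X → ℝ} (hf : Continuous f) (hom : ∀ (a : ℝ) x, f (a • x) = a ^ 2 * f x) :
    IsOpen {y : ℙ ℝ X | 0 < f y.rep} := by
  rw [← pm_quot.isOpen_preimage]
  have : pm ⁻¹' {y : ℙ ℝ X | 0 < f y.rep} = {x : {x : X // x ≠ 0} | 0 < f x.1} := by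
    ext x
    exact rep_pos hom x.2
  rw [this]
  exact isOpen_lt continuous_const (hf.comp continuous_subtype_val)

/-- separating functions -/
def sepFun (φ : X →L[ℝ] ℝ) (x : X) : X := (φ x / ‖x‖ ^ 2) • x

theorem projT2 : T2Space (ℙ ℝ X) := by
  have hinv : ∀ x : ℙ ℝ X, ∀ y (h : y ≠ 0), x = Projectivization.mk ℝ y h →
      ∀ φ : X →L[ℝ] ℝ, sepFun φ x.rep = sepFun φ y := by
    rintro _ y h rfl φ
    obtain ⟨a, ha⟩ := Projectivization.exists_smul_eq_mk_rep ℝ y h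
    have ha0 : (a : ℝ) ≠ 0 := a.ne_zero
    rw [← ha, Units.smul_def, sepFun, sepFun, map_smul, norm_smul, smul_smul, smul_eq_mul,
      mul_pow, Real.norm_eq_abs, sq_abs]
    congr 1
    have : ‖y‖ ≠ 0 := norm_ne_zero_iff.2 h
    field_simp
  let F : ℙ ℝ X → ((X →L[ℝ] ℝ) → X) := fun x φ => sepFun φ x.rep
  have hFc : Continuous F := by
    rw [pm_quot.continuous_iff]
    refine continuous_pi fun φ => ?_
    have : (fun x : {x : X // x ≠ 0} => (F ∘ pm) x φ) = fun x => sepFun φ x.1 := by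
      ext1 x
      exact hinv _ x.1 x.2 rfl φ
    rw [this]
    unfold sepFun
    refine Continuous.smul (Continuous.div (by fun_prop) (by fun_prop) fun x => ?_) (by fun_prop)
    have := norm_ne_zero_iff.2 x.2
    positivity
  have hFi : Function.Injective F := by
    intro x y hxy
    obtain ⟨φ, hφ, hφy⟩ := exists_dual_vector ℝ y.rep (norm_ne_zero_iff.2 y.rep_nonzero)
    have h1 : sepFun φ x.rep = sepFun φ y.rep := congrFun hxy φ
    rw [← x.mk_rep, ← y.mk_rep, Projectivization.mk_eq_mk_iff']
    have hy : ‖y.rep‖ ≠ 0 := norm_ne_zero_iff.2 y.rep_nonzero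
    have hx : ‖x.rep‖ ≠ 0 := norm_ne_zero_iff.2 x.rep_nonzero
    have hc : φ y.rep / ‖y.rep‖ ^ 2 ≠ 0 := by
      rw [hφy]
      simpa using hy
    have hb : φ x.rep / ‖x.rep‖ ^ 2 ≠ 0 := by
      intro h0
      rw [sepFun, sepFun, h0, zero_smul, eq_comm, smul_eq_zero] at h1
      rcases h1 with h1 | h1
      · exact hc h1
      · exact y.rep_nonzero h1
    refine ⟨(φ x.rep / ‖x.rep‖ ^ 2)⁻¹ * (φ y.rep / ‖y.rep‖ ^ 2), ?_⟩
    rw [mul_smul]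
    change _ • sepFun φ y.rep = _
    rw [← h1, sepFun, smul_smul, inv_mul_cancel₀ hb, one_smul]
  exact T2Space.of_injective_continuous hFi hFc

end ProjTop

theorem Bl_posd (p q : ℕ) (hq : 1 ≤ q) (y : PairV p q) :
    ∃ x, Bl p q x y = 0 ∧ 0 < Bl p q x x := by
  have h := LinearMap.ker_ne_bot_of_finrank_lt (f := (Bl p q).flip y ∘ₗ stdPos p q)
    (by simp; omega)
  obtain ⟨z, hz, hz0⟩ := Submodule.exists_mem_ne_zero_of_ne_bot h
  exact ⟨stdPos p q z, hz, stdPos_pos p q z hz0⟩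

theorem Bl_negd (p q : ℕ) (hp : 1 ≤ p) (y : PairV p q) :
    ∃ x, Bl p q x y = 0 ∧ Bl p q x x < 0 := by
  have h := LinearMap.ker_ne_bot_of_finrank_lt (f := (Bl p q).flip y ∘ₗ stdNeg p q)
    (by simp; omega)
  obtain ⟨z, hz, hz0⟩ := Submodule.exists_mem_ne_zero_of_ne_bot h
  exact ⟨stdNeg p q z, hz, stdNeg_neg p q z hz0⟩

theorem Bl_cont (p q : ℕ) : Continuous fun x : PairV p q => Bl p q x x := by
  simp only [Bl_eq]
  fun_prop

theorem Bl_contl (p q : ℕ) (e : PairV p q) : Continuous fun x : PairV p q => Bl p q e x :=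
  LinearMap.continuous_of_finiteDimensional _

theorem Bl_polar {p q : ℕ} {g : PairV p q ≃ₗ[ℝ] PairV p q}
    (h : ∀ v, bPair p q (g v) (g v) = bPair p q v v) (x y : PairV p q) :
    Bl p q (g x) (g y) = Bl p q x y := by
  have h1 := h (x + y)
  have h2 := h x
  have h3 := h y
  simp only [← Bl_apply, map_add, LinearMap.add_apply] at h1 h2 h3
  have h4 := Bl_symm p q x y
  have h5 := Bl_symm p q (g x) (g y)
  linarith

theorem mem_ein {p q : ℕ} {x : PairV p q} (h : x ≠ 0) :
    Projectivization.mk ℝ x h ∈ einSet (bPair p q) ↔ Bl p q x x = 0 := by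
  obtain ⟨a, ha⟩ := Projectivization.exists_smul_eq_mk_rep ℝ x h
  have ha0 : (a : ℝ) ≠ 0 := a.ne_zero
  change Bl p q _ _ = 0 ↔ _
  rw [← ha, Units.smul_def, map_smul, map_smul, LinearMap.smul_apply]
  simp [ha0]

theorem mem_lc {p q : ℕ} {x : PairV p q} (h : x ≠ 0) (y : ℙ ℝ (PairV p q)) :
    Projectivization.mk ℝ x h ∈ lightcone (bPair p q) y ↔
      Bl p q x x = 0 ∧ Bl p q y.rep x = 0 := by
  obtain ⟨a, ha⟩ := Projectivization.exists_smul_eq_mk_rep ℝ x h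
  have ha0 : (a : ℝ) ≠ 0 := a.ne_zero
  change (_ ∧ Bl p q _ _ = 0) ↔ _
  rw [mem_ein, ← ha, Units.smul_def, map_smul]
  simp [ha0]

theorem ein_closed (p q : ℕ) : IsClosed (einSet (bPair p q)) := by
  have h1 := isOpen_rep (X := PairV p q) (f := fun x => Bl p q x x) (Bl_cont p q)
    (fun a x => by simp; ring)
  have h2 := isOpen_rep (X := PairV p q) (f := fun x => -Bl p q x x) (Bl_cont p q).neg
    (fun a x => by simp; ring)
  rw [← isOpen_compl_iff]
  convert h1.union h2 using 1
  ext x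
  change ¬ (Bl p q x.rep x.rep = 0) ↔ 0 < Bl p q x.rep x.rep ∨ 0 < -Bl p q x.rep x.rep
  rw [neg_pos, or_comm]
  exact ne_iff_lt_or_gt

/-- The concrete data attached to a proper domain. -/
structure CDat (p q : ℕ) where
  Ω : Set (ℙ ℝ (PairV p q))
  e : PairV p q
  sub : Ω ⊆ einSet (bPair p q)
  O : Set (ℙ ℝ (PairV p q))
  Oopen : IsOpen O
  hO : ∀ x ∈ einSet (bPair p q), x ∈ O ↔ x ∈ Ω
  pre : IsPreconnected Ω
  ne : Ω.Nonempty
  avoid : ∀ x (h : x ≠ 0), Projectivization.mk ℝ x h ∈ closure Ω → Bl p q e x ≠ 0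

namespace CDat

variable {p q : ℕ} (c : CDat p q)

/-- the cone -/
def C : Set (PairV p q) := {x | 0 < Bl p q c.e x ∧ ∃ h, Projectivization.mk ℝ x h ∈ c.Ω}

theorem mem_C {x : PairV p q} (h : x ≠ 0) :
    x ∈ c.C ↔ 0 < Bl p q c.e x ∧ Projectivization.mk ℝ x h ∈ c.Ω :=
  ⟨fun hx => ⟨hx.1, hx.2.2⟩, fun hx => ⟨hx.1, h, hx.2⟩⟩

/-- the open set -/
def U : Set (PairV p q) := {x | 0 < Bl p q c.e x ∧ ∃ h, Projectivization.mk ℝ x h ∈ c.O}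

theorem Uopen : IsOpen c.U :=
  (isOpen_lt continuous_const (Bl_contl p q c.e)).inter (isOpen_cone c.Oopen)

theorem memC (x : PairV p q) : x ∈ c.C ↔ x ∈ c.U ∧ Bl p q x x = 0 := by
  constructor
  · rintro ⟨h1, h, h2⟩
    exact ⟨⟨h1, h, (c.hO _ (c.sub h2)).2 h2⟩, (mem_ein h).1 (c.sub h2)⟩
  · rintro ⟨⟨h1, h, h2⟩, h3⟩
    exact ⟨h1, h, (c.hO _ ((mem_ein h).2 h3)).1 h2⟩

theorem cone : ∀ x ∈ c.C, ∀ t : ℝ, 0 < t → t • x ∈ c.C := by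
  rintro x ⟨h1, h, h2⟩ t ht
  have h3 : t • x ≠ 0 := smul_ne_zero ht.ne' h
  refine ⟨?_, h3, ?_⟩
  · rw [map_smul]; exact mul_pos ht h1
  · rw [mk_smul h ht.ne' h3]; exact h2

/-- every point of the domain has a representative in the cone -/
theorem exists_rep {ω : ℙ ℝ (PairV p q)} (hω : ω ∈ c.Ω) :
    ∃ x h, ω = Projectivization.mk ℝ x h ∧ x ∈ c.C := by
  have h1 : Projectivization.mk ℝ ω.rep ω.rep_nonzero ∈ c.Ω := by rw [ω.mk_rep]; exact hω
  rcases lt_or_gt_of_ne (c.avoid _ ω.rep_nonzero (subset_closure h1)) with h | h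
  · have h0 : (-1 : ℝ) • ω.rep ≠ 0 := smul_ne_zero (by norm_num) ω.rep_nonzero
    have h2 := mk_smul ω.rep_nonzero (t := -1) (by norm_num) h0
    refine ⟨(-1 : ℝ) • ω.rep, h0, by rw [h2, ω.mk_rep], ?_, h0, by rw [h2]; exact h1⟩
    rw [map_smul, smul_eq_mul]; linarith
  · exact ⟨ω.rep, ω.rep_nonzero, ω.mk_rep.symm, h, _, h1⟩

theorem compact_of_closed {K : Set (ℙ ℝ (PairV p q))} (hK : IsClosed K) :
    IsCompact {x : PairV p q | ‖x‖ = 1 ∧ ∃ h, Projectivization.mk ℝ x h ∈ K} := by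
  have h1 : IsCompact (Metric.sphere (0 : PairV p q) 1) := isCompact_sphere _ _
  have h2 := isOpen_cone hK.isOpen_compl
  convert h1.diff h2 using 1
  ext x
  constructor
  · rintro ⟨hx, h, hxK⟩
    exact ⟨by simpa using hx, fun ⟨_, h'⟩ => h' hxK⟩
  · rintro ⟨hx, hn⟩
    have hx1 : ‖x‖ = 1 := by simpa using hx
    have hx0 : x ≠ 0 := by rw [← norm_ne_zero_iff, hx1]; norm_num
    refine ⟨hx1, hx0, ?_⟩
    by_contra h
    exact hn ⟨hx0, h⟩

theorem exists_delta : ∃ δ > 0, ∀ x ∈ c.C, δ * ‖x‖ ≤ Bl p q c.e x := by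
  have h1 := compact_of_closed (p := p) (q := q) (isClosed_closure (s := c.Ω))
  obtain ⟨δ, hδ, h⟩ := h1.exists_forall_le' (f := fun x => |Bl p q c.e x|) (a := 0)
    (Bl_contl p q c.e).abs.continuousOn (fun x hx => by
      obtain ⟨-, h, hx⟩ := hx
      exact abs_pos.2 (c.avoid x h hx))
  refine ⟨δ, hδ, fun x hx => ?_⟩
  have hx0 : x ≠ 0 := hx.2.1
  have hn : 0 < ‖x‖ := norm_pos_iff.2 hx0
  have h2 := c.cone x hx ‖x‖⁻¹ (by positivity)
  have h3 := h (‖x‖⁻¹ • x) ⟨by rw [norm_smul, norm_inv, norm_norm, inv_mul_cancel₀ hn.ne'],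
    h2.2.1, subset_closure h2.2.2⟩
  rw [abs_of_pos h2.1, map_smul, smul_eq_mul] at h3
  calc δ * ‖x‖ ≤ (‖x‖⁻¹ * Bl p q c.e x) * ‖x‖ := by gcongr
    _ = Bl p q c.e x := by field_simp

theorem conf_sign {g : PairV p q ≃ₗ[ℝ] PairV p q}
    (hg : ∀ x (h : x ≠ 0), Projectivization.mk ℝ x h ∈ c.Ω →
      Bl p q c.e (g x) ≠ 0) {y : PairV p q} (hy : y ∈ c.C) (hgy : 0 < Bl p q c.e (g y))
    {z : PairV p q} (hz0 : z ≠ 0) (hz : Projectivization.mk ℝ z hz0 ∈ c.Ω) :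
    0 < Bl p q c.e (g z) * Bl p q c.e z := by
  have hgc : Continuous g := LinearMap.continuous_of_finiteDimensional g.toLinearMap
  have hc : Continuous fun x : PairV p q => Bl p q c.e (g x) * Bl p q c.e x :=
    ((Bl_contl p q c.e).comp hgc).mul (Bl_contl p q c.e)
  have hom1 : ∀ (a : ℝ) x, (fun x : PairV p q => Bl p q c.e (g x) * Bl p q c.e x) (a • x) =
      a ^ 2 * (fun x : PairV p q => Bl p q c.e (g x) * Bl p q c.e x) x := fun a x => by
    simp only [map_smul, smul_eq_mul]; ring
  have hom2 : ∀ (a : ℝ) x, (fun x : PairV p q => -(Bl p q c.e (g x) * Bl p q c.e x)) (a • x) =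
      a ^ 2 * (fun x : PairV p q => -(Bl p q c.e (g x) * Bl p q c.e x)) x := fun a x => by
    simp only [map_smul, smul_eq_mul]; ring
  by_contra hneg
  have hzn : Bl p q c.e (g z) * Bl p q c.e z ≠ 0 :=
    mul_ne_zero (hg z hz0 hz) (c.avoid z hz0 (subset_closure hz))
  have hyV := (rep_pos (f := fun x : PairV p q => Bl p q c.e (g x) * Bl p q c.e x) hom1
    hy.2.1).2 (mul_pos hgy hy.1)
  have hzV := (rep_pos (f := fun x : PairV p q => -(Bl p q c.e (g x) * Bl p q c.e x)) hom2
    hz0).2 (neg_pos.2 (lt_of_le_of_ne (not_lt.1 hneg) hzn))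
  obtain ⟨ω, hω, h1, h2⟩ := c.pre _ _ (isOpen_rep hc hom1) (isOpen_rep hc.neg hom2)
    (fun ω hω => by
      have h1 : Projectivization.mk ℝ ω.rep ω.rep_nonzero ∈ c.Ω := by rw [ω.mk_rep]; exact hω
      have h2 : Bl p q c.e (g ω.rep) * Bl p q c.e ω.rep ≠ 0 :=
        mul_ne_zero (hg _ _ h1) (c.avoid _ _ (subset_closure h1))
      rcases lt_or_gt_of_ne h2 with h | h
      · exact Or.inr (by simpa using h)
      · exact Or.inl h)
    ⟨_, hy.2.2, hyV⟩ ⟨_, hz, hzV⟩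
  have h3 : 0 < Bl p q c.e (g ω.rep) * Bl p q c.e ω.rep := h1
  have h4 : 0 < -(Bl p q c.e (g ω.rep) * Bl p q c.e ω.rep) := h2
  linarith

/-- The group acting on the cone. -/
def G : Set (PairV p q ≃ₗ[ℝ] PairV p q) :=
  {g | (∀ x y, Bl p q (g x) (g y) = Bl p q x y) ∧ ∀ x, g x ∈ c.C ↔ x ∈ c.C}

theorem mem_G {g : PairV p q ≃ₗ[ℝ] PairV p q} (h1 : ∀ x y, Bl p q (g x) (g y) = Bl p q x y)
    (h2 : ∀ x (h : x ≠ 0) (h' : g x ≠ 0), Projectivization.mk ℝ (g x) h' ∈ c.Ω ↔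
      Projectivization.mk ℝ x h ∈ c.Ω)
    {y : PairV p q} (hy : y ∈ c.C) (hgy : 0 < Bl p q c.e (g y)) : g ∈ c.G := by
  refine ⟨h1, fun x => ?_⟩
  by_cases hx : x = 0
  · rw [hx, map_zero]
  have hgx : g x ≠ 0 := by simpa using hx
  rw [c.mem_C hx, c.mem_C hgx, h2 x hx hgx]
  refine and_congr_left fun h => ?_
  have h3 := c.conf_sign (g := g) (fun z hz hz' => by
    have hgz : g z ≠ 0 := by simpa using hz
    exact c.avoid _ hgz (subset_closure ((h2 z hz hgz).2 hz'))) hy hgy hx h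
  constructor
  · intro h4
    exact (mul_pos_iff_of_pos_left h4).1 h3
  · intro h4
    exact (mul_pos_iff_of_pos_right h4).1 h3

theorem qh {K : Set (ℙ ℝ (PairV p q))} (hK : K ⊆ c.Ω)
    (h : c.Ω = ⋃ g ∈ Conf (bPair p q) c.Ω, projMap g '' K) (x : PairV p q) (hx : x ∈ c.C) :
    ∃ g ∈ c.G, ∃ k ∈ {x : PairV p q | (‖x‖ = 1 ∧ ∃ h, Projectivization.mk ℝ x h ∈ K) ∧
      0 ≤ Bl p q c.e x}, ∃ r : ℝ, 0 < r ∧ x = r • g k := by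
  obtain ⟨hx1, hx0, hxΩ⟩ := hx
  have h1 := hxΩ
  rw [h] at h1
  simp only [mem_iUnion] at h1
  obtain ⟨g, ⟨hgB, hgΩ⟩, k, hk, hgk⟩ := h1
  obtain ⟨y, hy0, rfl, hy⟩ := c.exists_rep (hK hk)
  have hn : 0 < ‖y‖ := norm_pos_iff.2 hy0
  set z := ‖y‖⁻¹ • y with hz
  have hz0 : z ≠ 0 := smul_ne_zero (by positivity) hy0
  have hzC : z ∈ c.C := c.cone y hy _ (by positivity)
  have hzmk : Projectivization.mk ℝ z hz0 = Projectivization.mk ℝ y hy0 :=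
    mk_smul hy0 (by positivity) hz0
  have hzK : z ∈ {x : PairV p q | (‖x‖ = 1 ∧ ∃ h, Projectivization.mk ℝ x h ∈ K) ∧
      0 ≤ Bl p q c.e x} :=
    ⟨⟨by rw [hz, norm_smul, norm_inv, norm_norm, inv_mul_cancel₀ hn.ne'], hz0,
      by rw [hzmk]; exact hk⟩, hzC.1.le⟩
  rw [← hzmk, projMap, Projectivization.map_mk, Projectivization.mk_eq_mk_iff'] at hgk
  obtain ⟨a, ha⟩ := hgk
  have ha' : a • x = g z := ha
  have hmap : ∀ x (h : x ≠ 0) (h' : g x ≠ 0),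
      projMap g (Projectivization.mk ℝ x h) = Projectivization.mk ℝ (g x) h' := by
    intro x h h'
    rw [projMap, Projectivization.map_mk]; rfl
  have hinj : Function.Injective (projMap g) := Projectivization.map_injective _ _
  have hiff : ∀ x (h : x ≠ 0) (h' : g x ≠ 0), Projectivization.mk ℝ (g x) h' ∈ c.Ω ↔
      Projectivization.mk ℝ x h ∈ c.Ω := by
    intro x h h'
    rw [← hmap x h h']
    conv_lhs => rw [← hgΩ]
    exact hinj.mem_set_image
  have hgiso := Bl_polar hgB
  have ha0 : a ≠ 0 := by
    rintro rfl
    rw [zero_smul] at ha'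
    exact hz0 (by simpa using ha'.symm)
  rcases lt_or_gt_of_ne ha0 with hlt | hgt
  · let g' : PairV p q ≃ₗ[ℝ] PairV p q := g.trans (LinearEquiv.neg ℝ)
    have hg' : ∀ x, g' x = -g x := fun x => by simp [g']
    refine ⟨g', c.mem_G ?_ ?_ hzC ?_, z, hzK, (-a)⁻¹, by
      rw [inv_pos]; linarith, ?_⟩
    · intro x y
      rw [hg', hg']; simp [hgiso]
    · intro x h h'
      have h'' : g x ≠ 0 := by simpa using h
      rw [← hiff x h h'']
      have : Projectivization.mk ℝ (g' x) h' = Projectivization.mk ℝ (g x) h'' := by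
        rw [Projectivization.mk_eq_mk_iff']
        exact ⟨-1, by rw [hg']; simp⟩
      rw [this]
    · rw [hg', ← ha', map_neg, map_smul, smul_eq_mul]
      nlinarith
    · rw [hg', ← ha', ← neg_smul, smul_smul, inv_mul_cancel₀ (by simpa using ha0), one_smul]
  · refine ⟨g, c.mem_G hgiso hiff hzC ?_, z, hzK, a⁻¹, by positivity, ?_⟩
    · rw [← ha', map_smul, smul_eq_mul]; positivity
    · rw [← ha', smul_smul, inv_mul_cancel₀ ha0, one_smul]

end CDat

/-- Any proper quasi-homogeneous domain of `Ein^{p,q}` is a diamond. -/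
theorem stmt_0 (p q : ℕ) (hp : 1 ≤ p) (hq : 1 ≤ q)
    (Ω : Set (ℙ ℝ (PairV p q)))
    (hproper : IsProperDomain (bPair p q) Ω)
    (hqh : IsQuasiHomogeneous (bPair p q) Ω) :
    ∃ g : PairV p q ≃ₗ[ℝ] PairV p q,
      (∀ v, bPair p q (g v) (g v) = bPair p q v v) ∧
      projMap g '' diamond p q = Ω := by
  obtain ⟨⟨hsub, hopen, hconn⟩, x₀, hx₀, hdisj⟩ := hproper
  obtain ⟨K, hKΩ, hKc, hKu⟩ := hqh
  obtain ⟨O, hO, hOΩ⟩ := isOpen_induced_iff.1 hopen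
  have himg : Subtype.val '' (Subtype.val ⁻¹' Ω : Set (einSet (bPair p q))) = Ω := by
    rw [Subtype.image_preimage_coe]
    exact inter_eq_right.2 hsub
  have hcon : IsConnected Ω := by
    have := hconn.image Subtype.val continuous_subtype_val.continuousOn
    rwa [himg] at this
  let c : CDat p q :=
    { Ω := Ω
      e := x₀.rep
      sub := hsub
      O := O
      Oopen := hO
      hO := fun x hx => by
        have := Set.ext_iff.1 hOΩ ⟨x, hx⟩
        exact this
      pre := hcon.isPreconnected
      ne := hcon.nonempty
      avoid := fun x h hx h0 => by
        have h1 : Projectivization.mk ℝ x h ∈ einSet (bPair p q) :=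
          closure_minimal hsub (ein_closed p q) hx
        have h2 : Projectivization.mk ℝ x h ∈ closure Ω ∩ lightcone (bPair p q) x₀ :=
          ⟨hx, (mem_lc h x₀).2 ⟨(mem_ein h).1 h1, h0⟩⟩
        rw [hdisj] at h2
        exact h2 }
  obtain ⟨δ, hδ, hbd⟩ := c.exists_delta
  haveI : T2Space (ℙ ℝ (PairV p q)) := projT2
  have hCne : c.C.Nonempty := by
    obtain ⟨ω, hω⟩ := c.ne
    obtain ⟨x, -, -, hx⟩ := c.exists_rep hω
    exact ⟨x, hx⟩
  let d : EDat (PairV p q) :=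
    { B := Bl p q
      symm := Bl_symm p q
      nondeg := Bl_nondeg p q
      posd := Bl_posd p q hq
      negd := Bl_negd p q hp
      C := c.C
      U := c.U
      K := {x : PairV p q | (‖x‖ = 1 ∧ ∃ h, Projectivization.mk ℝ x h ∈ K) ∧
        0 ≤ Bl p q c.e x}
      G := c.G
      e := c.e
      δ := δ
      hδ := hδ
      Uopen := c.Uopen
      memC := c.memC
      cone := c.cone
      ne := hCne
      ne0 := fun x hx => hx.2.1
      bd := hbd
      Giso := fun g hg => hg.1
      GC := fun g hg => hg.2
      Kc := (CDat.compact_of_closed hKc.isClosed).inter_right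
        (isClosed_le continuous_const (Bl_contl p q c.e))
      KC := fun x hx => ⟨lt_of_le_of_ne hx.2
        (c.avoid x hx.1.2.1 (subset_closure (hKΩ hx.1.2.2))).symm, hx.1.2.1, hKΩ hx.1.2.2⟩
      qh := c.qh hKΩ hKu }
  obtain ⟨P, h1, h2, h3, h4, h5, h6⟩ := d.main
  let pd : PDat (PairV p q) :=
    { B := Bl p q
      symm := Bl_symm p q
      nondeg := Bl_nondeg p q
      C := c.C
      U := c.U
      P := P
      Uopen := c.Uopen
      memC := c.memC
      cone := c.cone
      ne := hCne
      PP := h1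
      adj := h2
      pos := h3
      hp := h4
      hm := h5
      cl := h6 }
  obtain ⟨g, hg, hC⟩ := pd.exists_model rfl
  refine ⟨g, fun v => hg v v, ?_⟩
  ext ω
  constructor
  · rintro ⟨_, ⟨y, hy, rfl, y1, y2, y3, y4⟩, rfl⟩
    have h7 : g y ∈ c.C := (hC _).2 ⟨1, one_pos, y, (one_smul _ _).symm, y1, y2, y3, y4⟩
    rw [projMap, Projectivization.map_mk]
    exact h7.2.2
  · intro hω
    obtain ⟨x, hx, rfl, hxC⟩ := c.exists_rep hω
    obtain ⟨t, ht, y, hxy, y1, y2, y3, y4⟩ := (hC _).1 hxC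
    have hy : y ≠ 0 := by
      rintro rfl
      simp at y2
    refine ⟨Projectivization.mk ℝ y hy, ⟨y, hy, rfl, y1, y2, y3, y4⟩, ?_⟩
    rw [projMap, Projectivization.map_mk, Projectivization.mk_eq_mk_iff']
    refine ⟨t⁻¹, ?_⟩
    rw [hxy, smul_smul, inv_mul_cancel₀ ht.ne', one_smul]
    rfl
end
end

section
/- Let p, q ≥ 1 and let Ω be a proper domain of Ein^{p,q}. Then δ^Ω is finite on Ω × Ω and induces the standard topology on Ω: for every x ∈ Ω and every sequence (x_k) in Ω, x_k converges to x in ℙ(ℝⁿ) if and only if δ^Ω(x, x_k) → 0. -/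
noncomputable section

open scoped LinearAlgebra.Projectivization ENNReal
open Projectivization Filter Topology Set

variable {W : Type} [AddCommGroup W] [Module ℝ W] [TopologicalSpace W]

section aux
set_option linter.unusedSectionVars false
set_option linter.unusedVariables false
variable {ι : Type} [Fintype ι] [DecidableEq ι]

/-- Partial Euclidean product over the coordinates in `S`. -/
def NS (S : Finset ι) (v w : ι → ℝ) : ℝ := ∑ i ∈ S, v i * w i

lemma NS_comm (S : Finset ι) (v w : ι → ℝ) : NS S v w = NS S w v := by
  simp [NS, mul_comm]

lemma NS_add_right (S : Finset ι) (v w z : ι → ℝ) : NS S v (w + z) = NS S v w + NS S v z := by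
  simp [NS, mul_add, Finset.sum_add_distrib]

lemma NS_smul_right (S : Finset ι) (c : ℝ) (v w : ι → ℝ) : NS S v (c • w) = c * NS S v w := by
  simp only [NS, Finset.mul_sum, Pi.smul_apply, smul_eq_mul]
  exact Finset.sum_congr rfl fun i _ => by ring

lemma NS_add_left (S : Finset ι) (v w z : ι → ℝ) : NS S (w + z) v = NS S w v + NS S z v := by
  rw [NS_comm, NS_add_right, NS_comm S v w, NS_comm S v z]

lemma NS_smul_left (S : Finset ι) (c : ℝ) (v w : ι → ℝ) : NS S (c • w) v = c * NS S w v := by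
  rw [NS_comm, NS_smul_right, NS_comm S v w]

lemma NS_continuous (S : Finset ι) :
    Continuous (fun z : (ι → ℝ) × (ι → ℝ) => NS S z.1 z.2) := by
  unfold NS; fun_prop

lemma NS_nonneg (S : Finset ι) (v : ι → ℝ) : 0 ≤ NS S v v :=
  Finset.sum_nonneg fun i _ => mul_self_nonneg _

lemma NS_congr_left (S : Finset ι) {v w z : ι → ℝ} (h : ∀ i ∈ S, v i = w i) :
    NS S v z = NS S w z :=
  Finset.sum_congr rfl fun i hi => by rw [h i hi]

lemma NS_congr_right (S : Finset ι) {v w z : ι → ℝ} (h : ∀ i ∈ S, v i = w i) :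
    NS S z v = NS S z w :=
  Finset.sum_congr rfl fun i hi => by rw [h i hi]

/-- Signed form with negative coordinates `S`. -/
def gB (S : Finset ι) (v w : ι → ℝ) : ℝ := NS Sᶜ v w - NS S v w

lemma gB_comm (S : Finset ι) (v w : ι → ℝ) : gB S v w = gB S w v := by
  simp [gB, NS_comm _ v w]

lemma gB_add_right (S : Finset ι) (v w z : ι → ℝ) : gB S v (w + z) = gB S v w + gB S v z := by
  simp only [gB, NS_add_right]; ring

lemma gB_smul_right (S : Finset ι) (c : ℝ) (v w : ι → ℝ) : gB S v (c • w) = c * gB S v w := by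
  simp only [gB, NS_smul_right]; ring

lemma gB_add_left (S : Finset ι) (v w z : ι → ℝ) : gB S (w + z) v = gB S w v + gB S z v := by
  simp only [gB, NS_add_left]; ring

lemma gB_smul_left (S : Finset ι) (c : ℝ) (v w : ι → ℝ) : gB S (c • w) v = c * gB S w v := by
  simp only [gB, NS_smul_left]; ring

lemma gB_continuous (S : Finset ι) :
    Continuous (fun z : (ι → ℝ) × (ι → ℝ) => gB S z.1 z.2) :=
  (NS_continuous _).sub (NS_continuous _)

lemma mk_mem_einSet (S : Finset ι) (w : ι → ℝ) (hw : w ≠ 0) :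
    Projectivization.mk ℝ w hw ∈ einSet (gB S) ↔ gB S w w = 0 := by
  obtain ⟨c, hc⟩ := Projectivization.exists_smul_eq_mk_rep ℝ w hw
  have hc0 : (c : ℝ) ≠ 0 := c.ne_zero
  rw [einSet, mem_ofPred_eq, ← hc, Units.smul_def, gB_smul_right, gB_smul_left]
  simp [hc0]

lemma mk_mem_lightcone (S : Finset ι) (x : ℙ ℝ (ι → ℝ)) (w : ι → ℝ) (hw : w ≠ 0) :
    Projectivization.mk ℝ w hw ∈ lightcone (gB S) x ↔ gB S w w = 0 ∧ gB S x.rep w = 0 := by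
  obtain ⟨c, hc⟩ := Projectivization.exists_smul_eq_mk_rep ℝ w hw
  have hc0 : (c : ℝ) ≠ 0 := c.ne_zero
  rw [lightcone, mem_ofPred_eq, mk_mem_einSet, ← hc, Units.smul_def, gB_smul_right]
  simp [hc0]

/-! Topology of the projective space. -/

/-- The quotient map. -/
def prj (v : {v : ι → ℝ // v ≠ 0}) : ℙ ℝ (ι → ℝ) := Projectivization.mk ℝ v.1 v.2

lemma prj_isQuotientMap : IsQuotientMap (prj (ι := ι)) := isQuotientMap_quotient_mk'

lemma prj_continuous : Continuous (prj (ι := ι)) := prj_isQuotientMap.continuous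

lemma prj_isOpenMap : IsOpenMap (prj (ι := ι)) := by
  intro U hU
  rw [← prj_isQuotientMap.isOpen_preimage]
  have : prj ⁻¹' (prj '' U) = ⋃ c : ℝˣ, (fun v : {v : ι → ℝ // v ≠ 0} =>
      (⟨(c : ℝ) • v.1, smul_ne_zero c.ne_zero v.2⟩ : {v : ι → ℝ // v ≠ 0})) ⁻¹' U := by
    ext v
    simp only [mem_preimage, mem_image, mem_iUnion]
    constructor
    · rintro ⟨u, hu, huv⟩
      obtain ⟨c, hc⟩ := (Projectivization.mk_eq_mk_iff ℝ _ _ u.2 v.2).1 huv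
      refine ⟨c, ?_⟩
      convert hu using 1
      exact Subtype.ext hc
    · rintro ⟨c, hc⟩
      refine ⟨_, hc, ?_⟩
      exact (Projectivization.mk_eq_mk_iff ℝ _ _ _ v.2).2 ⟨c, rfl⟩
  rw [this]
  refine isOpen_iUnion fun c => hU.preimage ?_
  fun_prop

lemma einSet_isClosed (S : Finset ι) : IsClosed (einSet (gB S)) := by
  rw [← prj_isQuotientMap.isClosed_preimage]
  have : prj ⁻¹' (einSet (gB S)) = {v : {v : ι → ℝ // v ≠ 0} | gB S v.1 v.1 = 0} := by
    ext v; exact mk_mem_einSet S v.1 v.2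
  rw [this]
  refine isClosed_eq ?_ continuous_const
  exact (gB_continuous S).comp (continuous_subtype_val.prodMk continuous_subtype_val)

/-- Affine normalization in the chart given by `v0`. -/
def hat (S : Finset ι) (v0 : ι → ℝ) (y : ℙ ℝ (ι → ℝ)) (i : ι) : ℝ := y.rep i / gB S v0 y.rep

lemma hat_mk (S : Finset ι) (v0 w : ι → ℝ) (hw : w ≠ 0) (i : ι) :
    hat S v0 (Projectivization.mk ℝ w hw) i = w i / gB S v0 w := by
  obtain ⟨c, hc⟩ := Projectivization.exists_smul_eq_mk_rep ℝ w hw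
  have hc0 : (c : ℝ) ≠ 0 := c.ne_zero
  rw [hat, ← hc, Units.smul_def, gB_smul_right, Pi.smul_apply, smul_eq_mul, mul_div_mul_left _ _ hc0]

lemma hat_bounded (S : Finset ι) (Ω : Set (ℙ ℝ (ι → ℝ))) (hΩ : Ω ⊆ einSet (gB S))
    (x : ℙ ℝ (ι → ℝ)) (hx : closure Ω ∩ lightcone (gB S) x = ∅) :
    (∀ y ∈ Ω, gB S x.rep y.rep ≠ 0) ∧ ∃ R : ℝ, ∀ y ∈ Ω, ∀ i, |hat S x.rep y i| ≤ R := by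
  have hcl : closure Ω ⊆ einSet (gB S) := closure_minimal hΩ (einSet_isClosed S)
  constructor
  · intro y hy h0
    have : y ∈ closure Ω ∩ lightcone (gB S) x := ⟨subset_closure hy, hΩ hy, h0⟩
    rw [hx] at this; exact this
  let K : Set (ι → ℝ) := Metric.sphere 0 1 ∩ {v | ∃ h : v ≠ 0, prj ⟨v, h⟩ ∈ closure Ω}
  have hK : IsCompact K := by
    have h1 : IsClosed (prj ⁻¹' closure Ω : Set {v : ι → ℝ // v ≠ 0}) :=
      isClosed_closure.preimage prj_continuous
    obtain ⟨C, hC, hCe⟩ := isClosed_induced_iff.1 h1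
    have : K = Metric.sphere 0 1 ∩ C := by
      ext v
      simp only [K, mem_inter_iff, mem_ofPred_eq]
      refine and_congr_right fun hv => ?_
      have hv0 : v ≠ 0 := by
        rintro rfl; simp at hv
      have := Set.ext_iff.1 hCe ⟨v, hv0⟩
      simp only [mem_preimage] at this
      rw [this]
      exact ⟨fun ⟨_, h⟩ => h, fun h => ⟨hv0, h⟩⟩
    rw [this]
    exact (isCompact_sphere _ _).inter_right hC
  have hcont : ContinuousOn (fun v : ι → ℝ => (gB S x.rep v)⁻¹) K := by
    refine ContinuousOn.inv₀ ?_ ?_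
    · exact ((gB_continuous S).comp (continuous_const.prodMk continuous_id)).continuousOn
    · rintro v ⟨_, hv0, hv⟩ h0
      have : prj ⟨v, hv0⟩ ∈ closure Ω ∩ lightcone (gB S) x :=
        ⟨hv, (mk_mem_lightcone S x v hv0).2 ⟨(mk_mem_einSet S v hv0).1 (hcl hv), h0⟩⟩
      rw [hx] at this; exact this
  obtain ⟨R, hR⟩ := hK.exists_bound_of_continuousOn hcont
  refine ⟨R, fun y hy i => ?_⟩
  have hn : ‖y.rep‖ ≠ 0 := norm_ne_zero_iff.2 y.rep_nonzero
  set w := ‖y.rep‖⁻¹ • y.rep with hw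
  have hw0 : w ≠ 0 := smul_ne_zero (inv_ne_zero hn) y.rep_nonzero
  have hyw : y = Projectivization.mk ℝ w hw0 := by
    conv_lhs => rw [← y.mk_rep]
    rw [Projectivization.mk_eq_mk_iff']
    exact ⟨‖y.rep‖, by rw [hw, smul_smul, mul_inv_cancel₀ hn, one_smul]⟩
  have hw1 : ‖w‖ = 1 := by rw [hw, norm_smul, norm_inv, norm_norm, inv_mul_cancel₀ hn]
  have hwK : w ∈ K := ⟨by simp [hw1], hw0, by
    have := subset_closure hy; rw [hyw] at this; exact this⟩
  rw [hyw, hat_mk, div_eq_mul_inv, abs_mul]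
  have h1 := hR w hwK
  have h2 := norm_le_pi_norm w i
  rw [Real.norm_eq_abs] at h1 h2
  rw [hw1] at h2
  calc |w i| * |(gB S x.rep w)⁻¹| ≤ 1 * |(gB S x.rep w)⁻¹| := by gcongr
    _ ≤ R := by simpa using h1

lemma tendsto_of_hat (S : Finset ι) (v0 : ι → ℝ) (x : ℙ ℝ (ι → ℝ)) (xs : ℕ → ℙ ℝ (ι → ℝ))
    (h0 : gB S v0 x.rep ≠ 0) (h : ∀ k, gB S v0 (xs k).rep ≠ 0)
    (ht : ∀ i, Tendsto (fun k => hat S v0 (xs k) i) atTop (𝓝 (hat S v0 x i))) :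
    Tendsto xs atTop (𝓝 x) := by
  have key : ∀ y : ℙ ℝ (ι → ℝ), gB S v0 y.rep ≠ 0 →
      ∃ h : hat S v0 y ≠ 0, prj ⟨hat S v0 y, h⟩ = y := by
    intro y hy
    have e : hat S v0 y = (gB S v0 y.rep)⁻¹ • y.rep := by
      ext i; simp [hat, div_eq_inv_mul]
    have hne : hat S v0 y ≠ 0 := by
      rw [e]; exact smul_ne_zero (inv_ne_zero hy) y.rep_nonzero
    refine ⟨hne, ?_⟩
    conv_rhs => rw [← y.mk_rep]
    exact (Projectivization.mk_eq_mk_iff' ℝ _ _ _ _).2 ⟨(gB S v0 y.rep)⁻¹, e.symm⟩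
  choose hk hk' using fun k => key (xs k) (h k)
  obtain ⟨hx, hx'⟩ := key x h0
  have : Tendsto (fun k => (⟨hat S v0 (xs k), hk k⟩ : {v : ι → ℝ // v ≠ 0})) atTop
      (𝓝 ⟨hat S v0 x, hx⟩) := tendsto_subtype_rng.2 (tendsto_pi_nhds.2 ht)
  have h2 := (prj_continuous.tendsto _).comp this
  rw [hx'] at h2
  refine h2.congr fun k => hk' k

/-! The one dimensional estimate. -/

lemma affine_ratio {A B s t : ℝ} (hm : ∀ τ ∈ II, 0 < A * τ + B) (hs : s ∈ II) (ht : t ∈ II) :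
    A * t + B ≤ Real.exp (dHyp s t) * (A * s + B) := by
  have h0 : 0 < B := by simpa using hm 0 (by simp [II])
  have h1 : 0 ≤ A + B := by
    by_contra hc
    push Not at hc
    have hA : A < 0 := by linarith
    have := hm (-B / A) ⟨by rw [lt_div_iff_of_neg hA]; linarith,
      by rw [div_lt_iff_of_neg hA]; linarith⟩
    rw [mul_div_cancel₀ _ hA.ne] at this
    linarith
  have h2 : 0 ≤ B - A := by
    by_contra hc
    push Not at hc
    have hA : 0 < A := by linarith
    have := hm (-B / A) ⟨by rw [lt_div_iff₀ hA]; linarith,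
      by rw [div_lt_iff₀ hA]; linarith⟩
    rw [mul_div_cancel₀ _ hA.ne'] at this
    linarith
  obtain ⟨hs1, hs2⟩ := hs
  obtain ⟨ht1, ht2⟩ := ht
  have a1 : 0 < 1 + s := by linarith
  have a2 : 0 < 1 - s := by linarith
  have a3 : 0 < 1 + t := by linarith
  have a4 : 0 < 1 - t := by linarith
  set X := ((1 + t) * (1 - s)) / ((1 - t) * (1 + s)) with hX
  have hXp : 0 < X := by positivity
  set D := Real.exp (dHyp s t) with hD
  have hD1 : X ≤ D := by
    rw [hD, dHyp, ← hX]
    calc X = Real.exp (Real.log X) := (Real.exp_log hXp).symm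
      _ ≤ _ := Real.exp_le_exp.2 (le_abs_self _)
  have hD2 : X⁻¹ ≤ D := by
    rw [hD, dHyp, ← hX]
    calc X⁻¹ = Real.exp (-Real.log X) := by rw [Real.exp_neg, Real.exp_log hXp]
      _ ≤ _ := Real.exp_le_exp.2 (neg_le_abs _)
  have hD3 : 1 ≤ D := by rw [hD, dHyp]; exact Real.one_le_exp (abs_nonneg _)
  have e1 : 1 + t ≤ D * (1 + s) := by
    rcases le_total s t with h | h
    · have : 1 + t ≤ X * (1 + s) := by
        rw [hX, div_mul_eq_mul_div, le_div_iff₀ (by positivity)]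
        have : 0 ≤ (1 + t) * (1 + s) * (t - s) := by
          have : 0 ≤ t - s := by linarith
          positivity
        nlinarith
      nlinarith
    · nlinarith
  have e2 : 1 - t ≤ D * (1 - s) := by
    rcases le_total s t with h | h
    · nlinarith
    · have : 1 - t ≤ X⁻¹ * (1 - s) := by
        rw [hX, inv_div, div_mul_eq_mul_div, le_div_iff₀ (by positivity)]
        have : 0 ≤ (1 - t) * (1 - s) * (s - t) := by
          have : 0 ≤ s - t := by linarith
          positivity
        nlinarith
      nlinarith
  nlinarith [mul_le_mul_of_nonneg_left e1 h1, mul_le_mul_of_nonneg_left e2 h2]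

lemma log_affine {A B s t : ℝ} (hm : ∀ τ ∈ II, 0 < A * τ + B) (hs : s ∈ II) (ht : t ∈ II) :
    Real.log (A * t + B) ≤ dHyp s t + Real.log (A * s + B) := by
  rw [← Real.log_exp (dHyp s t), ← Real.log_mul (Real.exp_pos _).ne' (hm s hs).ne']
  exact Real.log_le_log (hm t ht) (affine_ratio hm hs ht)

lemma dHyp_comm {s t : ℝ} : dHyp s t = dHyp t s := by
  unfold dHyp
  rw [← abs_neg, ← Real.log_inv, inv_div]
  congr 3 <;> ring

lemma proj_estimate_pos {e f β γ R s t : ℝ} (hg : ∀ τ ∈ II, 0 < β * τ + γ)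
    (h : ∀ τ ∈ II, |(e * τ + f) / (β * τ + γ)| ≤ R) (hs : s ∈ II) (ht : t ∈ II) :
    |Real.log (R + 1 + (e * t + f) / (β * t + γ)) - Real.log (R + 1 + (e * s + f) / (β * s + γ))|
      ≤ 2 * dHyp s t := by
  have hL : ∀ τ ∈ II, 0 < ((R + 1) * β + e) * τ + ((R + 1) * γ + f) := by
    intro τ hτ
    have h1 := (abs_le.1 (h τ hτ)).1
    rw [le_div_iff₀ (hg τ hτ)] at h1
    nlinarith [hg τ hτ]
  have hlog : ∀ τ ∈ II, Real.log (R + 1 + (e * τ + f) / (β * τ + γ)) =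
      Real.log (((R + 1) * β + e) * τ + ((R + 1) * γ + f)) - Real.log (β * τ + γ) := by
    intro τ hτ
    rw [← Real.log_div (hL τ hτ).ne' (hg τ hτ).ne']
    congr 1
    have := (hg τ hτ).ne'
    rw [eq_div_iff this, add_mul, div_mul_cancel₀ _ this]
    ring
  rw [hlog t ht, hlog s hs]
  have b1 := log_affine hL hs ht
  have b2 := log_affine hL ht hs
  have b3 := log_affine hg hs ht
  have b4 := log_affine hg ht hs
  rw [dHyp_comm] at b2 b4
  rw [abs_le]
  constructor <;> linarith

lemma proj_estimate {e f β γ R s t : ℝ} (hg : ∀ τ ∈ II, β * τ + γ ≠ 0)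
    (h : ∀ τ ∈ II, |(e * τ + f) / (β * τ + γ)| ≤ R) (hs : s ∈ II) (ht : t ∈ II) :
    |Real.log (R + 1 + (e * t + f) / (β * t + γ)) - Real.log (R + 1 + (e * s + f) / (β * s + γ))|
      ≤ 2 * dHyp s t := by
  have hII : IsPreconnected II := isPreconnected_Ioo
  have hc : ContinuousOn (fun τ : ℝ => β * τ + γ) II := by fun_prop
  have h00 : (0 : ℝ) ∈ II := by simp [II]
  rcases lt_or_gt_of_ne (hg 0 h00) with h0 | h0
  · have hneg : ∀ τ ∈ II, 0 < (-β) * τ + (-γ) := by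
      intro τ hτ
      by_contra hcon
      obtain ⟨σ, hσ, hσ0⟩ := hII.intermediate_value h00 hτ hc (show (0 : ℝ) ∈ _ from
        ⟨h0.le, by linarith⟩)
      exact hg σ hσ hσ0
    have key : ∀ τ, (e * τ + f) / (β * τ + γ) = ((-e) * τ + (-f)) / ((-β) * τ + (-γ)) := by
      intro τ
      rw [← neg_div_neg_eq]; congr 1 <;> ring
    rw [key, key]
    exact proj_estimate_pos hneg (fun τ hτ => by rw [← key]; exact h τ hτ) hs ht
  · have hpos : ∀ τ ∈ II, 0 < β * τ + γ := by
      intro τ hτ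
      by_contra hcon
      obtain ⟨σ, hσ, hσ0⟩ := hII.intermediate_value hτ h00 hc (show (0 : ℝ) ∈ _ from
        ⟨by linarith, h0.le⟩)
      exact hg σ hσ hσ0
    exact proj_estimate_pos hpos h hs ht

lemma telescoping : ∀ (N : ℕ) (f : Fin (N + 1) → ℝ) (d : Fin N → ℝ),
    (∀ i : Fin N, |f i.succ - f i.castSucc| ≤ d i) → |f (Fin.last N) - f 0| ≤ ∑ i, d i := by
  intro N
  induction N with
  | zero => intro f d _; simp
  | succ N ih =>
    intro f d h
    rw [Fin.sum_univ_castSucc]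
    have h1 := ih (fun i => f i.castSucc) (fun i => d i.castSucc) (fun i => h i.castSucc)
    have h2 := h (Fin.last N)
    simp only [Fin.castSucc_zero, Fin.succ_last] at h1 h2
    rw [abs_le] at *
    constructor <;> linarith [h1.1, h1.2, h2.1, h2.2]

lemma markowitz_lower (S : Finset ι) (Ω : Set (ℙ ℝ (ι → ℝ))) (v0 : ι → ℝ) (R : ℝ)
    (h0 : ∀ y ∈ Ω, gB S v0 y.rep ≠ 0) (hR : ∀ y ∈ Ω, ∀ i, |hat S v0 y i| ≤ R)
    (x y : ℙ ℝ (ι → ℝ)) (i : ι) :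
    ENNReal.ofReal |Real.log (R + 1 + hat S v0 y i) - Real.log (R + 1 + hat S v0 x i)|
      ≤ 2 * markowitz (gB S) Ω x y := by
  have key : ∀ e ∈ {e | ∃ (N : ℕ) (c : ℝ), 1 ≤ N ∧ IsChainCost (gB S) Ω x y N c ∧
      e = ENNReal.ofReal c},
      ENNReal.ofReal |Real.log (R + 1 + hat S v0 y i) - Real.log (R + 1 + hat S v0 x i)| / 2
        ≤ e := by
    rintro e ⟨N, c, _, ⟨xs, αs, ss, ts, hx, hy, hch, rfl⟩, rfl⟩
    have := telescoping N (fun j => Real.log (R + 1 + hat S v0 (xs j) i))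
      (fun j => 2 * dHyp (ss j) (ts j)) (by
        intro j
        obtain ⟨⟨u, w, a, b, c, d, _, _, _, _, _, hα⟩, hs, ht, hxs, hxt⟩ := hch j
        have hcoord : ∀ τ ∈ II, αs j τ ∈ Ω ∧ (a * gB S v0 u + c * gB S v0 w) * τ +
            (b * gB S v0 u + d * gB S v0 w) ≠ 0 ∧ hat S v0 (αs j τ) i =
            ((a * u i + c * w i) * τ + (b * u i + d * w i)) /
            ((a * gB S v0 u + c * gB S v0 w) * τ + (b * gB S v0 u + d * gB S v0 w)) := by
          intro τ hτ
          obtain ⟨hne, he, hm⟩ := hα τ hτ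
          have hden : gB S v0 ((a * τ + b) • u + (c * τ + d) • w) =
              (a * gB S v0 u + c * gB S v0 w) * τ + (b * gB S v0 u + d * gB S v0 w) := by
            rw [gB_add_right, gB_smul_right, gB_smul_right]; ring
          refine ⟨hm, ?_, ?_⟩
          · rw [← hden]
            intro hz
            have h1 := h0 _ hm
            obtain ⟨k, hk⟩ := Projectivization.exists_smul_eq_mk_rep ℝ _ hne
            rw [he, ← hk, Units.smul_def, gB_smul_right, hz] at h1
            simp at h1
          · rw [he, hat_mk, hden]
            congr 1
            simp only [Pi.add_apply, Pi.smul_apply, smul_eq_mul]; ring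
        simp only [← hxs, ← hxt]
        rw [(hcoord _ hs).2.2, (hcoord _ ht).2.2]
        refine proj_estimate (fun τ hτ => (hcoord τ hτ).2.1) (fun τ hτ => ?_) hs ht
        rw [← (hcoord τ hτ).2.2]
        exact hR _ (hcoord τ hτ).1 i)
    simp only [hx, hy, ← Finset.mul_sum] at this
    rw [ENNReal.div_le_iff (by simp) (by simp), mul_comm]
    have h2 : (2 : ℝ≥0∞) = ENNReal.ofReal 2 := by simp
    rw [h2, ← ENNReal.ofReal_mul (by norm_num)]
    exact ENNReal.ofReal_le_ofReal this
  have := le_sInf key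
  rw [ENNReal.div_le_iff (by simp) (by simp), mul_comm] at this
  exact this

/-! Upper estimates. -/

lemma near_step (S : Finset ι) (Ω : Set (ℙ ℝ (ι → ℝ))) (α : ℝ → ℙ ℝ (ι → ℝ))
    (hα : IsLightGeodesic (gB S) Ω α) (s t : ℝ) (hs : s ∈ II) (ht : t ∈ II)
    (a : ℙ ℝ (ι → ℝ)) :
    markowitz (gB S) Ω a (α t) ≤ markowitz (gB S) Ω a (α s) + ENNReal.ofReal (dHyp s t) := by
  conv_rhs => rw [markowitz, ENNReal.sInf_add]
  refine le_iInf₂ ?_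
  rintro e ⟨N, c, hN, ⟨xs, αs, ss, ts, hx, hy, hch, rfl⟩, rfl⟩
  refine le_trans ?_ (ENNReal.ofReal_add_le (p := ∑ i, dHyp (ss i) (ts i)))
  refine sInf_le ⟨N + 1, _, by omega, ⟨Fin.snoc (α := fun _ => ℙ ℝ (ι → ℝ)) xs (α t),
    Fin.snoc (α := fun _ => ℝ → ℙ ℝ (ι → ℝ)) αs α, Fin.snoc (α := fun _ => ℝ) ss s,
    Fin.snoc (α := fun _ => ℝ) ts t, ?_, ?_, ?_, rfl⟩, ?_⟩
  · rw [← Fin.castSucc_zero, Fin.snoc_castSucc, hx]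
  · rw [Fin.snoc_last]
  · intro i
    refine Fin.lastCases ?_ (fun j => ?_) i
    · simp only [Fin.snoc_last, Fin.snoc_castSucc, Fin.succ_last]
      exact ⟨hα, hs, ht, hy.symm, trivial⟩
    · rw [← Fin.castSucc_succ]
      simp only [Fin.snoc_castSucc]
      exact hch j
  · rw [Fin.sum_univ_castSucc]
    simp only [Fin.snoc_last, Fin.snoc_castSucc]

lemma markowitz_le_one (S : Finset ι) (Ω : Set (ℙ ℝ (ι → ℝ))) (α : ℝ → ℙ ℝ (ι → ℝ))
    (hα : IsLightGeodesic (gB S) Ω α) (s t : ℝ) (hs : s ∈ II) (ht : t ∈ II) :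
    markowitz (gB S) Ω (α s) (α t) ≤ ENNReal.ofReal (dHyp s t) := by
  refine sInf_le ⟨1, _, le_rfl, ⟨![α s, α t], fun _ => α, fun _ => s, fun _ => t,
    rfl, rfl, ?_, rfl⟩, by simp⟩
  intro i
  fin_cases i
  exact ⟨hα, hs, ht, rfl, rfl⟩

lemma geo_exists (S : Finset ι) (Ω : Set (ℙ ℝ (ι → ℝ))) (z e : ι → ℝ) (r : ℝ) (hr : r ≠ 0)
    (hli : ∀ s t : ℝ, s • e + t • z = 0 → s = 0 ∧ t = 0)
    (h1 : gB S e e = 0) (h2 : gB S e z = 0) (h3 : gB S z z = 0)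
    (hin : ∀ t ∈ II, ∀ h : z + (r * t) • e ≠ 0, Projectivization.mk ℝ (z + (r * t) • e) h ∈ Ω) :
    ∃ α : ℝ → ℙ ℝ (ι → ℝ), IsLightGeodesic (gB S) Ω α ∧
      ∀ t, ∃ h : z + (r * t) • e ≠ 0, α t = Projectivization.mk ℝ (z + (r * t) • e) h := by
  have hne : ∀ t : ℝ, z + (r * t) • e ≠ 0 := by
    intro t h
    have := hli (r * t) 1 (by rw [one_smul, add_comm]; exact h)
    exact one_ne_zero this.2
  have heq : ∀ t : ℝ, (r * t + 0) • e + ((0 : ℝ) * t + 1) • z = z + (r * t) • e := by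
    intro t; simp [add_comm]
  refine ⟨fun t => Projectivization.mk ℝ _ (hne t), ⟨e, z, r, 0, 0, 1,
    LinearIndependent.pair_iff.2 hli, h1, h2, h3, by simpa using hr, ?_⟩, fun t => ⟨hne t, rfl⟩⟩
  intro t ht
  refine ⟨by rw [heq]; exact hne t, ?_, hin t ht _⟩
  simp only [heq]

lemma dHyp_small {ε : ℝ} (hε : 0 < ε) : ∃ s : ℝ, 0 < s ∧ s < 1 ∧ dHyp 0 s < ε := by
  have hc : ContinuousAt (fun s : ℝ => dHyp 0 s) 0 := by
    unfold dHyp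
    refine ContinuousAt.abs (ContinuousAt.log ?_ (by simp))
    refine ContinuousAt.div (by fun_prop) (by fun_prop) (by simp)
  have h0 : dHyp 0 0 = 0 := by simp [dHyp]
  have h1 : ∀ᶠ s in 𝓝 (0 : ℝ), dHyp 0 s < ε := by
    refine hc.eventually (gt_mem_nhds ?_)
    simpa only [h0] using hε
  have h2 : ∀ᶠ s in 𝓝[>] (0 : ℝ), dHyp 0 s < ε := h1.filter_mono nhdsWithin_le_nhds
  have h3 : ∀ᶠ s in 𝓝[>] (0 : ℝ), s ∈ Ioo (0 : ℝ) 1 := Ioo_mem_nhdsGT one_pos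
  obtain ⟨s, hs, hs'⟩ := (h2.and h3).exists
  exact ⟨s, hs'.1, hs'.2, hs⟩

lemma step (S : Finset ι) (Ω : Set (ℙ ℝ (ι → ℝ))) (v : ι → ℝ) (hv : v ≠ 0) (ρ : ℝ) (hρ : 0 < ρ)
    (hball : ∀ (w : ι → ℝ) (hw : w ≠ 0), gB S w w = 0 → ‖w - v‖ < ρ →
      Projectivization.mk ℝ w hw ∈ Ω) (ε : ℝ) (hε : 0 < ε) :
    ∃ η > 0, η ≤ ‖v‖ ∧ ∀ (z z' : ι → ℝ) (hz : z ≠ 0) (hz' : z' ≠ 0), gB S z z = 0 →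
      gB S z' z' = 0 → gB S z z' = 0 → ‖z - v‖ < η → ‖z' - v‖ < η → ∀ a,
      markowitz (gB S) Ω a (Projectivization.mk ℝ z' hz') ≤
        markowitz (gB S) Ω a (Projectivization.mk ℝ z hz) + ENNReal.ofReal ε := by
  obtain ⟨s, hs0, hs1, hsε⟩ := dHyp_small hε
  have hr : 0 < s⁻¹ := inv_pos.2 hs0
  have hnv : 0 < ‖v‖ := norm_pos_iff.2 hv
  refine ⟨min ‖v‖ (ρ / (1 + 2 * s⁻¹)), lt_min hnv (by positivity), min_le_left _ _, ?_⟩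
  intro z z' hz hz' nz nz' nzz' dz dz' a
  by_cases hdep : ∃ c : ℝ, c • z = z'
  · have : Projectivization.mk ℝ z' hz' = Projectivization.mk ℝ z hz :=
      (Projectivization.mk_eq_mk_iff' ℝ _ _ _ _).2 hdep
    rw [this]; exact le_self_add
  have e0 : z' - z = z' + (-1 : ℝ) • z := by rw [neg_one_smul, sub_eq_add_neg]
  obtain ⟨α, hα, hα'⟩ := geo_exists S Ω z (z' - z) s⁻¹ hr.ne' (by
    intro p t hpt
    have hp : p = 0 := by
      by_contra hp
      apply hdep
      refine ⟨1 - p⁻¹ * t, ?_⟩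
      have h1 : p⁻¹ • (p • (z' - z) + t • z) = 0 := by rw [hpt, smul_zero]
      rw [smul_add, smul_smul, inv_mul_cancel₀ hp, one_smul, smul_smul] at h1
      rw [sub_smul, one_smul]
      have : z' = z - (p⁻¹ * t) • z + (z' - z + (p⁻¹ * t) • z) := by abel
      rw [this, h1, add_zero]
    refine ⟨hp, ?_⟩
    rw [hp, zero_smul, zero_add] at hpt
    exact (smul_eq_zero.1 hpt).resolve_right hz)
    (by
      rw [e0]
      simp only [gB_add_left, gB_add_right, gB_smul_left, gB_smul_right, nz, nz', nzz',
        gB_comm S z' z]; ring)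
    (by
      rw [e0]
      simp only [gB_add_left, gB_smul_left, nz, nzz', gB_comm S z' z]; ring) nz
    (by
      intro t ht h
      refine hball _ h ?_ ?_
      · rw [e0]
        simp only [gB_add_left, gB_add_right, gB_smul_left, gB_smul_right, nz, nz', nzz',
          gB_comm S z' z]; ring
      · have ht' : |t| ≤ 1 := abs_le.2 ⟨ht.1.le, ht.2.le⟩
        have d1 : ‖z' - z‖ ≤ ‖z' - v‖ + ‖z - v‖ := by
          have : z' - z = (z' - v) - (z - v) := by abel
          rw [this]; exact norm_sub_le _ _
        have d2 : ‖z + (s⁻¹ * t) • (z' - z) - v‖ ≤ ‖z - v‖ + s⁻¹ * |t| * ‖z' - z‖ := by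
          have : z + (s⁻¹ * t) • (z' - z) - v = (z - v) + (s⁻¹ * t) • (z' - z) := by abel
          rw [this]
          refine (norm_add_le _ _).trans ?_
          rw [norm_smul, Real.norm_eq_abs, abs_mul, abs_of_pos hr]
        have d3 : s⁻¹ * |t| * ‖z' - z‖ ≤ s⁻¹ * 1 * (‖z' - v‖ + ‖z - v‖) := by gcongr
        have c1 := lt_of_lt_of_le dz (min_le_right _ _)
        have c2 := lt_of_lt_of_le dz' (min_le_right _ _)
        have c3 : ρ / (1 + 2 * s⁻¹) * (1 + 2 * s⁻¹) = ρ := div_mul_cancel₀ _ (by positivity)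
        set η := ρ / (1 + 2 * s⁻¹)
        have c4 : s⁻¹ * (‖z' - v‖ + ‖z - v‖) ≤ s⁻¹ * (η + η) := by gcongr
        nlinarith)
  have hst := near_step S Ω α hα 0 s (by simp [II]) ⟨by linarith, hs1⟩ a
  obtain ⟨q0, hq0⟩ := hα' 0
  obtain ⟨q1, hq1⟩ := hα' s
  have k0 : α 0 = Projectivization.mk ℝ z hz := by rw [hq0]; simp
  have k1 : α s = Projectivization.mk ℝ z' hz' := by
    rw [hq1]; simp [inv_mul_cancel₀ hs0.ne']
  rw [k0, k1] at hst
  exact hst.trans (by gcongr)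

lemma exists_orth (T : Finset ι) (i j : ι) (hi : i ∈ T) (hj : j ∈ T) (hij : i ≠ j) (z : ι → ℝ) :
    ∃ b : ι → ℝ, NS T z b = 0 ∧ NS T b b = 1 := by
  have h1 : ∃ α β : ℝ, α * z i + β * z j = 0 ∧ α * α + β * β = 1 := by
    by_cases h : z i = 0
    · exact ⟨1, 0, by simp [h], by simp⟩
    · have hpos : 0 < z i ^ 2 + z j ^ 2 := by positivity
      have hsq := Real.mul_self_sqrt hpos.le
      have hne : √(z i ^ 2 + z j ^ 2) ≠ 0 := (Real.sqrt_pos.2 hpos).ne'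
      set m := √(z i ^ 2 + z j ^ 2)
      refine ⟨z j / m, -z i / m, by ring, ?_⟩
      rw [div_mul_div_comm, div_mul_div_comm, ← add_div, hsq, div_eq_one_iff_eq hpos.ne']
      ring
  obtain ⟨α, β, hαβ, hn⟩ := h1
  have hs : ∀ (w : ι → ℝ) (k : ι), k ∈ T → NS T w (Pi.single k 1) = w k := by
    intro w k hk
    simp [NS, Pi.single_apply, hk]
  refine ⟨α • Pi.single i 1 + β • Pi.single j 1, ?_, ?_⟩
  · rw [NS_add_right, NS_smul_right, NS_smul_right, hs _ _ hi, hs _ _ hj, hαβ]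
  · rw [NS_add_right, NS_smul_right, NS_smul_right, hs _ _ hi, hs _ _ hj]
    simp [hij, hij.symm, hn]

/-- Unit null vectors. -/
def IsU (T : Finset ι) (v : ι → ℝ) : Prop := NS T v v = 1 ∧ NS Tᶜ v v = 1

lemma IsU.compl {T : Finset ι} {v : ι → ℝ} (h : IsU T v) : IsU Tᶜ v :=
  ⟨h.2, by rw [compl_compl]; exact h.1⟩

lemma IsU.ne_zero {T : Finset ι} {v : ι → ℝ} (h : IsU T v) : v ≠ 0 := by
  rintro rfl
  have := h.1
  simp [NS] at this

lemma IsU.null {T : Finset ι} {v : ι → ℝ} (h : IsU T v) : gB T v v = 0 := by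
  rw [gB, h.1, h.2, sub_self]

lemma IsU.piecewise {T : Finset ι} {y z : ι → ℝ} (hy : IsU T y) (hz : IsU T z) :
    IsU T (T.piecewise y z) := by
  have e1 : ∀ i ∈ T, T.piecewise y z i = y i := fun i hi => by simp [hi]
  have e2 : ∀ i ∈ Tᶜ, T.piecewise y z i = z i := fun i hi => by
    simp [Finset.mem_compl.1 hi]
  constructor
  · rw [NS_congr_left T e1, NS_congr_right T e1, hy.1]
  · rw [NS_congr_left Tᶜ e2, NS_congr_right Tᶜ e2, hz.2]

lemma move (T : Finset ι) (v : ι → ℝ) (hv : IsU T v)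
    (hb : ∀ z : ι → ℝ, ∃ b : ι → ℝ, NS Tᶜ z b = 0 ∧ NS Tᶜ b b = 1) (η : ℝ) (hη : 0 < η) :
    ∃ η' > 0, η' ≤ η ∧ ∀ z y : ι → ℝ, IsU T z → IsU T y → ‖z - v‖ < η' → ‖y - v‖ < η' →
      ∃ M : ι → ℝ, ‖M - v‖ < η ∧ NS T M M = NS Tᶜ M M ∧ NS T z M = NS Tᶜ z M ∧
        NS T (T.piecewise y z) M = NS Tᶜ (T.piecewise y z) M := by
  choose b hb1 hb2 using hb
  let lam : (ι → ℝ) × (ι → ℝ) → ℝ := fun x => (1 + NS T x.1 x.2) / 2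
  let M : (ι → ℝ) × (ι → ℝ) → ι → ℝ := fun x =>
    T.piecewise ((1 / 2 : ℝ) • (x.1 + x.2))
      (lam x • x.1 + √(lam x * (1 - lam x)) • b x.1)
  have hlamc : Continuous lam := by
    have := NS_continuous T
    fun_prop
  have hlamv : lam (v, v) = 1 := by simp only [lam, hv.1]; norm_num
  have hlam : Tendsto lam (𝓝 (v, v)) (𝓝 1) := by
    rw [← hlamv]; exact hlamc.tendsto _
  have hM : Tendsto M (𝓝 (v, v)) (𝓝 v) := by
    rw [tendsto_pi_nhds]
    intro i
    have t1 : Tendsto (fun x : (ι → ℝ) × (ι → ℝ) => x.1 i) (𝓝 (v, v)) (𝓝 (v i)) :=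
      (by fun_prop : Continuous (fun x : (ι → ℝ) × (ι → ℝ) => x.1 i)).tendsto (v, v)
    have t2 : Tendsto (fun x : (ι → ℝ) × (ι → ℝ) => x.2 i) (𝓝 (v, v)) (𝓝 (v i)) :=
      (by fun_prop : Continuous (fun x : (ι → ℝ) × (ι → ℝ) => x.2 i)).tendsto (v, v)
    by_cases hi : i ∈ T
    · simp only [M, Finset.piecewise_eq_of_mem _ _ _ hi, Pi.smul_apply, Pi.add_apply, smul_eq_mul]
      have := (t1.add t2).const_mul (1 / 2 : ℝ)
      convert this using 2
      ring
    · simp only [M, Finset.piecewise_eq_of_notMem _ _ _ hi, Pi.smul_apply, Pi.add_apply,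
        smul_eq_mul]
      have s1 : Tendsto (fun x => √(lam x * (1 - lam x))) (𝓝 (v, v)) (𝓝 0) := by
        have := (Real.continuous_sqrt.tendsto _).comp (hlam.mul (hlam.const_sub 1))
        simpa [Function.comp_def] using this
      have s2 : Tendsto (fun x : (ι → ℝ) × (ι → ℝ) => √(lam x * (1 - lam x)) * b x.1 i)
          (𝓝 (v, v)) (𝓝 0) := by
        refine squeeze_zero_norm (fun x => ?_) s1
        have hbi : b x.1 i * b x.1 i ≤ 1 := by
          rw [← hb2 x.1]
          exact Finset.single_le_sum (f := fun i => b x.1 i * b x.1 i)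
            (fun j _ => mul_self_nonneg _) (Finset.mem_compl.2 hi)
        have hbi' : |b x.1 i| ≤ 1 := by
          rw [← abs_one, ← sq_le_sq]; nlinarith
        rw [Real.norm_eq_abs, abs_mul, abs_of_nonneg (Real.sqrt_nonneg _)]
        exact mul_le_of_le_one_right (Real.sqrt_nonneg _) hbi'
      have := (hlam.mul t1).add s2
      simpa using this
  have hev : ∀ᶠ x in 𝓝 (v, v), M x ∈ Metric.ball v η := hM (Metric.ball_mem_nhds v hη)
  obtain ⟨δ, hδ, hδ'⟩ := Metric.eventually_nhds_iff.1 hev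
  refine ⟨min δ η, lt_min hδ hη, min_le_right _ _, ?_⟩
  intro z y hz hy dz dy
  refine ⟨M (z, y), ?_, ?_⟩
  · have := @hδ' (z, y) (by
      rw [Prod.dist_eq, max_lt_iff, dist_eq_norm, dist_eq_norm]
      exact ⟨dz.trans_le (min_le_left _ _), dy.trans_le (min_le_left _ _)⟩)
    rwa [Metric.mem_ball, dist_eq_norm] at this
  have hN1 : NS T z y ≤ 1 := by
    have := NS_nonneg T (z + (-1 : ℝ) • y)
    simp only [NS_add_left, NS_add_right, NS_smul_left, NS_smul_right, hz.1, hy.1,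
      NS_comm T y z] at this
    linarith
  have hN2 : -1 ≤ NS T z y := by
    have := NS_nonneg T (z + y)
    simp only [NS_add_left, NS_add_right, hz.1, hy.1, NS_comm T y z] at this
    linarith
  have hl : lam (z, y) = (1 + NS T z y) / 2 := rfl
  have hsq : √(lam (z, y) * (1 - lam (z, y))) * √(lam (z, y) * (1 - lam (z, y))) =
      lam (z, y) * (1 - lam (z, y)) := by
    refine Real.mul_self_sqrt (mul_nonneg ?_ ?_) <;> rw [hl] <;> linarith
  have m1 : ∀ i ∈ T, M (z, y) i = ((1 / 2 : ℝ) • (z + y)) i := fun i hi => by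
    simp only [M, Finset.piecewise_eq_of_mem _ _ _ hi]
  have m2 : ∀ i ∈ Tᶜ, M (z, y) i =
      (lam (z, y) • z + √(lam (z, y) * (1 - lam (z, y))) • b z) i := fun i hi => by
    simp only [M, Finset.piecewise_eq_of_notMem _ _ _ (Finset.mem_compl.1 hi)]
  have e1 : ∀ i ∈ T, T.piecewise y z i = y i := fun i hi => by simp [hi]
  have e2 : ∀ i ∈ Tᶜ, T.piecewise y z i = z i := fun i hi => by
    simp [Finset.mem_compl.1 hi]
  have hzz : NS Tᶜ z z = 1 := hz.2
  generalize √(lam (z, y) * (1 - lam (z, y))) = μ at hsq m2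
  generalize lam (z, y) = L at hl hsq m2
  refine ⟨?_, ?_, ?_⟩
  · rw [NS_congr_left T m1, NS_congr_right T m1, NS_congr_left Tᶜ m2, NS_congr_right Tᶜ m2]
    simp only [NS_add_left, NS_add_right, NS_smul_left, NS_smul_right, hz.1, hy.1, NS_comm T y z,
      hzz, hb1, hb2, NS_comm Tᶜ (b z) z]
    linear_combination (-1 : ℝ) * hsq - hl
  · rw [NS_congr_right T m1, NS_congr_right Tᶜ m2]
    simp only [NS_add_right, NS_smul_right, hz.1, hzz, hb1]
    linear_combination - hl
  · rw [NS_congr_left T e1, NS_congr_left Tᶜ e2, NS_congr_right T m1, NS_congr_right Tᶜ m2]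
    simp only [NS_add_right, NS_smul_right, hy.1, hzz, hb1, NS_comm T y z]
    linear_combination - hl

lemma gB_eq_zero_iff (S : Finset ι) (v w : ι → ℝ) : gB S v w = 0 ↔ NS S v w = NS Sᶜ v w := by
  rw [gB, sub_eq_zero, eq_comm]

lemma piecewise_near (T : Finset ι) (v y z : ι → ℝ) (η : ℝ) (hη : 0 < η) (hz : ‖z - v‖ < η)
    (hy : ‖y - v‖ < η) : ‖T.piecewise y z - v‖ < η := by
  rw [pi_norm_lt_iff hη] at *
  intro i
  by_cases hi : i ∈ T
  · simpa [hi] using hy i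
  · simpa [hi] using hz i

lemma local_vec (S : Finset ι) (Ω : Set (ℙ ℝ (ι → ℝ))) (v : ι → ℝ) (hv : IsU S v)
    (hb1 : ∀ z : ι → ℝ, ∃ b : ι → ℝ, NS S z b = 0 ∧ NS S b b = 1)
    (hb2 : ∀ z : ι → ℝ, ∃ b : ι → ℝ, NS Sᶜ z b = 0 ∧ NS Sᶜ b b = 1)
    (ρ : ℝ) (hρ : 0 < ρ)
    (hball : ∀ (w : ι → ℝ) (hw : w ≠ 0), gB S w w = 0 → ‖w - v‖ < ρ →
      Projectivization.mk ℝ w hw ∈ Ω) (ε : ℝ) (hε : 0 < ε) :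
    ∃ η > 0, ∀ (z y : ι → ℝ) (hz : IsU S z) (hy : IsU S y), ‖z - v‖ < η → ‖y - v‖ < η → ∀ a,
      markowitz (gB S) Ω a (Projectivization.mk ℝ y hy.ne_zero) ≤
        markowitz (gB S) Ω a (Projectivization.mk ℝ z hz.ne_zero) + ENNReal.ofReal ε := by
  obtain ⟨η, hη, hηv, hstep⟩ := step S Ω v hv.ne_zero ρ hρ hball (ε / 4) (by positivity)
  have hne : ∀ w : ι → ℝ, ‖w - v‖ < η → w ≠ 0 := by
    rintro w hw rfl
    rw [zero_sub, norm_neg] at hw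
    linarith
  obtain ⟨η1, h1, h1', hm1⟩ := move S v hv hb2 η hη
  obtain ⟨η2, h2, h2', hm2⟩ := move Sᶜ v hv.compl (by rw [compl_compl]; exact hb1) η hη
  rw [compl_compl] at hm2
  refine ⟨min η1 η2, lt_min h1 h2, ?_⟩
  intro z y hz hy dz dy a
  have hy' : IsU S (S.piecewise y z) := hy.piecewise hz
  have dy' := piecewise_near S v y z _ (lt_min h1 h2) dz dy
  obtain ⟨M, M1, M2, M3, M4⟩ := hm1 z y hz hy (dz.trans_le (min_le_left _ _))
    (dy.trans_le (min_le_left _ _))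
  obtain ⟨M', M1', M2', M3', M4'⟩ := hm2 (S.piecewise y z) y hy'.compl hy.compl
    (dy'.trans_le (min_le_right _ _)) (dy.trans_le (min_le_right _ _))
  have e : Sᶜ.piecewise y (S.piecewise y z) = y := by
    ext i
    by_cases hi : i ∈ S <;> simp [hi]
  rw [e] at M4'
  have hle : min η1 η2 ≤ η := (min_le_left _ _).trans h1'
  have s1 := hstep z M hz.ne_zero (hne M M1) hz.null ((gB_eq_zero_iff S _ _).2 M2)
    ((gB_eq_zero_iff S _ _).2 M3) (dz.trans_le hle) M1 a
  have s2 := hstep M (S.piecewise y z) (hne M M1) hy'.ne_zero ((gB_eq_zero_iff S _ _).2 M2)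
    hy'.null (by rw [gB_comm]; exact (gB_eq_zero_iff S _ _).2 M4) M1 (dy'.trans_le hle) a
  have s3 := hstep (S.piecewise y z) M' hy'.ne_zero (hne M' M1') hy'.null
    ((gB_eq_zero_iff S _ _).2 M2'.symm)
    ((gB_eq_zero_iff S _ _).2 M3'.symm) (dy'.trans_le hle) M1' a
  have s4 := hstep M' y (hne M' M1') hy.ne_zero ((gB_eq_zero_iff S _ _).2 M2'.symm)
    hy.null (by rw [gB_comm]; exact (gB_eq_zero_iff S _ _).2 M4'.symm) M1' (dy.trans_le hle) a
  have e4 : ENNReal.ofReal ε = ENNReal.ofReal (ε / 4) + ENNReal.ofReal (ε / 4) +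
      ENNReal.ofReal (ε / 4) + ENNReal.ofReal (ε / 4) := by
    rw [← ENNReal.ofReal_add, ← ENNReal.ofReal_add, ← ENNReal.ofReal_add] <;> try positivity
    congr 1; ring
  rw [e4, ← add_assoc, ← add_assoc, ← add_assoc]
  refine s4.trans (add_le_add_left (s3.trans (add_le_add_left (s2.trans
    (add_le_add_left s1 _)) _)) _)

lemma normalize_null (S : Finset ι) (w : ι → ℝ) (hw : w ≠ 0) (h : gB S w w = 0) :
    0 < NS S w w ∧ IsU S ((√(NS S w w))⁻¹ • w) := by
  rw [gB_eq_zero_iff] at h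
  have hpos : 0 < NS S w w := by
    refine lt_of_le_of_ne (NS_nonneg S w) fun h0 => hw ?_
    have h1 := h0.symm
    have h2 := h.symm.trans h1
    ext i
    by_cases hi : i ∈ S
    · exact mul_self_eq_zero.1
        ((Finset.sum_eq_zero_iff_of_nonneg fun j _ => mul_self_nonneg (w j)).1 h1 i hi)
    · exact mul_self_eq_zero.1
        ((Finset.sum_eq_zero_iff_of_nonneg fun j _ => mul_self_nonneg (w j)).1 h2 i
          (Finset.mem_compl.2 hi))
  refine ⟨hpos, ?_⟩
  have hs := Real.mul_self_sqrt hpos.le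
  have hne := (Real.sqrt_pos.2 hpos).ne'
  have : (√(NS S w w))⁻¹ * ((√(NS S w w))⁻¹ * NS S w w) = 1 := by
    conv_lhs => enter [2, 2]; rw [← hs]
    field_simp
  constructor
  · rw [NS_smul_left, NS_smul_right, this]
  · rw [NS_smul_left, NS_smul_right, ← h, this]

lemma mk_normalize (S : Finset ι) (w : ι → ℝ) (hw : w ≠ 0) (h : 0 < NS S w w)
    (hn : (√(NS S w w))⁻¹ • w ≠ 0) :
    Projectivization.mk ℝ ((√(NS S w w))⁻¹ • w) hn = Projectivization.mk ℝ w hw :=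
  (Projectivization.mk_eq_mk_iff' ℝ _ _ _ _).2 ⟨_, rfl⟩

lemma exists_ball (S : Finset ι) (Ω : Set (ℙ ℝ (ι → ℝ)))
    (hop : IsOpen (Subtype.val ⁻¹' Ω : Set (einSet (gB S)))) (v : ι → ℝ) (hv : v ≠ 0)
    (hnull : gB S v v = 0) (hvΩ : Projectivization.mk ℝ v hv ∈ Ω) :
    ∃ ρ > 0, ∀ (w : ι → ℝ) (hw : w ≠ 0), gB S w w = 0 → ‖w - v‖ < ρ →
      Projectivization.mk ℝ w hw ∈ Ω := by
  obtain ⟨O, hO, hOe⟩ := isOpen_induced_iff.1 hop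
  have hmem : ∀ y ∈ einSet (gB S), (y ∈ O ↔ y ∈ Ω) := by
    intro y hy
    exact Set.ext_iff.1 hOe ⟨y, hy⟩
  have h1 : IsOpen (prj ⁻¹' O : Set {v : ι → ℝ // v ≠ 0}) := hO.preimage prj_continuous
  obtain ⟨ρ, hρ, hb⟩ := Metric.isOpen_iff.1 h1 ⟨v, hv⟩
    ((hmem _ ((mk_mem_einSet S v hv).2 hnull)).2 hvΩ)
  refine ⟨ρ, hρ, fun w hw hwn hd => ?_⟩
  refine (hmem _ ((mk_mem_einSet S w hw).2 hwn)).1 ?_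
  have : (⟨w, hw⟩ : {v : ι → ℝ // v ≠ 0}) ∈ Metric.ball (⟨v, hv⟩ : {v : ι → ℝ // v ≠ 0}) ρ := by
    rw [Metric.mem_ball, Subtype.dist_eq, dist_eq_norm]; exact hd
  exact hb this

lemma nhds_A (S : Finset ι) (v : ι → ℝ) (hv : IsU S v) (η : ℝ) (hη : 0 < η) :
    {w : {v : ι → ℝ // v ≠ 0} | 0 < NS S w.1 w.1 ∧ ‖(√(NS S w.1 w.1))⁻¹ • w.1 - v‖ < η} ∈
      𝓝 (⟨v, hv.ne_zero⟩ : {v : ι → ℝ // v ≠ 0}) := by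
  have hcN : Continuous (fun w : ι → ℝ => NS S w w) :=
    (NS_continuous S).comp (continuous_id.prodMk continuous_id)
  have h1 : ∀ᶠ w in 𝓝 v, 0 < NS S w w := by
    refine hcN.continuousAt.eventually (lt_mem_nhds ?_)
    simp [hv.1]
  have h3 : ContinuousAt (fun w : ι → ℝ => (√(NS S w w))⁻¹) v := by
    refine ContinuousAt.inv₀ (Real.continuous_sqrt.comp hcN).continuousAt ?_
    simp [hv.1]
  have h4 : ContinuousAt (fun w : ι → ℝ => ‖(√(NS S w w))⁻¹ • w - v‖) v :=
    ((h3.smul continuousAt_id).sub continuousAt_const).norm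
  have h2 : ∀ᶠ w in 𝓝 v, ‖(√(NS S w w))⁻¹ • w - v‖ < η := by
    refine h4.eventually (gt_mem_nhds ?_)
    simpa [hv.1] using hη
  have h5 : Tendsto (Subtype.val : {v : ι → ℝ // v ≠ 0} → ι → ℝ)
    (𝓝 ⟨v, hv.ne_zero⟩) (𝓝 v) := continuous_subtype_val.tendsto _
  exact h5.eventually (h1.and h2)

lemma local_proj (S : Finset ι) (Ω : Set (ℙ ℝ (ι → ℝ))) (hΩ : Ω ⊆ einSet (gB S))
    (hop : IsOpen (Subtype.val ⁻¹' Ω : Set (einSet (gB S))))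
    (hb1 : ∀ z : ι → ℝ, ∃ b : ι → ℝ, NS S z b = 0 ∧ NS S b b = 1)
    (hb2 : ∀ z : ι → ℝ, ∃ b : ι → ℝ, NS Sᶜ z b = 0 ∧ NS Sᶜ b b = 1)
    (x : ℙ ℝ (ι → ℝ)) (hx : x ∈ Ω) :
    markowitz (gB S) Ω x x = 0 ∧ ∀ ε : ℝ, 0 < ε → ∃ U ∈ 𝓝 x, ∀ y ∈ U ∩ Ω, ∀ z ∈ U ∩ Ω, ∀ a,
      markowitz (gB S) Ω a z ≤ markowitz (gB S) Ω a y + ENNReal.ofReal ε := by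
  obtain ⟨hp, hv⟩ := normalize_null S x.rep x.rep_nonzero (hΩ hx)
  have hxv := mk_normalize S x.rep x.rep_nonzero hp hv.ne_zero
  rw [x.mk_rep] at hxv
  generalize (√(NS S x.rep x.rep))⁻¹ • x.rep = v at hv hxv
  subst hxv
  obtain ⟨ρ, hρ, hball⟩ := exists_ball S Ω hop v hv.ne_zero hv.null hx
  constructor
  · obtain ⟨b1, p1, p2⟩ := hb1 v
    obtain ⟨b2, q1, q2⟩ := hb2 v
    set e := S.piecewise b1 b2 with he
    have e1 : ∀ i ∈ S, e i = b1 i := fun i hi => by simp [he, hi]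
    have e2 : ∀ i ∈ Sᶜ, e i = b2 i := fun i hi => by simp [he, Finset.mem_compl.1 hi]
    have f1 : NS S v e = 0 := by rw [NS_congr_right S e1, p1]
    have f2 : NS Sᶜ v e = 0 := by rw [NS_congr_right Sᶜ e2, q1]
    have f3 : IsU S e := ⟨by rw [NS_congr_right S e1, NS_congr_left S e1, p2],
      by rw [NS_congr_right Sᶜ e2, NS_congr_left Sᶜ e2, q2]⟩
    have f4 : gB S e v = 0 := by rw [gB_comm, gB, f1, f2, sub_zero]
    have hen : 0 < ‖e‖ := norm_pos_iff.2 f3.ne_zero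
    obtain ⟨α, hα, hα'⟩ := geo_exists S Ω v e (ρ / ‖e‖) (by positivity) (by
      intro s t hst
      have g : NS S v (s • e + t • v) = 0 := by rw [hst]; simp [NS]
      rw [NS_add_right, NS_smul_right, NS_smul_right, f1, hv.1] at g
      have ht : t = 0 := by linarith
      rw [ht, zero_smul, add_zero] at hst
      exact ⟨(smul_eq_zero.1 hst).resolve_right f3.ne_zero, ht⟩) f3.null f4 hv.null (by
      intro t ht h
      refine hball _ h ?_ ?_
      · simp only [gB_add_left, gB_add_right, gB_smul_left, gB_smul_right, f4, hv.null, f3.null,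
          gB_comm S v e]; ring
      · rw [add_sub_cancel_left, norm_smul, Real.norm_eq_abs, abs_mul, abs_of_pos (by positivity)]
        have ht' : |t| < 1 := abs_lt.2 ht
        calc ρ / ‖e‖ * |t| * ‖e‖ = ρ * |t| := by field_simp
          _ < ρ := by nlinarith)
    have hm := markowitz_le_one S Ω α hα 0 0 (by simp [II]) (by simp [II])
    obtain ⟨q0, hq0⟩ := hα' 0
    have k0 : α 0 = Projectivization.mk ℝ v hv.ne_zero := by rw [hq0]; simp
    rw [k0] at hm
    simpa [dHyp] using hm
  intro ε hε
  obtain ⟨η, hη, hloc⟩ := local_vec S Ω v hv hb1 hb2 ρ hρ hball ε hε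
  let A : Set {v : ι → ℝ // v ≠ 0} :=
    {w | 0 < NS S w.1 w.1 ∧ ‖(√(NS S w.1 w.1))⁻¹ • w.1 - v‖ < η}
  have hA : A ∈ 𝓝 (⟨v, hv.ne_zero⟩ : {v : ι → ℝ // v ≠ 0}) := nhds_A S v hv η hη
  refine ⟨prj '' A, prj_isOpenMap.image_mem_nhds hA, ?_⟩
  rintro _ ⟨⟨y, ⟨yA1, yA2⟩, rfl⟩, hyΩ⟩ _ ⟨⟨z, ⟨zA1, zA2⟩, rfl⟩, hzΩ⟩ a
  obtain ⟨_, hyU⟩ := normalize_null S y.1 y.2 ((mk_mem_einSet S y.1 y.2).1 (hΩ hyΩ))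
  obtain ⟨_, hzU⟩ := normalize_null S z.1 z.2 ((mk_mem_einSet S z.1 z.2).1 (hΩ hzΩ))
  have := hloc _ _ hyU hzU yA2 zA2 a
  rw [mk_normalize S y.1 y.2 yA1, mk_normalize S z.1 z.2 zA1] at this
  exact this

lemma main_aux (S : Finset ι) (Ω : Set (ℙ ℝ (ι → ℝ))) (hΩ : IsProperDomain (gB S) Ω)
    (hb1 : ∀ z : ι → ℝ, ∃ b : ι → ℝ, NS S z b = 0 ∧ NS S b b = 1)
    (hb2 : ∀ z : ι → ℝ, ∃ b : ι → ℝ, NS Sᶜ z b = 0 ∧ NS Sᶜ b b = 1) :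
    (∀ x ∈ Ω, ∀ y ∈ Ω, markowitz (gB S) Ω x y ≠ ⊤) ∧
    ∀ x ∈ Ω, ∀ xs : ℕ → ℙ ℝ (ι → ℝ), (∀ k, xs k ∈ Ω) →
      (Tendsto xs atTop (𝓝 x) ↔
        Tendsto (fun k => markowitz (gB S) Ω x (xs k)) atTop (𝓝 0)) := by
  obtain ⟨⟨hsub, hop, hconn⟩, x0, hx0, hdisj⟩ := hΩ
  have hloc := local_proj S Ω hsub hop hb1 hb2
  constructor
  · intro x hx y hy
    have hpre : IsPreconnected Ω := by
      have := hconn.isPreconnected.image _ continuous_subtype_val.continuousOn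
      rwa [Subtype.image_preimage_coe, inter_eq_self_of_subset_right hsub] at this
    have := hpre.induction₂' (fun y z => (markowitz (gB S) Ω x y ≠ ⊤ ↔ markowitz (gB S) Ω x z ≠ ⊤))
      (by
        intro w hw
        obtain ⟨U, hU, h⟩ := (hloc w hw).2 1 one_pos
        have hwU : w ∈ U ∩ Ω := ⟨mem_of_mem_nhds hU, hw⟩
        have key : ∀ y ∈ U ∩ Ω, ∀ z ∈ U ∩ Ω, markowitz (gB S) Ω x y ≠ ⊤ →
            markowitz (gB S) Ω x z ≠ ⊤ := by
          intro y hy z hz hne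
          exact ne_top_of_le_ne_top (ENNReal.add_ne_top.2 ⟨hne, ENNReal.ofReal_ne_top⟩)
            (h y hy z hz x)
        filter_upwards [inter_mem (mem_nhdsWithin_of_mem_nhds hU) self_mem_nhdsWithin] with y hy
        exact ⟨⟨key w hwU y hy, key y hy w hwU⟩, ⟨key y hy w hwU, key w hwU y hy⟩⟩)
      (by
        intro a b c _ _ _ h1 h2
        exact h1.trans h2) hx hy
    refine this.1 ?_
    rw [(hloc x hx).1]; exact ENNReal.zero_ne_top
  · intro x hx xs hxs
    constructor
    · intro ht
      rw [ENNReal.tendsto_nhds_zero]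
      intro ε hε
      obtain ⟨r, hr, hrε⟩ : ∃ r : ℝ, 0 < r ∧ ENNReal.ofReal r ≤ ε := by
        rcases eq_or_ne ε ⊤ with h | h
        · exact ⟨1, one_pos, by simp [h]⟩
        · exact ⟨ε.toReal, ENNReal.toReal_pos hε.ne' h, ENNReal.ofReal_toReal_le⟩
      obtain ⟨U, hU, h⟩ := (hloc x hx).2 r hr
      filter_upwards [ht hU] with k hk
      have := h x ⟨mem_of_mem_nhds hU, hx⟩ (xs k) ⟨hk, hxs k⟩ x
      rw [(hloc x hx).1, zero_add] at this
      exact this.trans hrε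
    · intro ht
      obtain ⟨h0, R, hR⟩ := hat_bounded S Ω hsub x0 hdisj
      refine tendsto_of_hat S x0.rep x xs (h0 x hx) (fun k => h0 _ (hxs k)) fun i => ?_
      have hpos : ∀ y ∈ Ω, 0 < R + 1 + hat S x0.rep y i := by
        intro y hy
        have := (abs_le.1 (hR y hy i)).1
        linarith
      have h2 : Tendsto (fun k => 2 * markowitz (gB S) Ω x (xs k)) atTop (𝓝 0) := by
        have := ENNReal.Tendsto.const_mul (a := 2) ht (Or.inr (by simp))
        simpa using this
      have h3 := tendsto_of_tendsto_of_tendsto_of_le_of_le tendsto_const_nhds h2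
        (fun k => bot_le) (fun k => markowitz_lower S Ω x0.rep R h0 hR x (xs k) i)
      have h4 := (ENNReal.tendsto_toReal ENNReal.zero_ne_top).comp h3
      simp only [Function.comp_def, ENNReal.toReal_ofReal (abs_nonneg _), ENNReal.toReal_zero] at h4
      have h5 := (tendsto_zero_iff_abs_tendsto_zero _).2 h4
      have h6 := h5.add_const (Real.log (R + 1 + hat S x0.rep x i))
      simp only [sub_add_cancel, zero_add] at h6
      have h7 := (Real.continuous_exp.tendsto _).comp h6
      simp only [Function.comp_def, Real.exp_log (hpos x hx),
        fun k => Real.exp_log (hpos _ (hxs k))] at h7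
      have h8 := h7.sub_const (R + 1)
      simpa using h8

end aux

/-- On a proper domain, the Markowitz pseudodistance is finite and
induces the standard topology. -/
theorem stmt_6 (p q : ℕ) (hp : 1 ≤ p) (hq : 1 ≤ q)
    (Ω : Set (ℙ ℝ (Fin (p + q + 2) → ℝ)))
    (hΩ : IsProperDomain (bForm p q) Ω) :
    (∀ x ∈ Ω, ∀ y ∈ Ω, markowitz (bForm p q) Ω x y ≠ ⊤) ∧
    ∀ x ∈ Ω, ∀ xs : ℕ → ℙ ℝ (Fin (p + q + 2) → ℝ), (∀ k, xs k ∈ Ω) →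
      (Tendsto xs atTop (𝓝 x) ↔
        Tendsto (fun k => markowitz (bForm p q) Ω x (xs k)) atTop (𝓝 0)) := by
  classical
  let S : Finset (Fin (p + q + 2)) := Finset.univ.filter fun i => (i : ℕ) ≤ p
  have hB : bForm p q = gB S := by
    funext v w
    have h1 : NS S v w = ∑ i : Fin (p + q + 2), if (i : ℕ) ≤ p then v i * w i else 0 := by
      rw [NS, Finset.sum_filter]
    have h2 : NS Sᶜ v w = ∑ i : Fin (p + q + 2), if (i : ℕ) ≤ p then 0 else v i * w i := by
      rw [NS, ← Finset.sum_ite_mem_eq]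
      refine Finset.sum_congr rfl fun i _ => ?_
      by_cases h : (i : ℕ) ≤ p <;> simp [S, h]
    rw [gB, h1, h2, ← Finset.sum_sub_distrib, bForm]
    refine Finset.sum_congr rfl fun i _ => ?_
    split_ifs <;> ring
  rw [hB] at hΩ ⊢
  refine main_aux S Ω hΩ ?_ ?_
  · refine exists_orth S ⟨0, by omega⟩ ⟨1, by omega⟩ ?_ ?_ ?_
    · simp [S]
    · simp [S, hp]
    · simp
  · refine exists_orth Sᶜ ⟨p + 1, by omega⟩ ⟨p + 2, by omega⟩ ?_ ?_ ?_
    · simp [S]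
    · simp [S]
    · simp
end
end
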